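/- For every ε > 0 there exist constants c_ε ≥ 1 and C_ε ≥ 1, depending only on ε, such that for every R ≥ 1 and every convex function γ : [0,1] → ℝ with 0 ≤ γ'_R(0) ≤ γ'_L(1) ≤ 1, there exists an ideal partition 𝒥 of [0,1] with parameters ε, R and constant c_ε such that for every exponent q with 2 ≤ q ≤ 6 and every Schwartz function f : ℝ² → ℂ whose Fourier transform is supported in N_{R^{−1}}(Γ), one has ‖f‖_{L^q(ℝ²)} ≤ C_ε · R^{ε} · (Σ_{J ∈ 𝒥} ‖f_J‖²_{L^q(ℝ²)})^{1/2}. -/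

import Mathlib

open MeasureTheory Set
open scoped FourierTransform ENNReal

noncomputable section

/-- The plane `ℝ²` with the Euclidean norm. -/
abbrev E2 := EuclideanSpace ℝ (Fin 2)

/-- `γR` and `γL` are the one-sided derivatives of `γ` on the interval `[a,b]`:
the right derivative is defined on `[a,b)` and the left derivative on `(a,b]`. -/
def HasOneSidedDerivs (γ γR γL : ℝ → ℝ) (a b : ℝ) : Prop :=
  (∀ x ∈ Set.Ico a b, HasDerivWithinAt γ (γR x) (Set.Ioc x b) x) ∧
  (∀ x ∈ Set.Ioc a b, HasDerivWithinAt γ (γL x) (Set.Ico a x) x)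

/-- The curve `Γ = {(t, γ t) : t ∈ [0,1]} ⊆ ℝ²`. -/
def curveGraph (γ : ℝ → ℝ) : Set E2 :=
  {p : E2 | p 0 ∈ Icc (0:ℝ) 1 ∧ p 1 = γ (p 0)}

/-- The line `{x : ⟪w,x⟫ = c}` (with `w ≠ 0`) is a supporting line for `Γ`:
it meets the closure of `Γ` and `Γ` lies in one of the two closed half-planes it bounds. -/
def IsSupportingLine (γ : ℝ → ℝ) (w : E2) (c : ℝ) : Prop :=
  w ≠ 0 ∧ (∃ x ∈ closure (curveGraph γ), inner (𝕜 := ℝ) w x = c) ∧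
    ((∀ x ∈ curveGraph γ, inner (𝕜 := ℝ) w x ≤ c) ∨
      (∀ x ∈ curveGraph γ, c ≤ inner (𝕜 := ℝ) w x))

/-- The cap `B(ℓ, r)`: points of `Γ` at distance `< r` from the line
`ℓ = {x : ⟪w,x⟫ = c}`; the distance from `ξ` to `ℓ` is `|⟪w,ξ⟫ − c|/‖w‖`. -/
def cap (γ : ℝ → ℝ) (w : E2) (c r : ℝ) : Set E2 :=
  {ξ : E2 | ξ ∈ curveGraph γ ∧ |inner (𝕜 := ℝ) w ξ - c| / ‖w‖ < r}

/-- `capNumber γ r` is `N(Γ, r)`: the minimal number of caps `B(ℓ, r)` over supporting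
lines `ℓ` needed to cover `Γ`. -/
def capNumber (γ : ℝ → ℝ) (r : ℝ) : ℕ :=
  sInf {n : ℕ | ∃ (w : Fin n → E2) (c : Fin n → ℝ),
    (∀ i, IsSupportingLine γ (w i) (c i)) ∧
    curveGraph γ ⊆ ⋃ i, cap γ (w i) (c i) r}

/-- The vertical `r`-neighbourhood `N_r(Γ) = {ξ : ξ₁ ∈ [0,1], |ξ₂ − γ(ξ₁)| ≤ r}`. -/
def vnbhd (γ : ℝ → ℝ) (r : ℝ) : Set E2 :=
  {ξ : E2 | ξ 0 ∈ Icc (0:ℝ) 1 ∧ |ξ 1 - γ (ξ 0)| ≤ r}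

/-- The Fourier projection `f_J`, defined by `𝓕 f_J (ξ) = 𝓕 f (ξ) · 1_J(ξ₁)`, i.e. as the
inverse Fourier transform of the cut-off of `𝓕 f` to the vertical strip over `J`. -/
def fourierProj (f : E2 → ℂ) (J : Set ℝ) : E2 → ℂ :=
  𝓕⁻ (Set.indicator {ξ : E2 | ξ 0 ∈ J} (𝓕 f))


namespace HighLow

/-! ### Plancherel for integrable functions -/

lemma integral_mul_fourierInv {f g : E2 → ℂ} (hf : Integrable f) (hg : Integrable g) :
    ∫ ξ, 𝓕⁻ f ξ * g ξ = ∫ x, f x * 𝓕⁻ g x := by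
  have h := VectorFourier.integral_bilin_fourierIntegral_eq_flip (ContinuousLinearMap.mul ℂ ℂ)
    (L := innerₗ E2) Real.continuous_fourierChar continuous_inner hf hg.comp_neg
  simp only [ContinuousLinearMap.mul_apply'] at h
  have e1 : ∀ ξ, VectorFourier.fourierIntegral Real.fourierChar volume (innerₗ E2) f ξ = 𝓕 f ξ :=
    fun ξ => rfl
  have e2 : ∀ x, VectorFourier.fourierIntegral Real.fourierChar volume (innerₗ E2).flip
      (fun x => g (-x)) x = 𝓕⁻ g x := by
    intro x
    rw [Real.fourierInv_eq_fourier_comp_neg]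
    rw [flip_innerₗ]; rfl
  simp only [e1, e2] at h
  rw [← h, ← integral_neg_eq_self]
  simp only [Real.fourierInv_eq_fourier_neg, neg_neg]

lemma fourierInv_continuous {g : E2 → ℂ} (hg : Integrable g) : Continuous (𝓕⁻ g) := by
  have : Continuous (𝓕 g) := VectorFourier.fourierIntegral_continuous
    Real.continuous_fourierChar continuous_inner hg
  have e : 𝓕⁻ g = fun x => 𝓕 g (-x) := by ext x; exact Real.fourierInv_eq_fourier_neg g x
  rw [e]; exact this.comp continuous_neg

lemma fourier_continuous {g : E2 → ℂ} (hg : Integrable g) : Continuous (𝓕 g) :=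
  VectorFourier.fourierIntegral_continuous Real.continuous_fourierChar continuous_inner hg

lemma norm_fourierInv_le (g : E2 → ℂ) (x : E2) : ‖𝓕⁻ g x‖ ≤ ∫ ξ, ‖g ξ‖ := by
  rw [Real.fourierInv_eq]
  refine (norm_integral_le_integral_norm _).trans (le_of_eq ?_)
  simp

lemma norm_fourier_le (g : E2 → ℂ) (x : E2) : ‖𝓕 g x‖ ≤ ∫ ξ, ‖g ξ‖ := by
  rw [Real.fourier_eq]
  refine (norm_integral_le_integral_norm _).trans (le_of_eq ?_)
  simp

lemma ae_eq_of_schwartz {f g : E2 → ℂ} (hf : LocallyIntegrable f) (hg : LocallyIntegrable g)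
    (h : ∀ φ : SchwartzMap E2 ℂ, ∫ x, φ x * f x = ∫ x, φ x * g x) : f =ᵐ[volume] g := by
  refine ae_eq_of_integral_contDiff_smul_eq hf hg fun φ hφ hc => ?_
  have hc' : HasCompactSupport (fun x => (φ x : ℂ)) := hc.comp_left (g := ((↑) : ℝ → ℂ)) rfl
  have hs : ContDiff ℝ (⊤ : ℕ∞) (fun x => (φ x : ℂ)) := Complex.ofRealCLM.contDiff.comp hφ
  have := h (hc'.toSchwartzMap hs)
  simpa [Complex.real_smul] using this

lemma ae_eq_fourierInv {g : E2 → ℂ} (hg : Integrable g) (hg2 : MemLp g 2) :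
    ((𝓕⁻ (hg2.toLp g) : Lp ℂ 2 (volume : Measure E2)) : E2 → ℂ) =ᵐ[volume] 𝓕⁻ g := by
  refine ae_eq_of_schwartz ((Lp.memLp _).locallyIntegrable (by norm_num))
    (fourierInv_continuous hg).locallyIntegrable fun φ => ?_
  have h := DFunLike.congr_fun (Lp.fourierInv_toTemperedDistribution_eq (hg2.toLp g)) φ
  rw [TemperedDistribution.fourierInv_apply, Lp.toTemperedDistribution_apply,
    Lp.toTemperedDistribution_apply] at h
  simp only [smul_eq_mul] at h
  rw [← h]
  rw [← integral_mul_fourierInv φ.integrable hg]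
  refine integral_congr_ae ?_
  filter_upwards [hg2.coeFn_toLp] with x hx
  rw [hx, SchwartzMap.fourierInv_coe]

lemma ae_eq_of_fourierInv_memLp {g : E2 → ℂ} (hg : Integrable g) (hg2 : MemLp (𝓕⁻ g) 2) :
    ((𝓕 (hg2.toLp _) : Lp ℂ 2 (volume : Measure E2)) : E2 → ℂ) =ᵐ[volume] g := by
  refine ae_eq_of_schwartz ((Lp.memLp _).locallyIntegrable (by norm_num))
    hg.locallyIntegrable fun φ => ?_
  have h := DFunLike.congr_fun (Lp.fourier_toTemperedDistribution_eq (hg2.toLp _)) φ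
  rw [TemperedDistribution.fourier_apply, Lp.toTemperedDistribution_apply,
    Lp.toTemperedDistribution_apply] at h
  simp only [smul_eq_mul] at h
  rw [← h]
  have e : ∫ x, (𝓕 φ) x * ((hg2.toLp _ : Lp ℂ 2 (volume : Measure E2)) : E2 → ℂ) x
      = ∫ x, (𝓕 φ) x * 𝓕⁻ g x := by
    refine integral_congr_ae ?_
    filter_upwards [hg2.coeFn_toLp] with x hx
    rw [hx]
  rw [e, ← integral_mul_fourierInv (𝓕 φ).integrable hg]
  have : (𝓕⁻ ((𝓕 φ : SchwartzMap E2 ℂ) : E2 → ℂ)) = φ := by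
    rw [← SchwartzMap.fourierInv_coe]; simp
  rw [this]

lemma fourierInv_memLp {g : E2 → ℂ} (hg : Integrable g) (hg2 : MemLp g 2) :
    MemLp (𝓕⁻ g) 2 :=
  (memLp_congr_ae (ae_eq_fourierInv hg hg2)).1 (Lp.memLp _)

lemma memLp_of_fourierInv {g : E2 → ℂ} (hg : Integrable g) (hg2 : MemLp (𝓕⁻ g) 2) :
    MemLp g 2 :=
  (memLp_congr_ae (ae_eq_of_fourierInv_memLp hg hg2)).1 (Lp.memLp _)

lemma eLpNorm_fourierInv {g : E2 → ℂ} (hg : Integrable g) (hg2 : MemLp (𝓕⁻ g) 2) :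
    eLpNorm g 2 = eLpNorm (𝓕⁻ g) 2 := by
  have h := Lp.norm_fourier_eq (hg2.toLp _)
  rw [← eLpNorm_congr_ae (ae_eq_of_fourierInv_memLp hg hg2),
    ← eLpNorm_congr_ae hg2.coeFn_toLp]
  rw [Lp.norm_def, Lp.norm_def] at h
  exact (ENNReal.toReal_eq_toReal_iff' (Lp.eLpNorm_ne_top _) (Lp.eLpNorm_ne_top _)).1 h

lemma integral_sq_eq {f g : E2 → ℂ} (hf : MemLp f 2) (hg : MemLp g 2)
    (h : eLpNorm f 2 = eLpNorm g 2) : ∫ x, ‖f x‖ ^ 2 = ∫ x, ‖g x‖ ^ 2 := by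
  have := congrArg (fun t => t.toReal ^ 2) h
  have key : ∀ {u : E2 → ℂ}, MemLp u 2 → (eLpNorm u 2).toReal ^ 2 = ∫ x, ‖u x‖ ^ 2 := by
    intro u hu
    rw [MemLp.eLpNorm_eq_integral_rpow_norm two_ne_zero ENNReal.ofNat_ne_top hu]
    have h0 : 0 ≤ ∫ x, ‖u x‖ ^ 2 := integral_nonneg fun x => by positivity
    simp only [ENNReal.toReal_ofNat, Real.rpow_ofNat]
    rw [ENNReal.toReal_ofReal (by positivity), ← Real.rpow_natCast, ← Real.rpow_mul h0]
    norm_num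
  rwa [key hf, key hg] at this

lemma integral_sq_fourierInv {g : E2 → ℂ} (hg : Integrable g) (hg2 : MemLp (𝓕⁻ g) 2) :
    ∫ x, ‖𝓕⁻ g x‖ ^ 2 = ∫ ξ, ‖g ξ‖ ^ 2 :=
  (integral_sq_eq (memLp_of_fourierInv hg hg2) hg2 (eLpNorm_fourierInv hg hg2)).symm


/-! ### Band-limited functions -/

/-- `f` is square integrable and the inverse Fourier transform of an integrable function
vanishing off `S`. -/
def BL (S : Set E2) (f : E2 → ℂ) : Prop :=
  MemLp f 2 ∧ ∃ g : E2 → ℂ, Integrable g ∧ (∀ ξ, ξ ∉ S → g ξ = 0) ∧ f = 𝓕⁻ g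

/-- Convolution of `K` with `f`. -/
def cv (K f : E2 → ℂ) (x : E2) : ℂ := ∫ z, K z * f (x - z)

lemma integrable_char_mul {g : E2 → ℂ} (hg : Integrable g) (x : E2) :
    Integrable (fun ξ => (Real.fourierChar (inner ℝ ξ x)) • g ξ) := by
  have := (Real.fourierIntegral_convergent_iff (-x)).2 hg
  simpa [inner_neg_right] using this

lemma fourierInv_add {f g : E2 → ℂ} (hf : Integrable f) (hg : Integrable g) :
    𝓕⁻ (fun ξ => f ξ + g ξ) = fun x => 𝓕⁻ f x + 𝓕⁻ g x := by
  ext x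
  simp only [Real.fourierInv_eq, smul_add]
  exact integral_add (integrable_char_mul hf x) (integrable_char_mul hg x)

lemma fourierInv_smul (c : ℂ) (f : E2 → ℂ) :
    𝓕⁻ (fun ξ => c * f ξ) = fun x => c * 𝓕⁻ f x := by
  ext x
  simp only [Real.fourierInv_eq]
  rw [← integral_const_mul]
  congr 1; ext ξ
  simp only [Circle.smul_def, smul_eq_mul]; ring

lemma fourierInv_sum {ι : Type*} (s : Finset ι) {g : ι → E2 → ℂ}
    (hg : ∀ i ∈ s, Integrable (g i)) :
    𝓕⁻ (fun ξ => ∑ i ∈ s, g i ξ) = fun x => ∑ i ∈ s, 𝓕⁻ (g i) x := by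
  ext x
  simp only [Real.fourierInv_eq, Finset.smul_sum]
  exact integral_finsetSum _ fun i hi => integrable_char_mul (hg i hi) x

lemma memLp_two_of_bdd {g : E2 → ℂ} (hg : Integrable g) {C : ℝ} (h : ∀ x, ‖g x‖ ≤ C) :
    MemLp g 2 := by
  rw [memLp_two_iff_integrable_sq_norm hg.1]
  refine (hg.norm.const_mul C).mono' (hg.1.norm.pow 2) (ae_of_all _ fun x => ?_)
  rw [Real.norm_of_nonneg (by positivity), sq]
  exact mul_le_mul_of_nonneg_right (h x) (norm_nonneg _)

lemma integrable_sq {f : E2 → ℂ} (hf : MemLp f 2) : Integrable (fun x => ‖f x‖ ^ 2) :=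
  (memLp_two_iff_integrable_sq_norm hf.1).1 hf

namespace BL

variable {S T : Set E2} {f h : E2 → ℂ}

lemma of_fourierInv {g : E2 → ℂ} (hg : Integrable g) (hg2 : MemLp g 2)
    (hS : ∀ ξ, ξ ∉ S → g ξ = 0) : BL S (𝓕⁻ g) :=
  ⟨fourierInv_memLp hg hg2, g, hg, hS, rfl⟩

lemma cont (hf : BL S f) : Continuous f := by
  obtain ⟨-, g, hg, -, rfl⟩ := hf; exact fourierInv_continuous hg

lemma bdd (hf : BL S f) : ∃ C, 0 ≤ C ∧ ∀ x, ‖f x‖ ≤ C := by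
  obtain ⟨-, g, hg, -, rfl⟩ := hf
  exact ⟨_, integral_nonneg fun x => norm_nonneg _, norm_fourierInv_le g⟩

lemma sqInt (hf : BL S f) : Integrable (fun x => ‖f x‖ ^ 2) := integrable_sq hf.1

lemma mono (hf : BL S f) (hST : S ⊆ T) : BL T f := by
  obtain ⟨h2, g, hg, hS, rfl⟩ := hf
  exact ⟨h2, g, hg, fun ξ hξ => hS ξ fun h => hξ (hST h), rfl⟩

lemma zero : BL S (fun _ => 0) := by
  refine ⟨MemLp.zero', fun _ => 0, integrable_zero _ _ _, fun _ _ => rfl, ?_⟩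
  ext x; simp [Real.fourierInv_eq]

lemma add (hf : BL S f) (hh : BL S h) : BL S (fun x => f x + h x) := by
  obtain ⟨h2, g, hg, hS, rfl⟩ := hf
  obtain ⟨h2', g', hg', hS', rfl⟩ := hh
  refine ⟨h2.add h2', fun ξ => g ξ + g' ξ, hg.add hg', fun ξ hξ => ?_, ?_⟩
  · simp only [hS ξ hξ, hS' ξ hξ, add_zero]
  · rw [fourierInv_add hg hg']

lemma const_mul (c : ℂ) (hf : BL S f) : BL S (fun x => c * f x) := by
  obtain ⟨h2, g, hg, hS, rfl⟩ := hf
  refine ⟨h2.const_mul c, fun ξ => c * g ξ, hg.const_mul c, fun ξ hξ => ?_, ?_⟩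
  · simp only [hS ξ hξ, mul_zero]
  · rw [fourierInv_smul]

lemma sub (hf : BL S f) (hh : BL S h) : BL S (fun x => f x - h x) := by
  have := hf.add (hh.const_mul (-1))
  simpa [sub_eq_add_neg] using this

lemma sum {ι : Type*} {s : Finset ι} {F : ι → E2 → ℂ} (hF : ∀ i ∈ s, BL S (F i)) :
    BL S (fun x => ∑ i ∈ s, F i x) := by
  classical
  induction s using Finset.induction_on with
  | empty => simpa using zero
  | insert a s ha ih =>
    simp only [Finset.sum_insert ha]
    exact (hF a (Finset.mem_insert_self a s)).add
      (ih fun i hi => hF i (Finset.mem_insert_of_mem hi))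

lemma mul (hf : BL S f) (hh : BL T h) :
    BL {ξ | ∃ η ∈ S, ξ - η ∈ T} (fun x => f x * h x) := by
  have hfb := hf.bdd
  obtain ⟨C, hC0, hC⟩ := hfb
  have hm : MemLp (fun x => f x * h x) 2 := by
    refine MemLp.of_le_mul (c := C) hh.1 (hf.1.1.mul hh.1.1) (ae_of_all _ fun x => ?_)
    rw [norm_mul]
    exact mul_le_mul_of_nonneg_right (hC x) (norm_nonneg _)
  refine ⟨hm, ?_⟩
  obtain ⟨-, g, hg, hS, rfl⟩ := hf
  obtain ⟨-, k, hk, hT, rfl⟩ := hh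
  refine ⟨convolution g k (ContinuousLinearMap.mul ℂ ℂ) volume,
    hg.integrable_convolution _ hk, fun ξ hξ => ?_, ?_⟩
  · unfold convolution
    refine integral_eq_zero_of_ae (ae_of_all _ fun η => ?_)
    simp only [ContinuousLinearMap.mul_apply', Pi.zero_apply]
    by_cases h1 : η ∈ S
    · have h2 : ξ - η ∉ T := fun h2 => hξ ⟨η, h1, h2⟩
      rw [hT _ h2, mul_zero]
    · rw [hS _ h1, zero_mul]
  · ext x
    simp only [Real.fourierInv_eq_fourier_neg]
    rw [Real.fourier_mul_convolution_eq hg hk]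

lemma conj (hf : BL S f) : BL {ξ | -ξ ∈ S} (fun x => (starRingEnd ℂ) (f x)) := by
  obtain ⟨h2, g, hg, hS, rfl⟩ := hf
  refine ⟨h2.star, fun ξ => (starRingEnd ℂ) (g (-ξ)), ?_, fun ξ hξ => ?_, ?_⟩
  · have := hg.comp_neg
    exact (LinearIsometryEquiv.integrable_comp_iff Complex.conjLIE).2 this
  · have := hS _ hξ
    simp only [this, map_zero]
  · ext x
    simp only [Real.fourierInv_eq]
    rw [← integral_conj, ← integral_neg_eq_self]
    congr 1; ext ξ
    simp only [Circle.smul_def, smul_eq_mul, map_mul, inner_neg_left]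
    rw [← Circle.coe_inv_eq_conj, ← AddChar.map_neg_eq_inv, neg_neg]

/-- Almost orthogonality for functions with finitely overlapping spectra. -/
lemma orth {ι : Type*} {s : Finset ι} {S : ι → Set E2} {F : ι → E2 → ℂ} {M : ℝ}
    (hF : ∀ i ∈ s, BL (S i) (F i))
    (hM : ∀ ξ, ∃ t : Finset ι, (t.card : ℝ) ≤ M ∧ ∀ i ∈ s, ξ ∈ S i → i ∈ t) :
    ∫ x, ‖∑ i ∈ s, F i x‖ ^ 2 ≤ M * ∑ i ∈ s, ∫ x, ‖F i x‖ ^ 2 := by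
  classical
  have hsum : BL univ (fun x => ∑ i ∈ s, F i x) :=
    BL.sum fun i hi => (hF i hi).mono (subset_univ _)
  choose! hF2 g hg hgS hgF using hF
  have e : (fun x => ∑ i ∈ s, F i x) = 𝓕⁻ (fun ξ => ∑ i ∈ s, g i ξ) := by
    rw [fourierInv_sum s hg]
    ext x; exact Finset.sum_congr rfl fun i hi => by rw [hgF i hi]
  have hgi : Integrable (fun ξ => ∑ i ∈ s, g i ξ) := integrable_finsetSum _ hg
  have h1 : ∫ x, ‖∑ i ∈ s, F i x‖ ^ 2 = ∫ ξ, ‖∑ i ∈ s, g i ξ‖ ^ 2 := by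
    rw [← integral_sq_fourierInv hgi (by rw [← e]; exact hsum.1), ← e]
  have h2 : ∀ i ∈ s, ∫ x, ‖F i x‖ ^ 2 = ∫ ξ, ‖g i ξ‖ ^ 2 := by
    intro i hi
    rw [← integral_sq_fourierInv (hg i hi) (by rw [← hgF i hi]; exact hF2 i hi), ← hgF i hi]
  have hg2 : ∀ i ∈ s, MemLp (g i) 2 := fun i hi =>
    memLp_of_fourierInv (hg i hi) (by rw [← hgF i hi]; exact hF2 i hi)
  rw [h1, Finset.sum_congr rfl h2, ← integral_finsetSum _ fun i hi => integrable_sq (hg2 i hi),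
    ← integral_const_mul]
  refine integral_mono (integrable_sq (memLp_finsetSum s hg2))
    ((integrable_finsetSum _ fun i hi => integrable_sq (hg2 i hi)).const_mul M) fun ξ => ?_
  obtain ⟨t, htM, ht⟩ := hM ξ
  have hst : ∑ i ∈ s, g i ξ = ∑ i ∈ s ∩ t, g i ξ := by
    refine (Finset.sum_subset Finset.inter_subset_left fun i hi hi' => ?_).symm
    refine hgS i hi ξ fun hξ => hi' (Finset.mem_inter.2 ⟨hi, ht i hi hξ⟩)
  simp only
  rw [hst]
  calc ‖∑ i ∈ s ∩ t, g i ξ‖ ^ 2 ≤ (∑ i ∈ s ∩ t, ‖g i ξ‖) ^ 2 := by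
        gcongr; exact norm_sum_le _ _
    _ ≤ (s ∩ t).card * ∑ i ∈ s ∩ t, ‖g i ξ‖ ^ 2 := sq_sum_le_card_mul_sum_sq
    _ ≤ M * ∑ i ∈ s, ‖g i ξ‖ ^ 2 := by
        have h3 : ((s ∩ t).card : ℝ) ≤ M :=
          le_trans (by exact_mod_cast Finset.card_le_card Finset.inter_subset_right) htM
        have h4 : s ∩ t ⊆ s := Finset.inter_subset_left
        have h5 : 0 ≤ M := (Nat.cast_nonneg _).trans h3
        gcongr

end BL

/-! ### Convolution as a Fourier multiplier -/

lemma cv_fourierInv {K g : E2 → ℂ} (hK : Integrable K) (hg : Integrable g) :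
    cv K (𝓕⁻ g) = 𝓕⁻ (fun ξ => g ξ * 𝓕 K ξ) := by
  ext x
  have e1 : ∀ z, 𝓕⁻ g (x - z) =
      𝓕⁻ (fun ξ => Real.fourierChar (inner ℝ ξ x) • g ξ) (-z) := by
    intro z
    simp only [Real.fourierInv_eq]
    congr 1; ext ξ
    simp only [Circle.smul_def, smul_eq_mul, inner_sub_right, inner_neg_right]
    rw [← mul_assoc, ← Circle.coe_mul, ← AddChar.map_add_eq_mul]
    congr 3; ring
  unfold cv
  simp only [e1]
  rw [← integral_neg_eq_self]
  simp only [neg_neg]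
  rw [← integral_mul_fourierInv hK.comp_neg (integrable_char_mul hg x)]
  rw [Real.fourierInv_eq_fourier_comp_neg]
  simp only [neg_neg]
  rw [Real.fourierInv_eq]
  congr 1; ext ξ
  simp only [Circle.smul_def, smul_eq_mul]; ring

lemma cv_comm (K f : E2 → ℂ) : cv K f = cv f K := by
  ext x
  unfold cv
  rw [← integral_sub_left_eq_self _ volume x]
  congr 1; ext z; rw [sub_sub_cancel, mul_comm]

namespace BL

variable {S T : Set E2} {f K : E2 → ℂ}

lemma integrable_mul_fourier {g : E2 → ℂ} (hK : Integrable K) (hg : Integrable g) :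
    Integrable (fun ξ => g ξ * 𝓕 K ξ) :=
  hg.mul_bdd (c := ∫ x, ‖K x‖) (fourier_continuous hK).aestronglyMeasurable
    (ae_of_all _ fun x => norm_fourier_le K x)

lemma cv_bl (hf : BL S f) (hK : Integrable K) : BL (S ∩ {ξ | 𝓕 K ξ ≠ 0}) (cv K f) := by
  obtain ⟨h2, g, hg, hS, rfl⟩ := hf
  rw [cv_fourierInv hK hg]
  refine of_fourierInv (integrable_mul_fourier hK hg) ?_ fun ξ hξ => ?_
  · refine MemLp.of_le_mul (c := ∫ x, ‖K x‖) (memLp_of_fourierInv hg h2)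
      (integrable_mul_fourier hK hg).1 (ae_of_all _ fun ξ => ?_)
    rw [norm_mul, mul_comm]
    exact mul_le_mul_of_nonneg_right (norm_fourier_le K ξ) (norm_nonneg _)
  · by_cases h : ξ ∈ S
    · have : 𝓕 K ξ = 0 := by
        by_contra h'; exact hξ ⟨h, h'⟩
      rw [this, mul_zero]
    · rw [hS ξ h, zero_mul]

lemma cv_sq_le (hf : BL S f) (hK : Integrable K) :
    ∫ x, ‖cv K f x‖ ^ 2 ≤ (∫ x, ‖K x‖) ^ 2 * ∫ x, ‖f x‖ ^ 2 := by
  have hb := (hf.cv_bl hK).1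
  obtain ⟨h2, g, hg, hS, rfl⟩ := hf
  rw [cv_fourierInv hK hg] at hb ⊢
  rw [integral_sq_fourierInv (integrable_mul_fourier hK hg) hb, integral_sq_fourierInv hg h2,
    ← integral_const_mul]
  refine integral_mono (integrable_sq (memLp_of_fourierInv (integrable_mul_fourier hK hg) hb))
    ((integrable_sq (memLp_of_fourierInv hg h2)).const_mul _) fun ξ => ?_
  simp only
  rw [norm_mul, mul_pow, mul_comm]
  gcongr
  exact norm_fourier_le K ξ

lemma cv_eq_self (hf : BL S f) (hK : Integrable K) (h : ∀ ξ ∈ S, 𝓕 K ξ = 1) : cv K f = f := by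
  obtain ⟨h2, g, hg, hS, rfl⟩ := hf
  rw [cv_fourierInv hK hg]
  congr 1; ext ξ
  by_cases hξ : ξ ∈ S
  · rw [h ξ hξ, mul_one]
  · rw [hS ξ hξ, zero_mul]

lemma cv_eq_zero (hf : BL S f) (hK : Integrable K) (h : ∀ ξ ∈ S, 𝓕 K ξ = 0) (x : E2) :
    cv K f x = 0 := by
  obtain ⟨h2, g, hg, hS, rfl⟩ := hf
  rw [cv_fourierInv hK hg]
  have : (fun ξ => g ξ * 𝓕 K ξ) = fun _ => 0 := by
    ext ξ
    by_cases hξ : ξ ∈ S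
    · rw [h ξ hξ, mul_zero]
    · rw [hS ξ hξ, zero_mul]
  rw [this]; simp [Real.fourierInv_eq]

lemma sub_cv_bl (hf : BL S f) (hK : Integrable K) :
    BL (S ∩ {ξ | 𝓕 K ξ ≠ 1}) (fun x => f x - cv K f x) := by
  have h1 : BL S (fun x => f x - cv K f x) := hf.sub ((hf.cv_bl hK).mono inter_subset_left)
  obtain ⟨h2, g, hg, hS, rfl⟩ := hf
  have hi : Integrable (fun ξ => g ξ * (1 - 𝓕 K ξ)) := by
    simp only [mul_sub, mul_one]
    exact hg.sub (integrable_mul_fourier hK hg)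
  refine ⟨h1.1, fun ξ => g ξ * (1 - 𝓕 K ξ), hi, fun ξ hξ => ?_, ?_⟩
  · by_cases h : ξ ∈ S
    · have : 𝓕 K ξ = 1 := by
        by_contra h'; exact hξ ⟨h, h'⟩
      simp only [this, sub_self, mul_zero]
    · simp only [hS ξ h, zero_mul]
  · rw [cv_fourierInv hK hg]
    have e : (fun ξ => g ξ * (1 - 𝓕 K ξ)) = fun ξ => g ξ + (-1) * (g ξ * 𝓕 K ξ) := by
      ext ξ; ring
    rw [e, fourierInv_add hg ((integrable_mul_fourier hK hg).const_mul _), fourierInv_smul]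
    ext x; ring

end BL


/-! ### Frames, weights and kernels -/

/-- The linear map `x ↦ (a (x₀ + v x₁), b x₁)`. -/
structure Frame where
  a : ℝ
  b : ℝ
  v : ℝ
  ha : 0 < a
  hb : 0 < b

/-- A parallelogram around the point `(t, c)` with long side of slope `v`. -/
def plank (t c v a b : ℝ) : Set E2 := {ξ | |ξ 0 - t| ≤ a ∧ |ξ 1 - c - v * (ξ 0 - t)| ≤ b}

namespace Frame

variable (A : Frame)

def N (x : E2) : ℝ := A.a * |x 0 + A.v * x 1| + A.b * |x 1|

def w (p : ℕ) (x : E2) : ℝ := A.a * A.b * ((1 + A.N x) ^ p)⁻¹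

lemma N_nonneg (x : E2) : 0 ≤ A.N x := by
  have := A.ha; have := A.hb; unfold N; positivity

lemma one_add_N_pos (x : E2) : 0 < 1 + A.N x := by linarith [A.N_nonneg x]

lemma N_add (x y : E2) : A.N (x + y) ≤ A.N x + A.N y := by
  have h1 := A.ha; have h2 := A.hb
  simp only [N, PiLp.add_apply]
  have e1 : |x 0 + y 0 + A.v * (x 1 + y 1)| ≤ |x 0 + A.v * x 1| + |y 0 + A.v * y 1| := by
    refine le_trans (le_of_eq ?_) (abs_add_le _ _); congr 1; ring
  have e2 := abs_add_le (x 1) (y 1)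
  nlinarith [mul_le_mul_of_nonneg_left e1 h1.le, mul_le_mul_of_nonneg_left e2 h2.le]

lemma N_neg (x : E2) : A.N (-x) = A.N x := by
  simp only [N, PiLp.neg_apply]
  rw [← abs_neg (-x 0 + A.v * -x 1), abs_neg (x 1)]
  congr 3; ring

lemma N_continuous : Continuous A.N := by unfold N; fun_prop

lemma w_pos (p : ℕ) (x : E2) : 0 < A.w p x := by
  have h1 := A.ha; have h2 := A.hb; have := A.one_add_N_pos x; unfold w; positivity

lemma w_continuous (p : ℕ) : Continuous (A.w p) := by
  have := A.N_continuous
  unfold w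
  exact continuous_const.mul (((continuous_const.add this).pow p).inv₀
    fun x => (pow_pos (A.one_add_N_pos x) p).ne')

lemma w_sub_le (p : ℕ) (y z : E2) : A.w p (y - z) ≤ (1 + A.N z) ^ p * A.w p y := by
  have h1 := A.ha; have h2 := A.hb
  have hz := A.one_add_N_pos z
  have hy := A.one_add_N_pos y
  have hyz := A.one_add_N_pos (y - z)
  have key : 1 + A.N y ≤ (1 + A.N (y - z)) * (1 + A.N z) := by
    have := A.N_add (y - z) z
    rw [sub_add_cancel] at this
    nlinarith [A.N_nonneg z, A.N_nonneg (y - z)]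
  unfold w
  have h3 : ((1 + A.N (y - z)) ^ p)⁻¹ ≤ (1 + A.N z) ^ p * ((1 + A.N y) ^ p)⁻¹ := by
    rw [← div_eq_mul_inv, inv_eq_one_div, div_le_div_iff₀ (by positivity) (by positivity), one_mul,
      ← mul_pow, mul_comm]
    exact pow_le_pow_left₀ hy.le key p
  calc _ ≤ A.a * A.b * ((1 + A.N z) ^ p * ((1 + A.N y) ^ p)⁻¹) := by gcongr
    _ = _ := by ring

lemma w_succ_mul (p k : ℕ) (z : E2) : A.w (p + k) z * (1 + A.N z) ^ p = A.w k z := by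
  have := A.one_add_N_pos z
  unfold w; rw [pow_add]; field_simp

lemma w_anti {p q : ℕ} (h : p ≤ q) (z : E2) : A.w q z ≤ A.w p z := by
  have h1 := A.ha; have h2 := A.hb; have := A.one_add_N_pos z
  unfold w
  gcongr
  linarith [A.N_nonneg z]

/-- The linear map of a frame. -/
def lin : E2 →ₗ[ℝ] E2 where
  toFun x := !₂[A.a * (x 0 + A.v * x 1), A.b * x 1]
  map_add' x y := by
    ext i; fin_cases i <;> simp <;> ring
  map_smul' r x := by
    ext i; fin_cases i <;> simp <;> ring

@[simp] lemma lin_zero (x : E2) : A.lin x 0 = A.a * (x 0 + A.v * x 1) := rfl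
@[simp] lemma lin_one (x : E2) : A.lin x 1 = A.b * x 1 := rfl

lemma det_lin : LinearMap.det A.lin = A.a * A.b := by
  rw [← LinearMap.det_toMatrix (EuclideanSpace.basisFun (Fin 2) ℝ).toBasis, Matrix.det_fin_two]
  simp [LinearMap.toMatrix_apply]

lemma map_lin : Measure.map A.lin (volume : Measure E2) =
    ENNReal.ofReal (A.a * A.b)⁻¹ • volume := by
  have h : 0 < A.a * A.b := mul_pos A.ha A.hb
  rw [Measure.map_linearMap_addHaar_eq_smul_addHaar volume (by rw [det_lin]; exact h.ne'), det_lin,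
    abs_of_pos (inv_pos.2 h)]

lemma lin_measurable : Measurable A.lin := A.lin.continuous_of_finiteDimensional.measurable

lemma integral_lin {G : Type*} [NormedAddCommGroup G] [NormedSpace ℝ G] {F : E2 → G}
    (hF : Continuous F) : ∫ x, F (A.lin x) = (A.a * A.b)⁻¹ • ∫ y, F y := by
  have h : 0 < A.a * A.b := mul_pos A.ha A.hb
  rw [← integral_map A.lin_measurable.aemeasurable hF.aestronglyMeasurable, map_lin,
    integral_smul_measure, ENNReal.toReal_ofReal (inv_pos.2 h).le]

lemma integrable_lin {G : Type*} [NormedAddCommGroup G] {F : E2 → G}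
    (hF : Continuous F) (hi : Integrable F) : Integrable (fun x => F (A.lin x)) := by
  refine (integrable_map_measure (f := A.lin) hF.aestronglyMeasurable
    A.lin_measurable.aemeasurable).1 ?_
  rw [map_lin]
  exact hi.smul_measure ENNReal.ofReal_ne_top

end Frame

/-- The `ℓ¹` norm on the plane. -/
def n1 (y : E2) : ℝ := |y 0| + |y 1|

lemma n1_continuous : Continuous n1 := by unfold n1; fun_prop

lemma norm_le_n1 (y : E2) : ‖y‖ ≤ n1 y := by
  rw [EuclideanSpace.norm_eq, Fin.sum_univ_two]
  apply Real.sqrt_le_iff.2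
  simp only [n1, Real.norm_eq_abs]
  constructor
  · positivity
  · nlinarith [abs_nonneg (y 0), abs_nonneg (y 1)]

lemma abs_coord_le (y : E2) (i : Fin 2) : |y i| ≤ ‖y‖ := by
  simpa using PiLp.norm_apply_le y i

lemma n1_le (y : E2) : n1 y ≤ 2 * ‖y‖ := by
  unfold n1; linarith [abs_coord_le y 0, abs_coord_le y 1]

lemma Frame.N_eq (A : Frame) (x : E2) : A.N x = n1 (A.lin x) := by
  simp only [Frame.N, n1, Frame.lin_zero, Frame.lin_one, abs_mul, abs_of_pos A.ha, abs_of_pos A.hb]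

/-- The total mass of the weights of order three. -/
def I3 : ℝ := ∫ y : E2, ((1 + n1 y) ^ 3)⁻¹

lemma one_add_n1_pos (y : E2) : 0 < 1 + n1 y := by
  have : 0 ≤ n1 y := (norm_nonneg _).trans (norm_le_n1 y)
  linarith

lemma continuous_w0 : Continuous (fun y : E2 => ((1 + n1 y) ^ 3)⁻¹) :=
  ((continuous_const.add n1_continuous).pow 3).inv₀ fun y => (pow_pos (one_add_n1_pos y) 3).ne'

lemma integrable_w0 : Integrable (fun y : E2 => ((1 + n1 y) ^ 3)⁻¹) := by
  have h : Integrable (fun x : E2 => (1 + ‖x‖) ^ (-(3 : ℝ))) :=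
    integrable_one_add_norm (by simp; norm_num)
  refine h.mono' continuous_w0.aestronglyMeasurable (ae_of_all _ fun y => ?_)
  have h1 := one_add_n1_pos y
  rw [Real.norm_of_nonneg (by positivity), Real.rpow_neg (by positivity)]
  have : (1 + ‖y‖) ^ (3 : ℝ) = (1 + ‖y‖) ^ 3 := by
    rw [← Real.rpow_natCast]; norm_num
  rw [this]
  gcongr
  exact norm_le_n1 y

lemma I3_nonneg : 0 ≤ I3 := integral_nonneg fun y => by
  have := one_add_n1_pos y; simp only [Pi.zero_apply]; positivity

namespace Frame
variable (A : Frame)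

lemma w3_eq : A.w 3 = fun x => A.a * A.b * ((fun y => ((1 + n1 y) ^ 3)⁻¹) (A.lin x)) := by
  ext x; simp only [w, A.N_eq]

lemma integral_w3 : ∫ x, A.w 3 x = I3 := by
  rw [w3_eq, integral_const_mul, A.integral_lin continuous_w0, smul_eq_mul, ← mul_assoc,
    mul_inv_cancel₀ (mul_pos A.ha A.hb).ne', one_mul, I3]

lemma integrable_w {p : ℕ} (hp : 3 ≤ p) : Integrable (A.w p) := by
  have : Integrable (A.w 3) := by
    rw [w3_eq]; exact (A.integrable_lin continuous_w0 integrable_w0).const_mul _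
  refine this.mono' (A.w_continuous p).aestronglyMeasurable (ae_of_all _ fun x => ?_)
  rw [Real.norm_of_nonneg (A.w_pos p x).le]
  exact A.w_anti hp x

lemma integral_w_le {p : ℕ} (hp : 3 ≤ p) : ∫ x, A.w p x ≤ I3 := by
  rw [← A.integral_w3]
  exact integral_mono (A.integrable_w hp) (A.integrable_w le_rfl) fun x => A.w_anti hp x

end Frame

/-- Real-valued averages. -/
def av (w u : E2 → ℝ) (x : E2) : ℝ := ∫ z, w z * u (x - z)

lemma integrable_av {w u : E2 → ℝ} (hw : Integrable w) (hu : Measurable u) {C : ℝ}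
    (hC : ∀ x, |u x| ≤ C) (x : E2) : Integrable (fun z => w z * u (x - z)) :=
  hw.mul_bdd (c := C) (hu.comp (measurable_const.sub measurable_id)).aestronglyMeasurable
    (ae_of_all _ fun _ => hC _)

lemma av_nonneg {w u : E2 → ℝ} (hw : ∀ x, 0 ≤ w x) (hu : ∀ x, 0 ≤ u x) (x : E2) :
    0 ≤ av w u x := integral_nonneg fun z => mul_nonneg (hw z) (hu _)

lemma av_peetre (A : Frame) {p : ℕ} (hp : 3 ≤ p) {u : E2 → ℝ} (hu : Measurable u) {C : ℝ}
    (hC : ∀ x, |u x| ≤ C) (h0 : ∀ x, 0 ≤ u x) (x z : E2) :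
    av (A.w p) u (x - z) ≤ (1 + A.N z) ^ p * av (A.w p) u x := by
  unfold av
  rw [← integral_sub_right_eq_self (fun y => A.w p y * u (x - z - y)) z, ← integral_const_mul]
  have e : ∀ y, x - z - (y - z) = x - y := fun y => by abel
  simp only [e]
  refine integral_mono_of_nonneg (ae_of_all _ fun y => mul_nonneg (A.w_pos _ _).le (h0 _))
    ((integrable_av (A.integrable_w hp) hu hC x).const_mul _) (ae_of_all _ fun y => ?_)
  simp only
  rw [← mul_assoc]
  exact mul_le_mul_of_nonneg_right (A.w_sub_le p y z) (h0 _)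


/-- A fixed smooth cutoff on the frequency plane. -/
def bump : ContDiffBump (0 : E2) := ⟨1 / 2, 1, by norm_num, by norm_num⟩

lemma bump_compact : HasCompactSupport (fun ξ : E2 => (bump ξ : ℂ)) :=
  bump.hasCompactSupport.comp_left (g := ((↑) : ℝ → ℂ)) rfl

/-- The cutoff as a Schwartz function. -/
def bumpS : SchwartzMap E2 ℂ :=
  bump_compact.toSchwartzMap (Complex.ofRealCLM.contDiff.comp bump.contDiff)

lemma bumpS_apply (ξ : E2) : bumpS ξ = (bump ξ : ℂ) := rfl

/-- The inverse Fourier transform of the cutoff. -/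
def Phi : SchwartzMap E2 ℂ := 𝓕⁻ bumpS

lemma fourier_Phi (ξ : E2) : 𝓕 (⇑Phi) ξ = (bump ξ : ℂ) := by
  have : 𝓕 Phi = bumpS := FourierTransform.fourier_fourierInv_eq bumpS
  rw [← bumpS_apply, ← this, SchwartzMap.fourier_coe]

lemma exists_Phi_decay (p : ℕ) : ∃ C, 0 ≤ C ∧ ∀ y, ‖Phi y‖ ≤ C * ((1 + n1 y) ^ p)⁻¹ := by
  refine ⟨2 ^ p * (2 ^ p * (Finset.Iic ((p, 0) : ℕ × ℕ)).sup
    (fun m => SchwartzMap.seminorm ℝ m.1 m.2) Phi), by positivity, fun y => ?_⟩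
  have h := SchwartzMap.one_add_le_sup_seminorm_apply (𝕜 := ℝ) (m := (p, 0)) (k := p) (n := 0)
    le_rfl le_rfl Phi y
  rw [norm_iteratedFDeriv_zero] at h
  have h1 := one_add_n1_pos y
  rw [← div_eq_mul_inv, le_div_iff₀ (by positivity)]
  have h2 : (1 + n1 y) ^ p ≤ 2 ^ p * (1 + ‖y‖) ^ p := by
    rw [← mul_pow]
    exact pow_le_pow_left₀ h1.le (by linarith [n1_le y]) p
  calc _ ≤ ‖Phi y‖ * (2 ^ p * (1 + ‖y‖) ^ p) := by gcongr
    _ = 2 ^ p * ((1 + ‖y‖) ^ p * ‖Phi y‖) := by ring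
    _ ≤ _ := by gcongr

/-- Decay constants of the kernels. -/
def kerC (p : ℕ) : ℝ := (exists_Phi_decay p).choose

lemma kerC_nonneg (p : ℕ) : 0 ≤ kerC p := (exists_Phi_decay p).choose_spec.1

lemma Phi_decay (p : ℕ) (y : E2) : ‖Phi y‖ ≤ kerC p * ((1 + n1 y) ^ p)⁻¹ :=
  (exists_Phi_decay p).choose_spec.2 y

lemma Phi_zero_ne : Phi 0 ≠ 0 := by
  have h : Phi 0 = ((∫ ξ, bump ξ : ℝ) : ℂ) := by
    rw [Phi, SchwartzMap.fourierInv_coe, Real.fourierInv_eq, ← integral_complex_ofReal]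
    simp [bumpS_apply]
  rw [h]
  exact_mod_cast (bump.integral_pos).ne'

lemma exists_Phi_lower : ∃ r > 0, ∀ y, n1 y ≤ r → ‖Phi 0‖ / 2 ≤ ‖Phi y‖ := by
  have h0 : 0 < ‖Phi 0‖ := norm_pos_iff.2 Phi_zero_ne
  have hc : ContinuousAt (fun y => ‖Phi y‖) 0 := Phi.continuous.norm.continuousAt
  obtain ⟨d, hd, h⟩ := Metric.continuousAt_iff.1 hc (‖Phi 0‖ / 2) (by positivity)
  refine ⟨d / 2, by positivity, fun y hy => ?_⟩
  have := h (x := y) (by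
    rw [dist_zero_right]; linarith [norm_le_n1 y])
  rw [Real.dist_eq] at this
  linarith [(abs_lt.1 this).1]

/-- The radius on which the kernels are bounded below. -/
def kerR : ℝ := exists_Phi_lower.choose

lemma kerR_pos : 0 < kerR := exists_Phi_lower.choose_spec.1

/-- The lower bound of the kernels. -/
def kerL : ℝ := ‖Phi 0‖ / 2

lemma kerL_pos : 0 < kerL := half_pos (norm_pos_iff.2 Phi_zero_ne)

/-- The kernel adapted to a frame, modulated to be centred at the frequency `(t, c)`. -/
def ker (A : Frame) (t c : ℝ) (x : E2) : ℂ :=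
  (A.a * A.b : ℝ) * Phi (A.lin x) * Real.fourierChar (x 0 * t + x 1 * c)

section Ker
variable (A : Frame) (t c : ℝ)

lemma norm_ker (x : E2) : ‖ker A t c x‖ = A.a * A.b * ‖Phi (A.lin x)‖ := by
  unfold ker
  rw [norm_mul, norm_mul, Complex.norm_real, Circle.norm_coe, mul_one,
    Real.norm_of_nonneg (mul_pos A.ha A.hb).le]

lemma ker_decay (p : ℕ) (x : E2) : ‖ker A t c x‖ ≤ kerC p * A.w p x := by
  have := (mul_pos A.ha A.hb).le
  rw [norm_ker, Frame.w, A.N_eq, mul_left_comm]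
  gcongr
  exact Phi_decay p _

lemma ker_lower {x : E2} (hx : A.N x ≤ kerR) : kerL * (A.a * A.b) ≤ ‖ker A t c x‖ := by
  have := (mul_pos A.ha A.hb).le
  rw [norm_ker, mul_comm]
  gcongr
  exact exists_Phi_lower.choose_spec.2 _ (by rwa [← A.N_eq])

lemma ker_continuous : Continuous (ker A t c) := by
  unfold ker
  have h1 : Continuous A.lin := A.lin.continuous_of_finiteDimensional
  have h2 := Phi.continuous
  have h3 := Real.continuous_fourierChar
  fun_prop

lemma ker_integrable : Integrable (ker A t c) :=
  ((A.integrable_w le_rfl).const_mul (kerC 3)).mono' (ker_continuous A t c).aestronglyMeasurable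
    (ae_of_all _ fun x => ker_decay A t c 3 x)

/-- The dual linear change of variables. -/
def dualPt (ξ : E2) : E2 := !₂[(ξ 0 - t) / A.a, (ξ 1 - c - A.v * (ξ 0 - t)) / A.b]

lemma fourier_ker (ξ : E2) : 𝓕 (ker A t c) ξ = (bump (dualPt A t c ξ) : ℂ) := by
  have hA := mul_pos A.ha A.hb
  have ha := A.ha.ne'
  have hb := A.hb.ne'
  rw [← fourier_Phi, Real.fourier_eq, Real.fourier_eq]
  have hcont : Continuous fun y : E2 =>
      Real.fourierChar (-inner ℝ y (dualPt A t c ξ)) • Phi y := by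
    have h2 := Phi.continuous
    have h3 := Real.continuous_fourierChar
    fun_prop
  have h := A.integral_lin hcont
  have e : ∀ x, Real.fourierChar (-inner ℝ x ξ) • ker A t c x = ((A.a * A.b : ℝ) : ℂ) *
      (Real.fourierChar (-inner ℝ (A.lin x) (dualPt A t c ξ)) • Phi (A.lin x)) := by
    intro x
    simp only [Circle.smul_def, ker, smul_eq_mul]
    have : (Real.fourierChar (-inner ℝ (A.lin x) (dualPt A t c ξ)) : ℂ) =
        Real.fourierChar (-inner ℝ x ξ) * Real.fourierChar (x 0 * t + x 1 * c) := by
      rw [← Circle.coe_mul, ← AddChar.map_add_eq_mul]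
      congr 2
      simp only [dualPt, PiLp.inner_apply, Fin.sum_univ_two, Frame.lin_zero, Frame.lin_one]
      simp
      field_simp
      ring
    rw [this]; ring
  simp only [e]
  rw [integral_const_mul, h, Complex.real_smul, ← mul_assoc, ← Complex.ofReal_mul,
    mul_inv_cancel₀ hA.ne', Complex.ofReal_one, one_mul]

lemma fourier_ker_one {ξ : E2} (h : ξ ∈ plank t c A.v (A.a / 4) (A.b / 4)) :
    𝓕 (ker A t c) ξ = 1 := by
  rw [fourier_ker]
  have : dualPt A t c ξ ∈ Metric.closedBall (0 : E2) bump.rIn := by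
    rw [mem_closedBall_zero_iff]
    refine (norm_le_n1 _).trans ?_
    have ha := A.ha
    have hb := A.hb
    simp only [n1, dualPt, bump]
    simp only [Matrix.cons_val_zero, Matrix.cons_val_one, abs_div, abs_of_pos ha, abs_of_pos hb]
    have h1 : |ξ 0 - t| / A.a ≤ 1 / 4 := by rw [div_le_iff₀ ha]; linarith [h.1]
    have h2 : |ξ 1 - c - A.v * (ξ 0 - t)| / A.b ≤ 1 / 4 := by rw [div_le_iff₀ hb]; linarith [h.2]
    linarith
  rw [bump.one_of_mem_closedBall this, Complex.ofReal_one]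

lemma fourier_ker_zero {ξ : E2} (h : ξ ∉ plank t c A.v A.a A.b) : 𝓕 (ker A t c) ξ = 0 := by
  rw [fourier_ker]
  by_contra hne
  apply h
  have h1 : bump (dualPt A t c ξ) ≠ 0 := fun h0 => hne (by rw [h0, Complex.ofReal_zero])
  have h2 : dualPt A t c ξ ∈ Metric.ball (0 : E2) bump.rOut := by
    rw [← bump.support_eq]; exact h1
  rw [mem_ball_zero_iff] at h2
  have ha := A.ha
  have hb := A.hb
  have c0 := (abs_coord_le (dualPt A t c ξ) 0).trans h2.le
  have c1 := (abs_coord_le (dualPt A t c ξ) 1).trans h2.le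
  simp only [dualPt, bump, PiLp.toLp_apply, Matrix.cons_val_zero, Matrix.cons_val_one, abs_div,
    abs_of_pos ha, abs_of_pos hb] at c0 c1
  rw [div_le_iff₀ ha, one_mul] at c0
  rw [div_le_iff₀ hb, one_mul] at c1
  exact ⟨c0, c1⟩

lemma ker_bl : BL (plank t c A.v A.a A.b) (ker A t c) := by
  have hi := ker_integrable A t c
  have hcs : Integrable (𝓕 (ker A t c)) := by
    refine Continuous.integrable_of_hasCompactSupport (fourier_continuous hi) ?_
    refine HasCompactSupport.intro (K := Metric.closedBall 0
      (|t| + A.a + (|c| + A.b + |A.v| * A.a))) (isCompact_closedBall _ _) fun ξ hξ => ?_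
    refine fourier_ker_zero A t c fun hm => hξ ?_
    rw [mem_closedBall_zero_iff]
    refine (norm_le_n1 ξ).trans ?_
    have e0 : |ξ 0| ≤ |t| + A.a := by
      have := abs_add_le t (ξ 0 - t); rw [add_sub_cancel] at this; linarith [hm.1]
    have e1 : |ξ 1| ≤ |c| + A.b + |A.v| * A.a := by
      have h1 := abs_add_three c (ξ 1 - c - A.v * (ξ 0 - t)) (A.v * (ξ 0 - t))
      rw [show c + (ξ 1 - c - A.v * (ξ 0 - t)) + A.v * (ξ 0 - t) = ξ 1 by ring,
        abs_mul A.v] at h1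
      have := mul_le_mul_of_nonneg_left hm.1 (abs_nonneg A.v)
      linarith [hm.2]
    unfold n1; linarith
  have heq : ker A t c = 𝓕⁻ (𝓕 (ker A t c)) :=
    ((ker_continuous A t c).fourierInv_fourier_eq hi hcs).symm
  refine ⟨?_, 𝓕 (ker A t c), hcs, fun ξ hξ => fourier_ker_zero A t c hξ, heq⟩
  refine memLp_two_of_bdd hi (C := ∫ ξ, ‖𝓕 (ker A t c) ξ‖) fun x => ?_
  conv_lhs => rw [heq]
  exact norm_fourierInv_le _ _

lemma integral_norm_ker_le : ∫ x, ‖ker A t c x‖ ≤ kerC 3 * I3 := by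
  rw [← A.integral_w3, ← integral_const_mul]
  exact integral_mono (ker_integrable A t c).norm ((A.integrable_w le_rfl).const_mul _)
    fun x => ker_decay A t c 3 x

end Ker


/-! ### Averages -/

section Av
variable {w u : E2 → ℝ}

lemma av_eq_conv (w u : E2 → ℝ) :
    av w u = convolution w u (ContinuousLinearMap.mul ℝ ℝ) volume := by
  ext x; simp [av, convolution]

lemma av_continuous (hw : Integrable w) (hu : Continuous u) {C : ℝ} (hC : ∀ x, |u x| ≤ C) :
    Continuous (av w u) := by
  rw [av_eq_conv]
  refine BddAbove.continuous_convolution_right_of_integrable _ ⟨C, ?_⟩ hw hu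
  rintro _ ⟨x, rfl⟩
  exact hC x

lemma av_integrable (hw : Integrable w) (hu : Integrable u) : Integrable (av w u) := by
  rw [av_eq_conv]; exact hw.integrable_convolution _ hu

lemma integral_av (hw : Integrable w) (hu : Integrable u) :
    ∫ x, av w u x = (∫ x, w x) * ∫ x, u x := by
  rw [av_eq_conv, integral_convolution _ hw hu]; rfl

lemma av_le (hw : Integrable w) (h0 : ∀ x, 0 ≤ w x) {C : ℝ} (hC : ∀ x, u x ≤ C)
    (hu : ∀ x, 0 ≤ u x) (x : E2) : av w u x ≤ (∫ x, w x) * C := by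
  rw [← integral_mul_const]
  refine integral_mono_of_nonneg (ae_of_all _ fun z => mul_nonneg (h0 z) (hu _))
    (hw.mul_const C) (ae_of_all _ fun z => ?_)
  exact mul_le_mul_of_nonneg_left (hC _) (h0 z)

end Av

section CS
variable {K h : E2 → ℂ}

lemma norm_cv_sq_le (hK : Integrable K) (hh : Measurable h) {C : ℝ} (hC : ∀ x, ‖h x‖ ≤ C)
    (x : E2) : ‖cv K h x‖ ^ 2 ≤ (∫ z, ‖K z‖) * av (fun z => ‖K z‖) (fun y => ‖h y‖ ^ 2) x := by
  have hC0 : 0 ≤ C := (norm_nonneg _).trans (hC 0)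
  have hm : Measurable fun z => h (x - z) := hh.comp (measurable_const.sub measurable_id)
  have h1 : ‖cv K h x‖ ≤ ∫ z, ‖K z‖ * ‖h (x - z)‖ := by
    refine (norm_integral_le_integral_norm _).trans (le_of_eq ?_)
    simp only [norm_mul]
  have i1 : Integrable fun z => ‖K z‖ * ‖h (x - z)‖ :=
    hK.norm.mul_bdd (c := C) hm.norm.aestronglyMeasurable (ae_of_all _ fun z => by
      rw [norm_norm]; exact hC _)
  have i2 : Integrable fun z => ‖K z‖ * ‖h (x - z)‖ ^ 2 :=
    hK.norm.mul_bdd (c := C ^ 2) (hm.norm.pow_const 2).aestronglyMeasurable (ae_of_all _ fun z => by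
      rw [norm_pow, norm_norm]; exact pow_le_pow_left₀ (norm_nonneg _) (hC _) 2)
  set a := ∫ z, ‖K z‖ with ha
  set b := ∫ z, ‖K z‖ * ‖h (x - z)‖ with hb
  have ha0 : 0 ≤ a := integral_nonneg fun z => norm_nonneg _
  have hb0 : 0 ≤ b := integral_nonneg fun z => mul_nonneg (norm_nonneg _) (norm_nonneg _)
  have hc0 : 0 ≤ ∫ z, ‖K z‖ * ‖h (x - z)‖ ^ 2 :=
    integral_nonneg fun z => mul_nonneg (norm_nonneg _) (sq_nonneg _)
  have key : 2 * b * a * b ≤ b ^ 2 * a + a ^ 2 * ∫ z, ‖K z‖ * ‖h (x - z)‖ ^ 2 := by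
    have : ∫ z, 2 * b * a * (‖K z‖ * ‖h (x - z)‖) ≤
        ∫ z, (b ^ 2 * ‖K z‖ + a ^ 2 * (‖K z‖ * ‖h (x - z)‖ ^ 2)) := by
      refine integral_mono (i1.const_mul _) ((hK.norm.const_mul _).add (i2.const_mul _)) fun z => ?_
      simp only
      nlinarith [mul_nonneg (norm_nonneg (K z)) (sq_nonneg (b - a * ‖h (x - z)‖))]
    rw [integral_const_mul, integral_add (hK.norm.const_mul _) (i2.const_mul _),
      integral_const_mul, integral_const_mul] at this
    exact this
  have h2 : ‖cv K h x‖ ^ 2 ≤ b ^ 2 := pow_le_pow_left₀ (norm_nonneg _) h1 2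
  refine h2.trans ?_
  change b ^ 2 ≤ a * ∫ z, ‖K z‖ * ‖h (x - z)‖ ^ 2
  rcases ha0.eq_or_lt with h0 | h0
  · have hz : ∀ᵐ z, ‖K z‖ = 0 :=
      (integral_eq_zero_iff_of_nonneg (fun z => norm_nonneg (K z)) hK.norm).1 (ha.symm.trans h0.symm)
    have : b = 0 := by
      rw [hb]
      exact integral_eq_zero_of_ae (by
        filter_upwards [hz] with z hz
        simp only [hz, zero_mul, Pi.zero_apply])
    rw [this, ← h0]; simp
  · by_contra hne
    push Not at hne
    nlinarith [mul_lt_mul_of_pos_left hne h0]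

lemma norm_cv_le (hK : Integrable K) {C : ℝ} (hC : ∀ x, ‖h x‖ ≤ C) (x : E2) :
    ‖cv K h x‖ ≤ (∫ z, ‖K z‖) * C := by
  refine (norm_integral_le_integral_norm _).trans ?_
  rw [← integral_mul_const]
  refine integral_mono_of_nonneg (ae_of_all _ fun z => norm_nonneg _)
    (hK.norm.mul_const C) (ae_of_all _ fun z => ?_)
  simp only [norm_mul]
  exact mul_le_mul_of_nonneg_left (hC _) (norm_nonneg _)

lemma integrable_cv (hK : Integrable K) (hh : Measurable h) {C : ℝ} (hC : ∀ x, ‖h x‖ ≤ C)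
    (x : E2) : Integrable fun z => K z * h (x - z) :=
  hK.mul_bdd (c := C) (hh.comp (measurable_const.sub measurable_id)).aestronglyMeasurable
    (ae_of_all _ fun _ => hC _)

lemma cv_add_right {h' : E2 → ℂ} (hK : Integrable K) (hh : Measurable h) {C : ℝ}
    (hC : ∀ x, ‖h x‖ ≤ C) (hh' : Measurable h') {C' : ℝ} (hC' : ∀ x, ‖h' x‖ ≤ C') (x : E2) :
    cv K (fun y => h y + h' y) x = cv K h x + cv K h' x := by
  unfold cv
  rw [← integral_add (integrable_cv hK hh hC x) (integrable_cv hK hh' hC' x)]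
  simp only [mul_add]

lemma cv_young (hK : Integrable K) (hh : Measurable h) {C : ℝ} (hC : ∀ x, ‖h x‖ ≤ C)
    (h2 : Integrable fun x => ‖h x‖ ^ 2) :
    ∫ x, ‖cv K h x‖ ^ 2 ≤ (∫ x, ‖K x‖) ^ 2 * ∫ x, ‖h x‖ ^ 2 := by
  rw [sq (∫ x, ‖K x‖), mul_assoc, ← integral_av hK.norm h2, ← integral_const_mul]
  exact integral_mono_of_nonneg (ae_of_all _ fun x => sq_nonneg _)
    ((av_integrable hK.norm h2).const_mul _) (ae_of_all _ fun x => norm_cv_sq_le hK hh hC x)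

end CS

/-! ### Pruning -/

/-- A dilated frame. -/
def Frame.scale (A : Frame) (r : ℝ) (hr : 0 < r) : Frame :=
  ⟨r * A.a, r * A.b, A.v, mul_pos hr A.ha, mul_pos hr A.hb⟩

lemma Frame.N_scale (A : Frame) {r : ℝ} (hr : 0 < r) (x : E2) :
    (A.scale r hr).N x = r * A.N x := by
  simp only [Frame.N, Frame.scale]; ring

lemma Frame.w_scale_le (A : Frame) {r : ℝ} (hr : 1 ≤ r) (p : ℕ) (x : E2) :
    (A.scale r (by linarith)).w p x ≤ r ^ 2 * A.w p x := by
  have h1 := A.ha; have h2 := A.hb; have h3 := A.one_add_N_pos x; have h4 := A.N_nonneg x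
  unfold Frame.w
  rw [A.N_scale (by linarith)]
  simp only [Frame.scale]
  calc _ = r ^ 2 * (A.a * A.b * ((1 + r * A.N x) ^ p)⁻¹) := by ring
    _ ≤ _ := by
      gcongr
      nlinarith

/-- The square function attached to a frame. -/
def sqav (A : Frame) (p : ℕ) (G : E2 → ℂ) : E2 → ℝ := av (A.w p) (fun y => ‖G y‖ ^ 2)

/-- The pruning kernel of a frame. -/
def pker (A : Frame) (t c : ℝ) : E2 → ℂ := ker (A.scale 8 (by norm_num)) t c

/-- The part of `G` where it is larger than `l`. -/
def big (l : ℝ) (G : E2 → ℂ) : E2 → ℂ := indicator {x | l < ‖G x‖} G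

/-- The part of `G` where it is at most `l`. -/
def small (l : ℝ) (G : E2 → ℂ) : E2 → ℂ := indicator {x | ‖G x‖ ≤ l} G

/-- The pruned function. -/
def prune (A : Frame) (t c l : ℝ) (G : E2 → ℂ) (x : E2) : ℂ := G x - cv (pker A t c) (big l G) x

/-- The `L¹` bound of the kernels. -/
def kerI : ℝ := kerC 3 * I3

lemma kerI_nonneg : 0 ≤ kerI := mul_nonneg (kerC_nonneg 3) I3_nonneg

lemma pker_integrable (A : Frame) (t c : ℝ) : Integrable (pker A t c) := ker_integrable _ t c

lemma integral_pker_le (A : Frame) (t c : ℝ) : ∫ x, ‖pker A t c x‖ ≤ kerI :=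
  integral_norm_ker_le _ t c

lemma pker_decay (A : Frame) (t c : ℝ) (p : ℕ) (x : E2) :
    ‖pker A t c x‖ ≤ 64 * kerC p * A.w p x := by
  refine (ker_decay _ t c p x).trans ?_
  have h1 := A.w_scale_le (r := 8) (by norm_num) p x
  nlinarith [kerC_nonneg p]

section Prune
variable {A : Frame} {t c l : ℝ} {G : E2 → ℂ} {S : Set E2}

lemma norm_big_le (l : ℝ) (G : E2 → ℂ) (x : E2) : ‖big l G x‖ ≤ ‖G x‖ :=
  norm_indicator_le_norm_self _ _

lemma norm_small_le (l : ℝ) (G : E2 → ℂ) (x : E2) : ‖small l G x‖ ≤ ‖G x‖ :=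
  norm_indicator_le_norm_self _ _

lemma norm_small_le' (hl : 0 ≤ l) (G : E2 → ℂ) (x : E2) : ‖small l G x‖ ≤ l := by
  unfold small; by_cases h : x ∈ {x | ‖G x‖ ≤ l}
  · rw [indicator_of_mem h]; exact h
  · rw [indicator_of_notMem h, norm_zero]; exact hl

lemma norm_big_le' (hl : 0 < l) (G : E2 → ℂ) (x : E2) : ‖big l G x‖ ≤ ‖G x‖ ^ 2 / l := by
  unfold big; by_cases h : x ∈ {x | l < ‖G x‖}
  · rw [indicator_of_mem h, le_div_iff₀ hl]
    have : l < ‖G x‖ := h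
    nlinarith
  · rw [indicator_of_notMem h, norm_zero]; positivity

lemma small_add_big (l : ℝ) (G : E2 → ℂ) (x : E2) : small l G x + big l G x = G x := by
  unfold small big
  by_cases h : ‖G x‖ ≤ l
  · rw [indicator_of_mem (by exact h), indicator_of_notMem (by simpa using h), add_zero]
  · rw [indicator_of_notMem (by exact h), indicator_of_mem (by simpa using h), zero_add]

lemma BL.measurable_big (hG : BL S G) (l : ℝ) : Measurable (big l G) :=
  hG.cont.measurable.indicator (measurableSet_lt measurable_const hG.cont.measurable.norm)

lemma BL.measurable_small (hG : BL S G) (l : ℝ) : Measurable (small l G) :=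
  hG.cont.measurable.indicator (measurableSet_le hG.cont.measurable.norm measurable_const)

lemma BL.sq_bdd (hG : BL S G) : ∃ C, ∀ x, |‖G x‖ ^ 2| ≤ C := by
  obtain ⟨C, hC, h⟩ := hG.bdd
  refine ⟨C ^ 2, fun x => ?_⟩
  rw [abs_of_nonneg (sq_nonneg _)]
  exact pow_le_pow_left₀ (norm_nonneg _) (h x) 2

lemma BL.integrable_big (hG : BL S G) (hl : 0 < l) : Integrable (big l G) :=
  (hG.sqInt.div_const l).mono' (hG.measurable_big l).aestronglyMeasurable
    (ae_of_all _ fun x => norm_big_le' hl G x)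

lemma BL.integrable_sqav (hG : BL S G) (A : Frame) {p : ℕ} (hp : 3 ≤ p) (x : E2) :
    Integrable fun z => A.w p z * ‖G (x - z)‖ ^ 2 := by
  obtain ⟨C, h⟩ := hG.sq_bdd
  exact integrable_av (A.integrable_w hp) (hG.cont.norm.pow 2).measurable h x

lemma BL.sqav_continuous (hG : BL S G) (A : Frame) {p : ℕ} (hp : 3 ≤ p) :
    Continuous (sqav A p G) := by
  obtain ⟨C, h⟩ := hG.sq_bdd
  exact av_continuous (A.integrable_w hp) (hG.cont.norm.pow 2) h

lemma sqav_nonneg (A : Frame) (p : ℕ) (G : E2 → ℂ) (x : E2) : 0 ≤ sqav A p G x :=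
  av_nonneg (fun x => (A.w_pos p x).le) (fun _ => sq_nonneg _) x

lemma BL.sqav_peetre (hG : BL S G) (A : Frame) {p : ℕ} (hp : 3 ≤ p) (x z : E2) :
    sqav A p G (x - z) ≤ (1 + A.N z) ^ p * sqav A p G x := by
  obtain ⟨C, h⟩ := hG.sq_bdd
  exact av_peetre A hp (hG.cont.norm.pow 2).measurable h (fun _ => sq_nonneg _) x z

lemma pker_one {ξ : E2} (h : ξ ∈ plank t c A.v (2 * A.a) (2 * A.b)) : 𝓕 (pker A t c) ξ = 1 := by
  refine fourier_ker_one _ t c ?_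
  simp only [Frame.scale]
  rw [show 8 * A.a / 4 = 2 * A.a by ring, show 8 * A.b / 4 = 2 * A.b by ring]
  exact h

lemma BL.prune_eq (hG : BL (plank t c A.v (2 * A.a) (2 * A.b)) G) (x : E2) :
    prune A t c l G x = cv (pker A t c) (small l G) x := by
  obtain ⟨C, hC, h⟩ := hG.bdd
  have h1 := hG.cv_eq_self (pker_integrable A t c) fun ξ hξ => pker_one hξ
  have h2 := cv_add_right (pker_integrable A t c) (hG.measurable_small l)
    (fun x => (norm_small_le l G x).trans (h x)) (hG.measurable_big l)
    (fun x => (norm_big_le l G x).trans (h x)) x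
  simp only [small_add_big] at h2
  have h3 : cv (pker A t c) G x = cv (pker A t c) (small l G) x + cv (pker A t c) (big l G) x := h2
  rw [h1] at h3
  unfold prune
  rw [h3]; ring

lemma BL.prune_bl (hG : BL (plank t c A.v (2 * A.a) (2 * A.b)) G) (hl : 0 < l) :
    BL (plank t c A.v (8 * A.a) (8 * A.b)) (prune A t c l G) := by
  have ha := A.ha
  have hb := A.hb
  refine (hG.mono fun ξ hξ => ?_).sub ?_
  · exact ⟨hξ.1.trans (by linarith), hξ.2.trans (by linarith)⟩
  · rw [cv_comm]
    exact ((ker_bl (A.scale 8 (by norm_num)) t c).cv_bl (hG.integrable_big hl)).mono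
      inter_subset_left

lemma BL.norm_prune_le (hG : BL (plank t c A.v (2 * A.a) (2 * A.b)) G) (hl : 0 ≤ l) (x : E2) :
    ‖prune A t c l G x‖ ≤ kerI * l := by
  rw [hG.prune_eq]
  exact (norm_cv_le (pker_integrable A t c) (norm_small_le' hl G) x).trans
    (mul_le_mul_of_nonneg_right (integral_pker_le A t c) hl)

lemma BL.norm_cv_pker_sq_le (hG : BL S G) {h : E2 → ℂ} (hh : Measurable h)
    (hle : ∀ x, ‖h x‖ ≤ ‖G x‖) (A : Frame) (t c : ℝ) {p : ℕ} (hp : 3 ≤ p) (x : E2) :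
    ‖cv (pker A t c) h x‖ ^ 2 ≤ kerI * (64 * kerC p) * sqav A p G x := by
  obtain ⟨C, hC, hb⟩ := hG.bdd
  refine (norm_cv_sq_le (pker_integrable A t c) hh (fun y => (hle y).trans (hb y)) x).trans ?_
  rw [mul_assoc]
  refine mul_le_mul (integral_pker_le A t c) ?_
    (av_nonneg (fun _ => norm_nonneg _) (fun _ => sq_nonneg _) x) kerI_nonneg
  rw [sqav, av, av, ← integral_const_mul]
  refine integral_mono_of_nonneg (ae_of_all _ fun z => mul_nonneg (norm_nonneg _) (sq_nonneg _))
    ((hG.integrable_sqav A hp x).const_mul _) (ae_of_all _ fun z => ?_)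
  simp only
  rw [← mul_assoc]
  exact mul_le_mul (pker_decay A t c p z) (pow_le_pow_left₀ (norm_nonneg _) (hle _) 2)
    (sq_nonneg _) ((norm_nonneg _).trans (pker_decay A t c p z))

lemma BL.norm_prune_sq_le (hG : BL (plank t c A.v (2 * A.a) (2 * A.b)) G) {p : ℕ} (hp : 3 ≤ p)
    (x : E2) : ‖prune A t c l G x‖ ^ 2 ≤ kerI * (64 * kerC p) * sqav A p G x := by
  rw [hG.prune_eq]
  exact hG.norm_cv_pker_sq_le (hG.measurable_small l) (norm_small_le l G) A t c hp x

lemma BL.norm_sq_le_sqav (hG : BL (plank t c A.v (2 * A.a) (2 * A.b)) G) {p : ℕ} (hp : 3 ≤ p)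
    (x : E2) : ‖G x‖ ^ 2 ≤ kerI * (64 * kerC p) * sqav A p G x := by
  have h1 := hG.cv_eq_self (pker_integrable A t c) fun ξ hξ => pker_one hξ
  conv_lhs => rw [← h1]
  exact hG.norm_cv_pker_sq_le hG.cont.measurable (fun _ => le_rfl) A t c hp x

lemma BL.norm_sub_prune_le (hG : BL S G) (hl : 0 < l) {p : ℕ} (hp : 3 ≤ p) (x : E2) :
    ‖G x - prune A t c l G x‖ ≤ 64 * kerC p / l * sqav A p G x := by
  have e : G x - prune A t c l G x = cv (pker A t c) (big l G) x := by unfold prune; ring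
  rw [e]
  refine (norm_integral_le_integral_norm _).trans ?_
  rw [sqav, av, ← integral_const_mul]
  refine integral_mono_of_nonneg (ae_of_all _ fun z => norm_nonneg _)
    ((hG.integrable_sqav A hp x).const_mul _) (ae_of_all _ fun z => ?_)
  simp only [norm_mul]
  calc _ ≤ (64 * kerC p * A.w p z) * (‖G (x - z)‖ ^ 2 / l) :=
        mul_le_mul (pker_decay A t c p z) (norm_big_le' hl G _) (norm_nonneg _)
          ((norm_nonneg _).trans (pker_decay A t c p z))
    _ = _ := by ring

lemma BL.integral_prune_sq_le (hG : BL (plank t c A.v (2 * A.a) (2 * A.b)) G) :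
    ∫ x, ‖prune A t c l G x‖ ^ 2 ≤ kerI ^ 2 * ∫ x, ‖G x‖ ^ 2 := by
  obtain ⟨C, hC, hb⟩ := hG.bdd
  have hi : Integrable fun x => ‖small l G x‖ ^ 2 :=
    hG.sqInt.mono' ((hG.measurable_small l).norm.pow_const 2).aestronglyMeasurable
      (ae_of_all _ fun x => by
        rw [Real.norm_of_nonneg (sq_nonneg _)]
        exact pow_le_pow_left₀ (norm_nonneg _) (norm_small_le l G x) 2)
  have h1 := cv_young (pker_integrable A t c) (hG.measurable_small l)
    (fun y => (norm_small_le l G y).trans (hb y)) hi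
  simp only [hG.prune_eq]
  refine h1.trans ?_
  refine mul_le_mul (pow_le_pow_left₀ (integral_nonneg fun _ => norm_nonneg _)
    (integral_pker_le A t c) 2) ?_ (integral_nonneg fun _ => sq_nonneg _) (sq_nonneg _)
  exact integral_mono hi hG.sqInt fun x =>
    pow_le_pow_left₀ (norm_nonneg _) (norm_small_le l G x) 2

end Prune


/-! ### Families of planks along a convex curve -/

/-- Points `(L i, c i)`, `i ∈ X`, on a convex curve with supporting slopes `v i`; the slopes lie
in `[s, s + S)` and every interval of length `ρ` contains at most four of them. -/
structure Fam where
  L : ℝ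
  ρ : ℝ
  s : ℝ
  S : ℝ
  b : ℕ
  c : ℕ → ℝ
  v : ℕ → ℝ
  X : Finset ℕ
  hL : 0 < L
  hρ : 0 < ρ
  hS : ρ ≤ S
  hb : 16 ≤ b
  slope_mem : ∀ i ∈ X, s ≤ v i ∧ v i < s + S
  supp : ∀ i ∈ X, ∀ j ∈ X, v i * (L * j - L * i) ≤ c j - c i
  sparse : ∀ x, (X.filter fun i => x ≤ v i ∧ v i < x + ρ).card ≤ 4

namespace Fam

/-- The subfamily with index set `Y`. -/
def sub (D : Fam) (Y : Finset ℕ) (h : Y ⊆ D.X) : Fam :=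
  { D with
    X := Y
    slope_mem := fun i hi => D.slope_mem i (h hi)
    supp := fun i hi j hj => D.supp i (h hi) j (h hj)
    sparse := fun x => (Finset.card_le_card (Finset.filter_subset_filter _ h)).trans (D.sparse x) }

variable (D : Fam)

lemma b_pos : 0 < D.b := by have := D.hb; omega

lemma b_pow_pos (m : ℕ) : 0 < D.b ^ m := pow_pos D.b_pos m

lemma one_le_b : (16 : ℝ) ≤ D.b := by exact_mod_cast D.hb

lemma S_pos : 0 < D.S := D.hρ.trans_le D.hS

variable {D}

lemma v_mono {i j : ℕ} (hi : i ∈ D.X) (hj : j ∈ D.X) (h : i ≤ j) : D.v i ≤ D.v j := by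
  rcases h.eq_or_lt with rfl | h
  · exact le_rfl
  have h1 := D.supp i hi j hj
  have h2 := D.supp j hj i hi
  have h3 : (0 : ℝ) < D.L * j - D.L * i := by
    rw [← mul_sub]; exact mul_pos D.hL (sub_pos.2 (by exact_mod_cast h))
  by_contra hne
  push Not at hne
  nlinarith [mul_lt_mul_of_pos_right hne h3]

lemma abs_height_le {i j : ℕ} (hi : i ∈ D.X) (hj : j ∈ D.X) :
    |D.c j - D.c i - D.v i * (D.L * j - D.L * i)| ≤ |D.v j - D.v i| * |D.L * j - D.L * i| := by
  have h1 := D.supp i hi j hj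
  have h2 := D.supp j hj i hi
  rw [abs_of_nonneg (by linarith), ← abs_mul]
  refine le_trans ?_ (le_abs_self _)
  linarith

variable (D)

/-- The nodes of height `m`. -/
def nodes (m : ℕ) : Finset ℕ := D.X.image fun i => i / D.b ^ m

/-- The leaves below a node. -/
def leaves (m k : ℕ) : Finset ℕ := D.X.filter fun i => i / D.b ^ m = k

open Classical in
/-- The first leaf below a node. -/
def rep (m k : ℕ) : ℕ := if h : (D.leaves m k).Nonempty then (D.leaves m k).min' h else 0

open Classical in
/-- The last leaf below a node. -/
def top (m k : ℕ) : ℕ := if h : (D.leaves m k).Nonempty then (D.leaves m k).max' h else 0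

/-- The variation of the slope over a node, enlarged by `4 ρ`. -/
def mu (m k : ℕ) : ℝ := 4 * D.ρ + |D.v (D.top m k) - D.v (D.rep m k)|

/-- The length of a node. -/
def len (m : ℕ) : ℝ := D.L * D.b ^ m

lemma len_pos (m : ℕ) : 0 < D.len m := mul_pos D.hL (pow_pos (by exact_mod_cast D.b_pos) m)

lemma len_succ (m : ℕ) : D.len (m + 1) = D.b * D.len m := by unfold len; ring

lemma four_rho_le_mu (m k : ℕ) : 4 * D.ρ ≤ D.mu m k := by
  unfold mu; linarith [abs_nonneg (D.v (D.top m k) - D.v (D.rep m k))]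

lemma mu_pos (m k : ℕ) : 0 < D.mu m k := by linarith [D.four_rho_le_mu m k, D.hρ]

/-- The frame of a node. -/
def frame (m k : ℕ) : Frame :=
  ⟨D.len m, D.len m * D.mu m k, D.v (D.rep m k), D.len_pos m, mul_pos (D.len_pos m) (D.mu_pos m k)⟩

/-- Horizontal coordinate of the base point of a node. -/
def tt (m k : ℕ) : ℝ := D.L * D.rep m k

/-- Vertical coordinate of the base point of a node. -/
def cc (m k : ℕ) : ℝ := D.c (D.rep m k)

variable {D} {m k i : ℕ}

lemma mem_leaves : i ∈ D.leaves m k ↔ i ∈ D.X ∧ i / D.b ^ m = k := Finset.mem_filter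

lemma leaves_nonempty (hk : k ∈ D.nodes m) : (D.leaves m k).Nonempty := by
  obtain ⟨i, hi, rfl⟩ := Finset.mem_image.1 hk
  exact ⟨i, mem_leaves.2 ⟨hi, rfl⟩⟩

lemma rep_mem (hk : k ∈ D.nodes m) : D.rep m k ∈ D.leaves m k := by
  unfold rep; rw [dif_pos (leaves_nonempty hk)]; exact Finset.min'_mem _ _

lemma top_mem (hk : k ∈ D.nodes m) : D.top m k ∈ D.leaves m k := by
  unfold top; rw [dif_pos (leaves_nonempty hk)]; exact Finset.max'_mem _ _

lemma rep_le (hi : i ∈ D.leaves m k) : D.rep m k ≤ i := by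
  unfold rep; rw [dif_pos ⟨i, hi⟩]; exact Finset.min'_le _ _ hi

lemma le_top (hi : i ∈ D.leaves m k) : i ≤ D.top m k := by
  unfold top; rw [dif_pos ⟨i, hi⟩]; exact Finset.le_max' _ _ hi

lemma rep_mem_X (hk : k ∈ D.nodes m) : D.rep m k ∈ D.X := (mem_leaves.1 (rep_mem hk)).1

lemma top_mem_X (hk : k ∈ D.nodes m) : D.top m k ∈ D.X := (mem_leaves.1 (top_mem hk)).1

lemma leaves_nodes (hi : i ∈ D.leaves m k) : k ∈ D.nodes m :=
  Finset.mem_image.2 ⟨i, mem_leaves.1 hi⟩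

lemma mu_eq (hk : k ∈ D.nodes m) : D.mu m k = 4 * D.ρ + (D.v (D.top m k) - D.v (D.rep m k)) := by
  unfold mu
  rw [abs_of_nonneg]
  exact sub_nonneg.2 (v_mono (rep_mem_X hk) (top_mem_X hk) (rep_le (top_mem hk)))

lemma slope_leaf (hi : i ∈ D.leaves m k) :
    D.v (D.rep m k) ≤ D.v i ∧ D.v i ≤ D.v (D.rep m k) + (D.mu m k - 4 * D.ρ) := by
  have hk := leaves_nodes hi
  have h1 := v_mono (rep_mem_X hk) (mem_leaves.1 hi).1 (rep_le hi)
  have h2 := v_mono (mem_leaves.1 hi).1 (top_mem_X hk) (le_top hi)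
  rw [mu_eq hk]
  constructor <;> linarith

lemma mu_le (hk : k ∈ D.nodes m) : D.mu m k ≤ 4 * D.ρ + D.S := by
  rw [mu_eq hk]
  linarith [(D.slope_mem _ (rep_mem_X hk)).1, (D.slope_mem _ (top_mem_X hk)).2]

lemma leaves_succ (hi : i ∈ D.leaves m k) : i ∈ D.leaves (m + 1) (k / D.b) := by
  rw [mem_leaves] at hi ⊢
  refine ⟨hi.1, ?_⟩
  rw [pow_succ, ← Nat.div_div_eq_div_mul, hi.2]

lemma parent_mem (hk : k ∈ D.nodes m) : k / D.b ∈ D.nodes (m + 1) :=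
  leaves_nodes (leaves_succ (rep_mem hk))

lemma mu_child_le (hk : k ∈ D.nodes m) : D.mu m k ≤ D.mu (m + 1) (k / D.b) := by
  rw [mu_eq hk]
  have h1 := slope_leaf (leaves_succ (rep_mem hk))
  have h2 := slope_leaf (leaves_succ (top_mem hk))
  linarith

lemma slope_child (hk : k ∈ D.nodes m) :
    |D.v (D.rep m k) - D.v (D.rep (m + 1) (k / D.b))| ≤ D.mu (m + 1) (k / D.b) := by
  have h1 := slope_leaf (leaves_succ (rep_mem hk))
  rw [abs_of_nonneg (by linarith)]
  linarith [D.hρ]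

lemma leaf_pos (hi : i ∈ D.leaves m k) :
    D.len m * k ≤ D.L * i ∧ D.L * i ≤ D.len m * k + D.len m := by
  obtain ⟨-, rfl⟩ := mem_leaves.1 hi
  have hb := D.b_pow_pos m
  have h1 : D.b ^ m * (i / D.b ^ m) ≤ i := Nat.mul_div_le _ _
  have h2 : i ≤ D.b ^ m * (i / D.b ^ m) + D.b ^ m := by
    have := Nat.lt_mul_div_succ i hb; nlinarith
  have h1' : (D.b : ℝ) ^ m * ((i / D.b ^ m : ℕ) : ℝ) ≤ i := by exact_mod_cast h1
  have h2' : (i : ℝ) ≤ (D.b : ℝ) ^ m * ((i / D.b ^ m : ℕ) : ℝ) + (D.b : ℝ) ^ m := by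
    exact_mod_cast h2
  have hL := D.hL
  unfold len
  constructor
  · rw [mul_assoc]; gcongr
  · calc D.L * i ≤ D.L * ((D.b : ℝ) ^ m * ((i / D.b ^ m : ℕ) : ℝ) + (D.b : ℝ) ^ m) := by gcongr
      _ = _ := by ring

lemma abs_leaf_sub_le {j : ℕ} (hi : i ∈ D.leaves m k) (hj : j ∈ D.leaves m k) :
    |D.L * i - D.L * j| ≤ D.len m := by
  have h1 := leaf_pos hi
  have h2 := leaf_pos hj
  rw [abs_le]; constructor <;> linarith

/-- The enlarged plank of a child is contained in the plank of its parent. -/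
lemma plank_child_subset (hk : k ∈ D.nodes m) :
    plank (D.tt m k) (D.cc m k) (D.frame m k).v (8 * (D.frame m k).a) (8 * (D.frame m k).b) ⊆
      plank (D.tt (m + 1) (k / D.b)) (D.cc (m + 1) (k / D.b)) (D.frame (m + 1) (k / D.b)).v
        (2 * (D.frame (m + 1) (k / D.b)).a) (2 * (D.frame (m + 1) (k / D.b)).b) := by
  rintro ξ ⟨h0, h1⟩
  have hp := parent_mem hk
  have hmu := mu_child_le hk
  have hsl := slope_child hk
  have hmu0 := D.mu_pos m k
  have hmu1 := D.mu_pos (m + 1) (k / D.b)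
  have hl := D.len_pos m
  have hb := D.one_le_b
  have ht := abs_leaf_sub_le (leaves_succ (rep_mem hk)) (rep_mem hp)
  have hc := abs_height_le (rep_mem_X hp) (rep_mem_X hk)
  simp only [frame, tt, cc, len_succ] at *
  set v := D.v (D.rep m k)
  set v' := D.v (D.rep (m + 1) (k / D.b))
  set t := D.L * (D.rep m k : ℝ)
  set t' := D.L * (D.rep (m + 1) (k / D.b) : ℝ)
  set c := D.c (D.rep m k)
  set c' := D.c (D.rep (m + 1) (k / D.b))
  set l := D.len m
  set u := D.mu m k
  set u' := D.mu (m + 1) (k / D.b)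
  have hbl : 16 * l ≤ D.b * l := by nlinarith
  constructor
  · rw [abs_le] at *; constructor <;> linarith
  · have e : ξ 1 - c' - v' * (ξ 0 - t') = (ξ 1 - c - v * (ξ 0 - t)) + (v - v') * (ξ 0 - t) +
        (c - c' - v' * (t - t')) := by ring
    rw [e]
    have e1 : |(v - v') * (ξ 0 - t)| ≤ u' * (8 * l) := by
      rw [abs_mul]; exact mul_le_mul hsl h0 (abs_nonneg _) hmu1.le
    have e2 : |c - c' - v' * (t - t')| ≤ u' * (D.b * l) :=
      hc.trans (mul_le_mul hsl ht (abs_nonneg _) hmu1.le)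
    have e3 : l * u ≤ l * u' := by gcongr
    refine (abs_add_three _ _ _).trans ?_
    nlinarith [mul_le_mul_of_nonneg_left hbl hmu1.le]

/-- Comparison of the dual gauges of a child and its parent. -/
lemma N_child_le (hk : k ∈ D.nodes m) (z : E2) :
    (D.frame m k).N z ≤ D.len m * |z 0 + D.v (D.rep (m + 1) (k / D.b)) * z 1| +
      2 * (D.len m * D.mu (m + 1) (k / D.b)) * |z 1| := by
  have hmu := mu_child_le hk
  have hsl := slope_child hk
  have hl := D.len_pos m
  simp only [Frame.N, frame]
  have e : |z 0 + D.v (D.rep m k) * z 1| ≤ |z 0 + D.v (D.rep (m + 1) (k / D.b)) * z 1| +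
      D.mu (m + 1) (k / D.b) * |z 1| := by
    have : z 0 + D.v (D.rep m k) * z 1 = (z 0 + D.v (D.rep (m + 1) (k / D.b)) * z 1) +
      (D.v (D.rep m k) - D.v (D.rep (m + 1) (k / D.b))) * z 1 := by ring
    rw [this]
    refine (abs_add_le _ _).trans ?_
    rw [abs_mul]
    gcongr
  have h1 := mul_le_mul_of_nonneg_left e hl.le
  have h2 := mul_le_mul_of_nonneg_right (mul_le_mul_of_nonneg_left hmu hl.le) (abs_nonneg (z 1))
  linarith

/-- The common frame of all nodes of a given height. -/
def box (D : Fam) (m : ℕ) : Frame :=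
  ⟨D.len m, D.len m * D.S, D.s, D.len_pos m, mul_pos (D.len_pos m) D.S_pos⟩

lemma N_le_box (hk : k ∈ D.nodes m) (z : E2) : (D.frame m k).N z ≤ 6 * (D.box m).N z := by
  have hmu := mu_le hk
  have hsl := D.slope_mem _ (rep_mem_X hk)
  have hl := D.len_pos m
  have hS := D.hS
  have hSp := D.S_pos
  simp only [Frame.N, frame, box]
  have e : |z 0 + D.v (D.rep m k) * z 1| ≤ |z 0 + D.s * z 1| + D.S * |z 1| := by
    have : z 0 + D.v (D.rep m k) * z 1 = (z 0 + D.s * z 1) + (D.v (D.rep m k) - D.s) * z 1 := by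
      ring
    rw [this]
    refine (abs_add_le _ _).trans ?_
    rw [abs_mul, abs_of_nonneg (by linarith : 0 ≤ D.v (D.rep m k) - D.s)]
    gcongr
    linarith
  have h1 := mul_le_mul_of_nonneg_left e hl.le
  have h2 : D.len m * D.mu m k * |z 1| ≤ D.len m * (5 * D.S) * |z 1| := by
    gcongr; linarith
  have h3 : 0 ≤ D.len m * |z 0 + D.s * z 1| := by positivity
  linarith

lemma box_mono (z : E2) : (D.box m).N z ≤ (D.box (m + 1)).N z := by
  have hl := D.len_pos m
  have hb := D.one_le_b
  have hS := D.S_pos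
  simp only [Frame.N, box, len_succ]
  have : D.len m ≤ D.b * D.len m := by nlinarith
  gcongr

end Fam


lemma card_nat_window (T : Finset ℕ) {l y R : ℝ} (hl : 0 < l) (hR : 0 ≤ R)
    (h : ∀ k ∈ T, |y - l * k| ≤ R * l) : (T.card : ℝ) ≤ 2 * R + 1 := by
  rcases T.eq_empty_or_nonempty with rfl | hT
  · simp; linarith
  have h1 := h _ (T.min'_mem hT)
  have h2 := h _ (T.max'_mem hT)
  have hs : T ⊆ Finset.Icc (T.min' hT) (T.max' hT) := fun k hk =>
    Finset.mem_Icc.2 ⟨T.min'_le _ hk, T.le_max' _ hk⟩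
  have hc := Finset.card_le_card hs
  have hle : T.min' hT ≤ T.max' hT := T.min'_le _ (T.max'_mem hT)
  rw [Nat.card_Icc] at hc
  have hc' : (T.card : ℝ) ≤ T.max' hT + 1 - T.min' hT := by
    have : T.card + T.min' hT ≤ T.max' hT + 1 := by omega
    have : (T.card : ℝ) + T.min' hT ≤ T.max' hT + 1 := by exact_mod_cast this
    linarith
  rw [abs_le] at h1 h2
  have : l * ((T.max' hT : ℝ) - T.min' hT) ≤ l * (2 * R) := by linarith [h1.2, h2.1]
  have := le_of_mul_le_mul_left this hl
  linarith

namespace Fam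

variable (D : Fam)

/-- The children of a node of height `m + 1`. -/
def children (m k : ℕ) : Finset ℕ := (D.nodes m).filter fun k' => k' / D.b = k

lemma mem_children {D : Fam} {m k j : ℕ} : j ∈ D.children m k ↔ j ∈ D.nodes m ∧ j / D.b = k :=
  Finset.mem_filter

lemma card_children_le (m k : ℕ) : (D.children m k).card ≤ D.b := by
  have hb := D.b_pos
  have : D.children m k ⊆ Finset.Ico (D.b * k) (D.b * k + D.b) := by
    intro j hj
    obtain ⟨-, rfl⟩ := mem_children.1 hj
    rw [Finset.mem_Ico]
    have h1 := Nat.mul_div_le j D.b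
    have h2 := Nat.lt_mul_div_succ j hb
    exact ⟨h1, by rw [mul_add, mul_one] at h2; exact h2⟩
  exact (Finset.card_le_card this).trans (by simp)

/-- The functions attached to the nodes, obtained from the leaves by successive pruning. -/
def G (f : ℕ → E2 → ℂ) (l : ℝ) : ℕ → ℕ → E2 → ℂ
  | 0, k => f k
  | m + 1, k => fun x => ∑ j ∈ D.children m k,
      prune (D.frame m j) (D.tt m j) (D.cc m j) l (G f l m j) x

/-- The pruned function at a node. -/
def Pr (f : ℕ → E2 → ℂ) (l : ℝ) (m k : ℕ) : E2 → ℂ :=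
  prune (D.frame m k) (D.tt m k) (D.cc m k) l (D.G f l m k)

/-- The exponents of the weights. -/
def pw (m : ℕ) : ℕ := 3 * (m + 1)

lemma three_le_pw (m : ℕ) : 3 ≤ pw m := by unfold pw; omega

/-- The square function of a node. -/
def W (f : ℕ → E2 → ℂ) (l : ℝ) (m k : ℕ) : E2 → ℝ := sqav (D.frame m k) (pw m) (D.G f l m k)

/-- The square function at height `m`. -/
def gs (f : ℕ → E2 → ℂ) (l : ℝ) (m : ℕ) (x : E2) : ℝ := ∑ k ∈ D.nodes m, D.W f l m k x

/-- The spectral condition on the leaf functions. -/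
def Adm (f : ℕ → E2 → ℂ) : Prop :=
  ∀ i ∈ D.X, BL (plank (D.L * i) (D.c i) (D.v i) (2 * D.L) (8 * (D.L * D.ρ))) (f i)

variable {D} {f : ℕ → E2 → ℂ} {l : ℝ} {m k : ℕ}

lemma mem_nodes_zero : k ∈ D.nodes 0 ↔ k ∈ D.X := by simp [nodes]

lemma leaves_zero (hk : k ∈ D.X) : D.leaves 0 k = {k} := by
  ext i; simp only [leaves, Finset.mem_filter, pow_zero, Nat.div_one, Finset.mem_singleton]
  constructor
  · exact fun h => h.2
  · rintro rfl; exact ⟨hk, rfl⟩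

lemma rep_zero (hk : k ∈ D.X) : D.rep 0 k = k := by
  have := rep_mem (mem_nodes_zero.2 hk)
  rw [leaves_zero hk] at this
  exact Finset.mem_singleton.1 this

lemma top_zero (hk : k ∈ D.X) : D.top 0 k = k := by
  have := top_mem (mem_nodes_zero.2 hk)
  rw [leaves_zero hk] at this
  exact Finset.mem_singleton.1 this

lemma mu_zero (hk : k ∈ D.X) : D.mu 0 k = 4 * D.ρ := by
  unfold mu; rw [rep_zero hk, top_zero hk]; simp

lemma len_zero : D.len 0 = D.L := by simp [len]

lemma G_bl (hf : D.Adm f) (hl : 0 < l) (hk : k ∈ D.nodes m) :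
    BL (plank (D.tt m k) (D.cc m k) (D.frame m k).v (2 * (D.frame m k).a) (2 * (D.frame m k).b))
      (D.G f l m k) := by
  induction m generalizing k with
  | zero =>
    have hk' := mem_nodes_zero.1 hk
    have := hf k hk'
    simp only [G, tt, cc, frame, rep_zero hk', mu_zero hk', len_zero]
    convert this using 2
    ring
  | succ m ih =>
    refine BL.sum fun j hj => ?_
    obtain ⟨hj', rfl⟩ := mem_children.1 hj
    exact ((ih hj').prune_bl hl).mono (plank_child_subset hj')

lemma Pr_bl (hf : D.Adm f) (hl : 0 < l) (hk : k ∈ D.nodes m) :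
    BL (plank (D.tt m k) (D.cc m k) (D.frame m k).v (8 * (D.frame m k).a) (8 * (D.frame m k).b))
      (D.Pr f l m k) := (G_bl hf hl hk).prune_bl hl

lemma G_succ (x : E2) : D.G f l (m + 1) k x = ∑ j ∈ D.children m k, D.Pr f l m j x := rfl

lemma sum_children {M : Type*} [AddCommMonoid M] (F : ℕ → M) :
    ∑ k ∈ D.nodes (m + 1), ∑ j ∈ D.children m k, F j = ∑ j ∈ D.nodes m, F j :=
  Finset.sum_fiberwise_of_maps_to (fun _ hj => parent_mem hj) F

lemma sum_G_succ (x : E2) :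
    ∑ k ∈ D.nodes (m + 1), D.G f l (m + 1) k x = ∑ j ∈ D.nodes m, D.Pr f l m j x := by
  simp only [G_succ]; exact sum_children _

lemma norm_G_succ_le (hf : D.Adm f) (hl : 0 < l) (x : E2) :
    ‖D.G f l (m + 1) k x‖ ≤ D.b * (kerI * l) := by
  rw [G_succ]
  refine (norm_sum_le _ _).trans ((Finset.sum_le_sum (g := fun _ => kerI * l) fun j hj => ?_).trans
    ?_)
  · exact (G_bl hf hl (mem_children.1 hj).1).norm_prune_le hl.le x
  · rw [Finset.sum_const, nsmul_eq_mul]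
    have : ((D.children m k).card : ℝ) ≤ D.b := by exact_mod_cast D.card_children_le m k
    have := mul_nonneg kerI_nonneg hl.le
    gcongr

lemma W_nonneg (x : E2) : 0 ≤ D.W f l m k x := sqav_nonneg _ _ _ x

lemma gs_nonneg (x : E2) : 0 ≤ D.gs f l m x := Finset.sum_nonneg fun _ _ => W_nonneg x

lemma sum_nodes_zero {M : Type*} [AddCommMonoid M] (F : ℕ → M) :
    ∑ k ∈ D.nodes 0, F k = ∑ i ∈ D.X, F i := by
  congr 1; ext i; exact mem_nodes_zero

lemma norm_sum_sub_le (hf : D.Adm f) (hl : 0 < l) (m : ℕ) (x : E2) :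
    ‖∑ i ∈ D.X, f i x - ∑ k ∈ D.nodes m, D.G f l m k x‖ ≤
      ∑ j ∈ Finset.range m, 64 * kerC (pw j) / l * D.gs f l j x := by
  induction m with
  | zero => rw [sum_nodes_zero]; simp [G]
  | succ m ih =>
    rw [Finset.sum_range_succ]
    have e : ∑ i ∈ D.X, f i x - ∑ k ∈ D.nodes (m + 1), D.G f l (m + 1) k x =
        (∑ i ∈ D.X, f i x - ∑ k ∈ D.nodes m, D.G f l m k x) +
        ∑ k ∈ D.nodes m, (D.G f l m k x - D.Pr f l m k x) := by
      rw [sum_G_succ, Finset.sum_sub_distrib]; ring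
    rw [e]
    refine (norm_add_le _ _).trans (add_le_add ih ?_)
    rw [gs, Finset.mul_sum]
    exact norm_sum_le_of_le _ fun k hk =>
      (G_bl hf hl hk).norm_sub_prune_le hl (three_le_pw m) x

lemma tt_near (hk : k ∈ D.nodes m) : D.len m * k ≤ D.tt m k ∧ D.tt m k ≤ D.len m * k + D.len m :=
  leaf_pos (rep_mem hk)

lemma orth_nodes {F : ℕ → E2 → ℂ} {T : Finset ℕ} (hT : T ⊆ D.nodes m) {r : ℝ} (hr : 0 ≤ r)
    (hF : ∀ k ∈ T, BL {ξ | |ξ 0 - D.tt m k| ≤ r * D.len m} (F k)) :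
    ∫ x, ‖∑ k ∈ T, F k x‖ ^ 2 ≤ (2 * (r + 1) + 1) * ∑ k ∈ T, ∫ x, ‖F k x‖ ^ 2 := by
  classical
  refine BL.orth hF fun ξ => ⟨T.filter fun k => |ξ 0 - D.tt m k| ≤ r * D.len m, ?_, ?_⟩
  · refine card_nat_window _ (l := D.len m) (y := ξ 0) (D.len_pos m) (by linarith) fun k hk => ?_
    obtain ⟨hk, h⟩ := Finset.mem_filter.1 hk
    have := tt_near (hT hk)
    rw [abs_le] at h ⊢
    constructor <;> linarith [h.1, h.2]
  · exact fun k hk hξ => Finset.mem_filter.2 ⟨hk, hξ⟩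

lemma plank_strip {t c v a b : ℝ} : plank t c v a b ⊆ {ξ | |ξ 0 - t| ≤ a} := fun _ h => h.1

lemma energy_le (hf : D.Adm f) (hl : 0 < l) (m : ℕ) :
    ∑ k ∈ D.nodes m, ∫ x, ‖D.G f l m k x‖ ^ 2 ≤
      (19 * kerI ^ 2) ^ m * ∑ i ∈ D.X, ∫ x, ‖f i x‖ ^ 2 := by
  induction m with
  | zero => rw [sum_nodes_zero]; simp [G]
  | succ m ih =>
    have h1 : ∀ k ∈ D.nodes (m + 1), ∫ x, ‖D.G f l (m + 1) k x‖ ^ 2 ≤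
        19 * ∑ j ∈ D.children m k, ∫ x, ‖D.Pr f l m j x‖ ^ 2 := by
      intro k _
      simp only [G_succ]
      refine (orth_nodes (D := D) (m := m) (Finset.filter_subset _ _) (r := 8) (by norm_num)
        fun j hj => ?_).trans (le_of_eq (by norm_num; rfl))
      exact (Pr_bl hf hl (mem_children.1 hj).1).mono plank_strip
    calc _ ≤ ∑ k ∈ D.nodes (m + 1), 19 * ∑ j ∈ D.children m k, ∫ x, ‖D.Pr f l m j x‖ ^ 2 :=
          Finset.sum_le_sum h1
      _ = 19 * ∑ j ∈ D.nodes m, ∫ x, ‖D.Pr f l m j x‖ ^ 2 := by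
          rw [← Finset.mul_sum, sum_children]
      _ ≤ 19 * ∑ j ∈ D.nodes m, kerI ^ 2 * ∫ x, ‖D.G f l m j x‖ ^ 2 := by
          gcongr with j hj
          exact (G_bl hf hl hj).integral_prune_sq_le
      _ = 19 * kerI ^ 2 * ∑ j ∈ D.nodes m, ∫ x, ‖D.G f l m j x‖ ^ 2 := by
          rw [← Finset.mul_sum]; ring
      _ ≤ 19 * kerI ^ 2 * ((19 * kerI ^ 2) ^ m * ∑ i ∈ D.X, ∫ x, ‖f i x‖ ^ 2) := by gcongr
      _ = _ := by ring

lemma gs_zero_le {a : ℕ → ℝ} (ha : ∀ i ∈ D.X, ∀ x, ‖f i x‖ ≤ a i) {β : ℝ}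
    (hβ : ∑ i ∈ D.X, a i ^ 2 ≤ β) (x : E2) : D.gs f l 0 x ≤ I3 * β := by
  have h0 : ∀ k ∈ D.nodes 0, D.W f l 0 k x ≤ I3 * a k ^ 2 := fun k hk => by
    have hk' := mem_nodes_zero.1 hk
    have := av_le (u := fun y => ‖f k y‖ ^ 2) ((D.frame 0 k).integrable_w le_rfl)
      (fun x => ((D.frame 0 k).w_pos 3 x).le)
      (fun y => pow_le_pow_left₀ (norm_nonneg _) (ha k hk' y) 2) (fun _ => sq_nonneg _) x
    rw [(D.frame 0 k).integral_w3] at this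
    exact this
  calc _ ≤ ∑ k ∈ D.nodes 0, I3 * a k ^ 2 := Finset.sum_le_sum h0
    _ = I3 * ∑ i ∈ D.X, a i ^ 2 := by rw [sum_nodes_zero, Finset.mul_sum]
    _ ≤ _ := mul_le_mul_of_nonneg_left hβ I3_nonneg

end Fam

/-! ### Slowly varying functions -/

/-- `V` grows at most polynomially on the scale of the frame. -/
def Slow (B : Frame) (q : ℝ) (p : ℕ) (V : E2 → ℝ) : Prop :=
  (∀ x, 0 ≤ V x) ∧ ∀ x z, V (x - z) ≤ (q * (1 + B.N z)) ^ p * V x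

lemma Slow.sum {ι : Type*} {s : Finset ι} {B : Frame} {q : ℝ} {p : ℕ} {V : ι → E2 → ℝ}
    (h : ∀ i ∈ s, Slow B q p (V i)) : Slow B q p (fun x => ∑ i ∈ s, V i x) :=
  ⟨fun x => Finset.sum_nonneg fun i hi => (h i hi).1 x, fun x z => by
    rw [Finset.mul_sum]; exact Finset.sum_le_sum fun i hi => (h i hi).2 x z⟩

lemma Slow.const_mul {B : Frame} {q : ℝ} {p : ℕ} {V : E2 → ℝ} (h : Slow B q p V) {C : ℝ}
    (hC : 0 ≤ C) : Slow B q p (fun x => C * V x) :=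
  ⟨fun x => mul_nonneg hC (h.1 x), fun x z => by
    rw [mul_left_comm]; exact mul_le_mul_of_nonneg_left (h.2 x z) hC⟩

lemma BL.sqav_slow {S : Set E2} {G : E2 → ℂ} (hG : BL S G) {A B : Frame} {q : ℝ} (hq : 1 ≤ q)
    (hN : ∀ z, A.N z ≤ q * B.N z) {p : ℕ} (hp : 3 ≤ p) : Slow B q p (sqav A p G) := by
  refine ⟨sqav_nonneg A p G, fun x z => (hG.sqav_peetre A hp x z).trans ?_⟩
  refine mul_le_mul_of_nonneg_right (pow_le_pow_left₀ (A.one_add_N_pos z).le ?_ p)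
    (sqav_nonneg A p G x)
  linarith [hN z]

lemma Slow.integral_le {B : Frame} {q : ℝ} {p : ℕ} {V : E2 → ℝ} (h : Slow B q p V)
    {w u : E2 → ℝ} {C : ℝ} (hw : ∀ z, |w z| ≤ C * B.w (p + 3) z)
    (hu : ∀ y, |u y| ≤ V y) (x : E2) :
    ∫ z, |w z| * |u (x - z)| ≤ C * (q ^ p * I3) * V x := by
  have e : C * (q ^ p * I3) * V x = ∫ z, C * q ^ p * V x * B.w 3 z := by
    rw [integral_const_mul, B.integral_w3]; ring
  rw [e]
  refine integral_mono_of_nonneg (ae_of_all _ fun z => by positivity)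
    ((B.integrable_w le_rfl).const_mul _) (ae_of_all _ fun z => ?_)
  calc _ ≤ (C * B.w (p + 3) z) * ((q * (1 + B.N z)) ^ p * V x) :=
        mul_le_mul (hw z) ((hu _).trans (h.2 x z)) (abs_nonneg _) ((abs_nonneg _).trans (hw z))
    _ = C * q ^ p * V x * (B.w (p + 3) z * (1 + B.N z) ^ p) := by rw [mul_pow]; ring
    _ = _ := by rw [B.w_succ_mul]


lemma cv_sum_right {ι : Type*} {s : Finset ι} {K : E2 → ℂ} {S : ι → Set E2} {F : ι → E2 → ℂ}
    (hK : Integrable K) (hF : ∀ i ∈ s, BL (S i) (F i)) (x : E2) :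
    cv K (fun y => ∑ i ∈ s, F i y) x = ∑ i ∈ s, cv K (F i) x := by
  unfold cv
  rw [← integral_finsetSum]
  · simp only [Finset.mul_sum]
  · intro i hi
    obtain ⟨C, -, h⟩ := (hF i hi).bdd
    exact integrable_cv hK (hF i hi).cont.measurable h x

lemma sum_near_le {T : Finset ℕ} {I : ℕ → ℝ} (hI : ∀ i, 0 ≤ I i) {a : ℕ → ℕ → ℝ} {R : ℕ}
    (h0 : ∀ i ∈ T, ∀ j ∈ T, (R : ℝ) < |(i : ℝ) - j| → a i j = 0)
    (h1 : ∀ i ∈ T, ∀ j ∈ T, a i j ≤ (I i + I j) / 2) :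
    ∑ i ∈ T, ∑ j ∈ T, a i j ≤ (2 * R + 1) * ∑ i ∈ T, I i := by
  classical
  let N : ℕ → ℕ → Prop := fun i j => |(i : ℝ) - j| ≤ R
  have hcount : ∀ i, ((T.filter (N i)).card : ℝ) ≤ 2 * R + 1 := fun i =>
    card_nat_window _ (l := 1) (y := i) one_pos (Nat.cast_nonneg R) fun j hj => by
      have := (Finset.mem_filter.1 hj).2
      simpa [N] using this
  have hA : ∑ i ∈ T, ∑ j ∈ T, (if N i j then I i else 0) ≤ (2 * R + 1) * ∑ i ∈ T, I i := by
    rw [Finset.mul_sum]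
    refine Finset.sum_le_sum fun i _ => ?_
    rw [← Finset.sum_filter, Finset.sum_const, nsmul_eq_mul]
    exact mul_le_mul_of_nonneg_right (hcount i) (hI i)
  have hB : ∑ i ∈ T, ∑ j ∈ T, (if N i j then I j else 0) =
      ∑ i ∈ T, ∑ j ∈ T, (if N i j then I i else 0) := by
    rw [Finset.sum_comm]
    refine Finset.sum_congr rfl fun i _ => Finset.sum_congr rfl fun j _ => ?_
    simp only [N, abs_sub_comm]
  calc _ ≤ ∑ i ∈ T, ∑ j ∈ T, ((if N i j then I i else 0) + (if N i j then I j else 0)) / 2 := by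
        refine Finset.sum_le_sum fun i hi => Finset.sum_le_sum fun j hj => ?_
        by_cases h : N i j
        · simp only [h, if_true]; exact h1 i hi j hj
        · simp only [h, if_false]
          rw [h0 i hi j hj (not_le.1 h)]; norm_num
    _ = (∑ i ∈ T, ∑ j ∈ T, (if N i j then I i else 0) +
          ∑ i ∈ T, ∑ j ∈ T, (if N i j then I j else 0)) / 2 := by
        simp only [← Finset.sum_div, Finset.sum_add_distrib]
    _ ≤ _ := by rw [hB]; linarith

namespace Fam

variable (D : Fam)

/-- The frame of the low-frequency cutoff at a node of height `m + 1`. -/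
def lowFrame (m k : ℕ) : Frame :=
  ⟨D.len m, 16 * (D.len (m + 1) * D.mu (m + 1) k), D.v (D.rep (m + 1) k), D.len_pos m,
    mul_pos (by norm_num) (mul_pos (D.len_pos _) (D.mu_pos _ k))⟩

/-- The low-frequency cutoff at a node of height `m + 1`. -/
def lowKer (m k : ℕ) : E2 → ℂ := ker (D.lowFrame m k) 0 0

/-- The squared modulus, as a complex function. -/
def sqmod (g : E2 → ℂ) (x : E2) : ℂ := g x * (starRingEnd ℂ) (g x)

/-- The weight of a node, as a complex function. -/
def cw (m k : ℕ) (x : E2) : ℂ := ((D.frame m k).w (pw m) x : ℂ)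

/-- The high-frequency part of the square function of a node. -/
def Hi (f : ℕ → E2 → ℂ) (l : ℝ) (m k : ℕ) : E2 → ℂ :=
  cv (D.cw (m + 1) k) fun x =>
    sqmod (D.G f l (m + 1) k) x - cv (D.lowKer m k) (sqmod (D.G f l (m + 1) k)) x

lemma sqmod_eq (g : E2 → ℂ) (x : E2) : sqmod g x = ((‖g x‖ ^ 2 : ℝ) : ℂ) := by
  unfold sqmod; rw [Complex.mul_conj, Complex.normSq_eq_norm_sq]

lemma norm_sqmod (g : E2 → ℂ) (x : E2) : ‖sqmod g x‖ = ‖g x‖ ^ 2 := by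
  rw [sqmod_eq, Complex.norm_real, Real.norm_of_nonneg (sq_nonneg _)]

lemma cw_integrable (m k : ℕ) : Integrable (D.cw m k) :=
  ((D.frame m k).integrable_w (three_le_pw m)).ofReal

lemma norm_cw (m k : ℕ) (x : E2) : ‖D.cw m k x‖ = (D.frame m k).w (pw m) x := by
  rw [cw, Complex.norm_real, Real.norm_of_nonneg ((D.frame m k).w_pos _ _).le]

lemma integral_norm_cw_le (m k : ℕ) : ∫ x, ‖D.cw m k x‖ ≤ I3 := by
  simp only [norm_cw]; exact (D.frame m k).integral_w_le (three_le_pw m)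

lemma _root_.HighLow.BL.mul_conj {t c v a b t' c' a' b' v' : ℝ} {g h : E2 → ℂ}
    (hg : BL (plank t c v a b) g) (hh : BL (plank t' c' v' a' b') h) :
    BL {ξ | ∃ η ∈ plank t c v a b, -(ξ - η) ∈ plank t' c' v' a' b'}
      (fun x => g x * (starRingEnd ℂ) (h x)) := hg.mul hh.conj

lemma plank_diff {t c v a b : ℝ} {ξ : E2}
    (h : ∃ η ∈ plank t c v a b, -(ξ - η) ∈ plank t c v a b) : ξ ∈ plank 0 0 v (2 * a) (2 * b) := by
  obtain ⟨η, ⟨h0, h1⟩, h2, h3⟩ := h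
  simp only [PiLp.neg_apply, PiLp.sub_apply] at h2 h3
  constructor
  · rw [abs_le] at *; constructor <;> linarith [h0.1, h0.2, h2.1, h2.2]
  · rw [abs_le] at *; constructor <;> nlinarith [h1.1, h1.2, h3.1, h3.2]

lemma plank_diff' {t c v a b t' c' v' b' : ℝ} {ξ : E2}
    (h : ∃ η ∈ plank t c v a b, -(ξ - η) ∈ plank t' c' v' a b') : |ξ 0 - (t - t')| ≤ 2 * a := by
  obtain ⟨η, ⟨h0, -⟩, h2, -⟩ := h
  simp only [PiLp.neg_apply, PiLp.sub_apply] at h2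
  rw [abs_le] at *; constructor <;> linarith [h0.1, h0.2, h2.1, h2.2]

variable {D} {f : ℕ → E2 → ℂ} {l : ℝ} {m k : ℕ}

lemma sqmod_bl (hf : D.Adm f) (hl : 0 < l) (hk : k ∈ D.nodes m) :
    BL (plank 0 0 (D.v (D.rep m k)) (4 * D.len m) (4 * (D.len m * D.mu m k)))
      (sqmod (D.G f l m k)) := by
  refine ((G_bl hf hl hk).mul_conj (G_bl hf hl hk)).mono fun ξ hξ => ?_
  have := plank_diff hξ
  simp only [frame] at this
  convert this using 2 <;> ring

lemma Hi_bl (hf : D.Adm f) (hl : 0 < l) (hk : k ∈ D.nodes (m + 1)) :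
    BL {ξ | D.len m / 4 < |ξ 0| ∧
      |ξ 1 - D.v (D.rep (m + 1) k) * ξ 0| ≤ 4 * (D.len (m + 1) * D.mu (m + 1) k)}
      (D.Hi f l m k) := by
  have h1 := (sqmod_bl hf hl hk).sub_cv_bl (ker_integrable (D.lowFrame m k) 0 0)
  refine (h1.cv_bl (D.cw_integrable (m + 1) k)).mono ?_
  rintro ξ ⟨⟨hξ, hne⟩, -⟩
  have h2 : |ξ 1 - D.v (D.rep (m + 1) k) * ξ 0| ≤ 4 * (D.len (m + 1) * D.mu (m + 1) k) := by
    simpa using hξ.2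
  refine ⟨?_, h2⟩
  by_contra hlt
  refine hne (fourier_ker_one _ 0 0 ⟨?_, ?_⟩)
  · simpa [lowFrame] using not_lt.1 hlt
  · simp only [lowFrame, sub_zero]
    linarith

lemma Hi_energy (hf : D.Adm f) (hl : 0 < l) (hk : k ∈ D.nodes (m + 1)) :
    ∫ x, ‖D.Hi f l m k x‖ ^ 2 ≤
      I3 ^ 2 * (2 * (1 + kerI ^ 2)) * (D.b * (kerI * l)) ^ 2 *
        ∫ x, ‖D.G f l (m + 1) k x‖ ^ 2 := by
  have hU := sqmod_bl hf hl hk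
  have hKi : Integrable (D.lowKer m k) := ker_integrable (D.lowFrame m k) 0 0
  have h1 := hU.sub_cv_bl hKi
  have hcv := hU.cv_bl hKi
  have e1 : ∫ x, ‖D.Hi f l m k x‖ ^ 2 ≤ I3 ^ 2 * ∫ x, ‖sqmod (D.G f l (m + 1) k) x -
      cv (D.lowKer m k) (sqmod (D.G f l (m + 1) k)) x‖ ^ 2 := by
    refine (h1.cv_sq_le (D.cw_integrable (m + 1) k)).trans ?_
    refine mul_le_mul_of_nonneg_right ?_ (integral_nonneg fun _ => sq_nonneg _)
    exact pow_le_pow_left₀ (integral_nonneg fun _ => norm_nonneg _) (D.integral_norm_cw_le _ _) 2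
  have e2 : ∫ x, ‖sqmod (D.G f l (m + 1) k) x -
      cv (D.lowKer m k) (sqmod (D.G f l (m + 1) k)) x‖ ^ 2 ≤
      2 * (1 + kerI ^ 2) * ∫ x, ‖sqmod (D.G f l (m + 1) k) x‖ ^ 2 := by
    have h3 : ∫ x, ‖cv (D.lowKer m k) (sqmod (D.G f l (m + 1) k)) x‖ ^ 2 ≤
        kerI ^ 2 * ∫ x, ‖sqmod (D.G f l (m + 1) k) x‖ ^ 2 := by
      refine (hU.cv_sq_le hKi).trans ?_
      refine mul_le_mul_of_nonneg_right ?_ (integral_nonneg fun _ => sq_nonneg _)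
      exact pow_le_pow_left₀ (integral_nonneg fun _ => norm_nonneg _) (integral_norm_ker_le _ 0 0) 2
    calc _ ≤ ∫ x, (2 * ‖sqmod (D.G f l (m + 1) k) x‖ ^ 2 +
          2 * ‖cv (D.lowKer m k) (sqmod (D.G f l (m + 1) k)) x‖ ^ 2) := by
          refine integral_mono h1.sqInt ((hU.sqInt.const_mul 2).add (hcv.sqInt.const_mul 2))
            fun x => ?_
          have := norm_sub_le (sqmod (D.G f l (m + 1) k) x)
            (cv (D.lowKer m k) (sqmod (D.G f l (m + 1) k)) x)
          simp only
          nlinarith [norm_nonneg (sqmod (D.G f l (m + 1) k) x -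
            cv (D.lowKer m k) (sqmod (D.G f l (m + 1) k)) x),
            sq_nonneg (‖sqmod (D.G f l (m + 1) k) x‖ -
              ‖cv (D.lowKer m k) (sqmod (D.G f l (m + 1) k)) x‖)]
      _ = 2 * (∫ x, ‖sqmod (D.G f l (m + 1) k) x‖ ^ 2) +
          2 * ∫ x, ‖cv (D.lowKer m k) (sqmod (D.G f l (m + 1) k)) x‖ ^ 2 := by
          rw [integral_add (hU.sqInt.const_mul 2) (hcv.sqInt.const_mul 2), integral_const_mul,
            integral_const_mul]
      _ ≤ _ := by linarith
  have e3 : ∫ x, ‖sqmod (D.G f l (m + 1) k) x‖ ^ 2 ≤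
      (D.b * (kerI * l)) ^ 2 * ∫ x, ‖D.G f l (m + 1) k x‖ ^ 2 := by
    rw [← integral_const_mul]
    refine integral_mono hU.sqInt ((G_bl hf hl hk).sqInt.const_mul _) fun x => ?_
    simp only [norm_sqmod]
    have := norm_G_succ_le hf hl (k := k) (m := m) x
    rw [sq (‖D.G f l (m + 1) k x‖ ^ 2)]
    exact mul_le_mul_of_nonneg_right (pow_le_pow_left₀ (norm_nonneg _) this 2) (sq_nonneg _)
  calc _ ≤ I3 ^ 2 * (2 * (1 + kerI ^ 2) * ((D.b * (kerI * l)) ^ 2 *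
        ∫ x, ‖D.G f l (m + 1) k x‖ ^ 2)) :=
        e1.trans (mul_le_mul_of_nonneg_left (e2.trans
          (mul_le_mul_of_nonneg_left e3 (by positivity))) (sq_nonneg _))
    _ = _ := by ring

lemma N_child_le_low (hk : k ∈ D.nodes m) (z : E2) :
    (D.frame m k).N z ≤ 1 * (D.lowFrame m (k / D.b)).N z := by
  refine (N_child_le hk z).trans ?_
  have hl := D.len_pos m
  have hb := D.one_le_b
  have hmu := D.mu_pos (m + 1) (k / D.b)
  simp only [Frame.N, lowFrame, len_succ, one_mul]
  have : D.len m ≤ D.b * D.len m := by nlinarith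
  gcongr
  norm_num

lemma N_child_le_frame (hk : k ∈ D.nodes m) (z : E2) :
    (D.frame m k).N z ≤ 1 * (D.frame (m + 1) (k / D.b)).N z := by
  refine (N_child_le hk z).trans ?_
  have hl := D.len_pos m
  have hb := D.one_le_b
  have hmu := D.mu_pos (m + 1) (k / D.b)
  simp only [Frame.N, frame, len_succ, one_mul]
  rw [← mul_assoc 2]
  have : 2 * D.len m ≤ D.b * D.len m := by nlinarith
  gcongr
  linarith

lemma low_vanish (hf : D.Adm f) (hl : 0 < l) {i j : ℕ} (hi : i ∈ D.nodes m) (hj : j ∈ D.nodes m)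
    (hij : 18 < |(i : ℝ) - j|) (k : ℕ) (x : E2) :
    cv (D.lowKer m k) (fun y => D.Pr f l m i y * (starRingEnd ℂ) (D.Pr f l m j y)) x = 0 := by
  refine ((Pr_bl hf hl hi).mul_conj (Pr_bl hf hl hj)).cv_eq_zero (ker_integrable _ 0 0)
    (fun ξ hξ => fourier_ker_zero _ 0 0 fun hm => ?_) x
  have h1 : |ξ 0 - (D.tt m i - D.tt m j)| ≤ 2 * (8 * D.len m) := plank_diff' hξ
  have h2 : |ξ 0| ≤ D.len m := by simpa [lowFrame] using hm.1
  have ti := tt_near hi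
  have tj := tt_near hj
  have hl := D.len_pos m
  rw [abs_le] at h1 h2
  rcases lt_abs.1 hij with h | h <;> nlinarith [mul_lt_mul_of_pos_left h hl]

/-- The constant in the low-frequency estimate before averaging. -/
def lowC (m : ℕ) : ℝ := 37 * (kerC (pw m + 3) * I3 * (kerI * (64 * kerC (pw m))))

lemma lowC_nonneg (m : ℕ) : 0 ≤ lowC m := by
  have := kerC_nonneg (pw m + 3); have := kerC_nonneg (pw m)
  have := I3_nonneg; have := kerI_nonneg
  unfold lowC; positivity

lemma norm_low_le (hf : D.Adm f) (hl : 0 < l) (x : E2) :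
    ‖cv (D.lowKer m k) (sqmod (D.G f l (m + 1) k)) x‖ ≤
      lowC m * ∑ j ∈ D.children m k, D.W f l m j x := by
  have hKi : Integrable (D.lowKer m k) := ker_integrable (D.lowFrame m k) 0 0
  set P : ℕ → ℕ → E2 → ℂ := fun i j y => D.Pr f l m i y * (starRingEnd ℂ) (D.Pr f l m j y) with hP
  have hPbl : ∀ i ∈ D.children m k, ∀ j ∈ D.children m k, BL univ (P i j) := fun i hi j hj =>
    ((Pr_bl hf hl (mem_children.1 hi).1).mul_conj
      (Pr_bl hf hl (mem_children.1 hj).1)).mono (subset_univ _)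
  have e : sqmod (D.G f l (m + 1) k) = fun y => ∑ i ∈ D.children m k, ∑ j ∈ D.children m k,
      P i j y := by
    ext y
    simp only [sqmod, G_succ, hP, map_sum, Finset.sum_mul_sum]
  have e' : cv (D.lowKer m k) (sqmod (D.G f l (m + 1) k)) x =
      ∑ i ∈ D.children m k, ∑ j ∈ D.children m k, cv (D.lowKer m k) (P i j) x := by
    rw [e, cv_sum_right hKi (S := fun _ => univ) fun i hi => BL.sum (hPbl i hi)]
    refine Finset.sum_congr rfl fun i hi => ?_
    rw [cv_sum_right hKi (hPbl i hi)]
  rw [e']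
  set I : ℕ → ℝ := fun j => ∫ z, ‖D.lowKer m k z‖ * ‖D.Pr f l m j (x - z)‖ ^ 2 with hI
  have hI0 : ∀ j, 0 ≤ I j := fun j =>
    integral_nonneg fun z => mul_nonneg (norm_nonneg _) (sq_nonneg _)
  have hjint : ∀ j ∈ D.children m k, Integrable fun z =>
      ‖D.lowKer m k z‖ * ‖D.Pr f l m j (x - z)‖ ^ 2 := fun j hj => by
    have h := Pr_bl hf hl (mem_children.1 hj).1
    obtain ⟨C, hC⟩ := h.sq_bdd
    exact integrable_av hKi.norm (h.cont.norm.pow 2).measurable hC x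
  have hIle : ∀ j ∈ D.children m k, I j ≤
      kerC (pw m + 3) * I3 * (kerI * (64 * kerC (pw m))) * D.W f l m j x := by
    intro j hj
    obtain ⟨hj', hjk⟩ := mem_children.1 hj
    have hN := N_child_le_low hj'
    rw [hjk] at hN
    have hs := ((G_bl hf hl hj').sqav_slow le_rfl hN (three_le_pw m)).const_mul
      (C := kerI * (64 * kerC (pw m))) (mul_nonneg kerI_nonneg (by
        have := kerC_nonneg (pw m); positivity))
    have := hs.integral_le (w := fun z => ‖D.lowKer m k z‖)
      (u := fun y => ‖D.Pr f l m j y‖ ^ 2) (C := kerC (pw m + 3)) (fun z => by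
        rw [abs_norm]; exact ker_decay _ 0 0 _ z) (fun y => by
        rw [abs_of_nonneg (sq_nonneg _)]
        exact (G_bl hf hl hj').norm_prune_sq_le (three_le_pw m) y) x
    simp only [abs_norm, abs_pow, one_pow, one_mul] at this
    refine this.trans (le_of_eq ?_)
    rw [W]; ring
  have key : ∑ i ∈ D.children m k, ∑ j ∈ D.children m k, ‖cv (D.lowKer m k) (P i j) x‖ ≤
      (2 * (18 : ℕ) + 1) * ∑ j ∈ D.children m k, I j := by
    refine sum_near_le hI0 (fun i hi j hj hij => ?_) fun i hi j hj => ?_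
    · rw [low_vanish hf hl (mem_children.1 hi).1 (mem_children.1 hj).1 (by exact_mod_cast hij),
        norm_zero]
    · refine (norm_integral_le_integral_norm _).trans ?_
      rw [hI, ← integral_add (hjint i hi) (hjint j hj), ← integral_div]
      refine integral_mono_of_nonneg (ae_of_all _ fun z => norm_nonneg _)
        (((hjint i hi).add (hjint j hj)).div_const 2) (ae_of_all _ fun z => ?_)
      simp only [hP, norm_mul, RCLike.norm_conj]
      nlinarith [mul_nonneg (norm_nonneg (D.lowKer m k z))
        (sq_nonneg (‖D.Pr f l m i (x - z)‖ - ‖D.Pr f l m j (x - z)‖))]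
  calc _ ≤ ∑ i ∈ D.children m k, ∑ j ∈ D.children m k, ‖cv (D.lowKer m k) (P i j) x‖ :=
        (norm_sum_le _ _).trans (Finset.sum_le_sum fun i _ => norm_sum_le _ _)
    _ ≤ (2 * (18 : ℕ) + 1) * ∑ j ∈ D.children m k, I j := key
    _ ≤ (2 * (18 : ℕ) + 1) * ∑ j ∈ D.children m k,
        kerC (pw m + 3) * I3 * (kerI * (64 * kerC (pw m))) * D.W f l m j x := by
        gcongr with j hj; exact hIle j hj
    _ = _ := by rw [← Finset.mul_sum, lowC]; push_cast; ring

/-- The square function of a node is controlled by its high part and its children. -/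
lemma W_le (hf : D.Adm f) (hl : 0 < l) (hk : k ∈ D.nodes (m + 1)) (x : E2) :
    (D.W f l (m + 1) k x : ℂ) = D.Hi f l m k x +
      cv (D.cw (m + 1) k) (cv (D.lowKer m k) (sqmod (D.G f l (m + 1) k))) x ∧
    ‖cv (D.cw (m + 1) k) (cv (D.lowKer m k) (sqmod (D.G f l (m + 1) k))) x‖ ≤
      I3 * lowC m * ∑ j ∈ D.children m k, D.W f l m j x := by
  have hU := sqmod_bl hf hl hk
  have hKi := ker_integrable (D.lowFrame m k) 0 0
  have hcv : BL _ (cv (D.lowKer m k) (sqmod (D.G f l (m + 1) k))) := hU.cv_bl hKi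
  have hd := hU.sub_cv_bl hKi
  have hci := D.cw_integrable (m + 1) k
  constructor
  · obtain ⟨C, -, hC⟩ := hcv.bdd
    obtain ⟨C', -, hC'⟩ := hd.bdd
    have := cv_add_right hci hd.cont.measurable hC' hcv.cont.measurable hC x
    rw [Hi]
    refine Eq.trans ?_ this
    have e : (fun y => sqmod (D.G f l (m + 1) k) y -
        cv (ker (D.lowFrame m k) 0 0) (sqmod (D.G f l (m + 1) k)) y +
        cv (D.lowKer m k) (sqmod (D.G f l (m + 1) k)) y) = sqmod (D.G f l (m + 1) k) := by
      ext y; exact sub_add_cancel _ _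
    rw [e, cv, W, sqav, av, ← integral_complex_ofReal]
    congr 1; ext z
    rw [sqmod_eq, cw]; push_cast; ring
  · have hs : Slow (D.frame (m + 1) k) 1 (pw m)
        (fun x => lowC m * ∑ j ∈ D.children m k, D.W f l m j x) := by
      refine (Slow.sum fun j hj => ?_).const_mul (lowC_nonneg m)
      obtain ⟨hj', hjk⟩ := mem_children.1 hj
      have hN := N_child_le_frame hj'
      rw [hjk] at hN
      exact (G_bl hf hl hj').sqav_slow le_rfl hN (three_le_pw m)
    have := hs.integral_le (w := fun z => (D.frame (m + 1) k).w (pw (m + 1)) z)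
      (u := fun y => ‖cv (D.lowKer m k) (sqmod (D.G f l (m + 1) k)) y‖) (C := 1) (fun z => by
        rw [abs_of_pos ((D.frame (m + 1) k).w_pos _ z), one_mul]; exact le_rfl) (fun y => by
        rw [abs_norm]; exact norm_low_le hf hl y) x
    refine (norm_integral_le_integral_norm _).trans ?_
    simp only [norm_mul, norm_cw]
    simp only [abs_norm, abs_of_pos ((D.frame (m + 1) k).w_pos _ _), one_pow, one_mul] at this
    refine this.trans (le_of_eq ?_)
    ring

/-- The high-frequency part of the square function. -/
def HH (D : Fam) (f : ℕ → E2 → ℂ) (l : ℝ) (m : ℕ) (x : E2) : ℂ :=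
  ∑ k ∈ D.nodes (m + 1), D.Hi f l m k x

lemma gs_le (hf : D.Adm f) (hl : 0 < l) (x : E2) :
    D.gs f l (m + 1) x ≤ ‖D.HH f l m x‖ + I3 * lowC m * D.gs f l m x := by
  have e : (D.gs f l (m + 1) x : ℂ) = D.HH f l m x + ∑ k ∈ D.nodes (m + 1),
      cv (D.cw (m + 1) k) (cv (D.lowKer m k) (sqmod (D.G f l (m + 1) k))) x := by
    rw [HH, ← Finset.sum_add_distrib, gs, Complex.ofReal_sum]
    exact Finset.sum_congr rfl fun k hk => (W_le hf hl hk x).1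
  have h1 : D.gs f l (m + 1) x = ‖(D.gs f l (m + 1) x : ℂ)‖ := by
    rw [Complex.norm_real, Real.norm_of_nonneg (gs_nonneg x)]
  rw [h1, e]
  refine (norm_add_le _ _).trans (add_le_add le_rfl ?_)
  refine (norm_sum_le _ _).trans ((Finset.sum_le_sum fun k hk => (W_le hf hl hk x).2).trans ?_)
  rw [← Finset.mul_sum, sum_children, gs]

end Fam


lemma card_le_of_bins {T : Finset ℕ} {u : ℕ → ℝ} {y δ : ℝ} {N M : ℕ} (hδ : 0 < δ)
    (h1 : ∀ k ∈ T, y ≤ u k ∧ u k ≤ y + N * δ)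
    (h2 : ∀ z, (T.filter fun k => z ≤ u k ∧ u k < z + δ).card ≤ M) :
    T.card ≤ M * (N + 1) := by
  classical
  have hm : ∀ k ∈ T, ⌊(u k - y) / δ⌋₊ ∈ Finset.range (N + 1) := fun k hk => by
    rw [Finset.mem_range, Nat.lt_succ_iff]
    refine Nat.floor_le_of_le ?_
    rw [div_le_iff₀ hδ]; linarith [(h1 k hk).2]
  have := Finset.card_le_mul_card_image_of_maps_to hm M fun j _ => ?_
  · simpa using this
  · refine le_trans (Finset.card_le_card fun k hk => ?_) (h2 (y + j * δ))
    obtain ⟨hkT, rfl⟩ := Finset.mem_filter.1 hk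
    have h0 : 0 ≤ (u k - y) / δ := div_nonneg (by linarith [(h1 k hkT).1]) hδ.le
    have h3 := Nat.floor_le h0
    have h4 := Nat.lt_floor_add_one ((u k - y) / δ)
    rw [le_div_iff₀ hδ] at h3
    rw [div_lt_iff₀ hδ] at h4
    refine Finset.mem_filter.2 ⟨hkT, by linarith, by linarith⟩

namespace Fam

variable {D : Fam} {f : ℕ → E2 → ℂ} {l : ℝ} {m : ℕ}

lemma lt_of_leaves {k k' i j : ℕ} (hi : i ∈ D.leaves m k) (hj : j ∈ D.leaves m k') (h : k < k') :
    i < j := by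
  obtain ⟨-, rfl⟩ := mem_leaves.1 hi
  obtain ⟨-, rfl⟩ := mem_leaves.1 hj
  by_contra hlt
  exact absurd (Nat.div_le_div_right (c := D.b ^ m) (not_lt.1 hlt)) (not_le.2 h)

lemma slope_gap {k k' : ℕ} (hk : k ∈ D.nodes m) (hk' : k' ∈ D.nodes m) (h : k < k') :
    D.v (D.rep m k) + (D.mu m k - 4 * D.ρ) ≤ D.v (D.rep m k') := by
  have := v_mono (top_mem_X hk) (rep_mem_X hk') (lt_of_leaves (top_mem hk) (rep_mem hk') h).le
  rw [mu_eq hk]; linarith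

lemma card_bin_le {T : Finset ℕ} (hT : T ⊆ D.nodes m) {Y : ℝ} (hY : ∀ k ∈ T, Y ≤ D.mu m k)
    (h : Y = D.ρ ∨ 16 * D.ρ ≤ Y) (z : ℝ) :
    (T.filter fun k => z ≤ D.v (D.rep m k) ∧ D.v (D.rep m k) < z + Y / 2).card ≤ 4 := by
  classical
  rcases h with rfl | h
  · have hinj : Set.InjOn (D.rep m)
        (T.filter fun k => z ≤ D.v (D.rep m k) ∧ D.v (D.rep m k) < z + D.ρ / 2) := by
      intro k hk k' hk' h
      have h1 := (mem_leaves.1 (rep_mem (hT (Finset.mem_filter.1 hk).1))).2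
      have h2 := (mem_leaves.1 (rep_mem (hT (Finset.mem_filter.1 hk').1))).2
      rw [← h1, ← h2, h]
    rw [← Finset.card_image_of_injOn hinj]
    refine (Finset.card_le_card fun i hi => ?_).trans (D.sparse z)
    obtain ⟨k, hk, rfl⟩ := Finset.mem_image.1 hi
    obtain ⟨hk, h1, h2⟩ := Finset.mem_filter.1 hk
    exact Finset.mem_filter.2 ⟨rep_mem_X (hT hk), h1, by linarith [D.hρ]⟩
  · refine le_trans (Finset.card_le_one.2 fun k hk k' hk' => ?_) (by norm_num)
    obtain ⟨hk, h1, h2⟩ := Finset.mem_filter.1 hk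
    obtain ⟨hk', h1', h2'⟩ := Finset.mem_filter.1 hk'
    have hρ := D.hρ
    rcases lt_trichotomy k k' with hlt | rfl | hlt
    · linarith [slope_gap (hT hk) (hT hk') hlt, hY k hk]
    · rfl
    · linarith [slope_gap (hT hk') (hT hk) hlt, hY k' hk']

lemma card_group_le {T : Finset ℕ} (hT : T ⊆ D.nodes m) {Y y : ℝ}
    (hY : ∀ k ∈ T, Y ≤ D.mu m k ∧ D.mu m k < D.b * Y) (h : Y = D.ρ ∨ 16 * D.ρ ≤ Y)
    (hy : ∀ k ∈ T, |y - D.v (D.rep m k)| ≤ 16 * D.b * D.mu m k) :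
    T.card ≤ 4 * (64 * D.b ^ 2 + 1) := by
  have hρ := D.hρ
  have hb := D.one_le_b
  have hYpos : 0 < Y := by rcases h with rfl | h <;> linarith
  refine card_le_of_bins (u := fun k => D.v (D.rep m k)) (y := y - 16 * D.b * (D.b * Y))
    (δ := Y / 2) (by linarith) (fun k hk => ?_) (card_bin_le hT (fun k hk => (hY k hk).1) h)
  have h1 := hy k hk
  have h2 : 16 * (D.b : ℝ) * D.mu m k ≤ 16 * D.b * (D.b * Y) := by
    gcongr; exact (hY k hk).2.le
  rw [abs_le] at h1
  push_cast
  constructor <;> linarith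

lemma exists_group {n k : ℕ} (hS : D.S ≤ D.b ^ (n + 1) * D.ρ) (hk : k ∈ D.nodes m) :
    ∃ i ∈ Finset.range (n + 2), D.b ^ i * D.ρ ≤ D.mu m k ∧ D.mu m k < D.b * (D.b ^ i * D.ρ) := by
  have hρ := D.hρ
  have hb := D.one_le_b
  have h0 : 1 ≤ D.mu m k / D.ρ := by
    rw [le_div_iff₀ hρ]; linarith [D.four_rho_le_mu m k]
  obtain ⟨i, h1, h2⟩ := exists_nat_pow_near h0 (by linarith : (1 : ℝ) < D.b)
  rw [le_div_iff₀ hρ] at h1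
  rw [div_lt_iff₀ hρ] at h2
  refine ⟨i, ?_, h1, by rw [← mul_assoc, ← pow_succ']; exact h2⟩
  rw [Finset.mem_range]
  by_contra hi
  have h3 : (D.b : ℝ) ^ (n + 2) ≤ D.b ^ i := pow_le_pow_right₀ (by linarith) (not_lt.1 hi)
  have h4 := mu_le hk
  have h5 : (1 : ℝ) ≤ D.b ^ (n + 1) := one_le_pow₀ (by linarith)
  have h6 : (D.b : ℝ) ^ (n + 2) * D.ρ ≤ D.b ^ i * D.ρ := by gcongr
  have h7 : D.ρ ≤ D.b ^ (n + 1) * D.ρ := by nlinarith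
  have h8 : 16 * ((D.b : ℝ) ^ (n + 1) * D.ρ) ≤ D.b ^ (n + 2) * D.ρ := by
    rw [pow_succ _ (n + 1), mul_comm _ (D.b : ℝ), mul_assoc]; gcongr
  linarith

lemma card_overlap_le {n : ℕ} (hS : D.S ≤ D.b ^ (n + 1) * D.ρ) {T : Finset ℕ}
    (hT : T ⊆ D.nodes m) {y : ℝ}
    (hy : ∀ k ∈ T, |y - D.v (D.rep m k)| ≤ 16 * D.b * D.mu m k) :
    T.card ≤ (n + 2) * (4 * (64 * D.b ^ 2 + 1)) := by
  classical
  have hρ := D.hρ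
  have hb := D.one_le_b
  have hsub : T ⊆ (Finset.range (n + 2)).biUnion fun i => T.filter fun k =>
      D.b ^ i * D.ρ ≤ D.mu m k ∧ D.mu m k < D.b * (D.b ^ i * D.ρ) := fun k hk => by
    obtain ⟨i, hi, h⟩ := exists_group hS (hT hk)
    exact Finset.mem_biUnion.2 ⟨i, hi, Finset.mem_filter.2 ⟨hk, h⟩⟩
  refine (Finset.card_le_card hsub).trans (Finset.card_biUnion_le.trans ?_)
  refine (Finset.sum_le_card_nsmul _ _ (4 * (64 * D.b ^ 2 + 1)) fun i _ => ?_).trans (by simp)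
  refine card_group_le (Y := D.b ^ i * D.ρ) (y := y) (m := m) ((Finset.filter_subset _ _).trans hT)
    (fun k hk => (Finset.mem_filter.1 hk).2) ?_ fun k hk => hy k (Finset.mem_filter.1 hk).1
  rcases i.eq_zero_or_pos with rfl | hi
  · left; simp
  · right
    have : (16 : ℝ) ≤ D.b ^ i := hb.trans (le_self_pow₀ (by linarith) hi.ne')
    gcongr

lemma HH_overlap {n : ℕ} (hS : D.S ≤ D.b ^ (n + 1) * D.ρ) (hf : D.Adm f) (hl : 0 < l) :
    ∫ x, ‖D.HH f l m x‖ ^ 2 ≤ ((n + 2) * (4 * (64 * D.b ^ 2 + 1)) : ℕ) *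
      ∑ k ∈ D.nodes (m + 1), ∫ x, ‖D.Hi f l m k x‖ ^ 2 := by
  classical
  refine BL.orth (fun k hk => Hi_bl hf hl hk) fun ξ => ?_
  refine ⟨(D.nodes (m + 1)).filter fun k => D.len m / 4 < |ξ 0| ∧
      |ξ 1 - D.v (D.rep (m + 1) k) * ξ 0| ≤ 4 * (D.len (m + 1) * D.mu (m + 1) k), ?_,
    fun k hk h => Finset.mem_filter.2 ⟨hk, h⟩⟩
  refine Nat.cast_le.2 (card_overlap_le hS (Finset.filter_subset _ _) (y := ξ 1 / ξ 0)
    fun k hk => ?_)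
  obtain ⟨-, h1, h2⟩ := Finset.mem_filter.1 hk
  have hl := D.len_pos m
  have hmu := D.mu_pos (m + 1) k
  have hb := D.one_le_b
  have h0 : 0 < |ξ 0| := by linarith
  have e : ξ 1 / ξ 0 - D.v (D.rep (m + 1) k) = (ξ 1 - D.v (D.rep (m + 1) k) * ξ 0) / ξ 0 := by
    field_simp [abs_pos.1 h0]
  rw [e, abs_div, div_le_iff₀ h0]
  refine h2.trans ?_
  rw [len_succ]
  have h3 : 0 < (D.b : ℝ) * D.mu (m + 1) k := by positivity
  nlinarith [mul_lt_mul_of_pos_left h1 h3]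

/-- The constant in the energy estimate of the high part. -/
def hiC (m : ℕ) : ℝ := 260 * (I3 ^ 2 * (2 * (1 + kerI ^ 2)) * kerI ^ 2) * (19 * kerI ^ 2) ^ (m + 1)

lemma hiC_nonneg (m : ℕ) : 0 ≤ hiC m := by
  have := I3_nonneg; have := kerI_nonneg; unfold hiC; positivity

lemma HH_energy {n : ℕ} (hS : D.S ≤ D.b ^ (n + 1) * D.ρ) (hf : D.Adm f) (hl : 0 < l) :
    ∫ x, ‖D.HH f l m x‖ ^ 2 ≤ hiC m * (n + 2) * D.b ^ 4 * l ^ 2 *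
      ∑ i ∈ D.X, ∫ x, ‖f i x‖ ^ 2 := by
  have hb := D.one_le_b
  have hI := I3_nonneg
  have hkI := kerI_nonneg
  have hE : 0 ≤ ∑ i ∈ D.X, ∫ x, ‖f i x‖ ^ 2 :=
    Finset.sum_nonneg fun i _ => integral_nonneg fun x => sq_nonneg _
  have h1 : (((n + 2) * (4 * (64 * D.b ^ 2 + 1)) : ℕ) : ℝ) ≤ 260 * (n + 2) * D.b ^ 2 := by
    push_cast
    have : (1 : ℝ) ≤ D.b ^ 2 := one_le_pow₀ (by linarith)
    nlinarith [mul_le_mul_of_nonneg_left this (by positivity : (0 : ℝ) ≤ n + 2)]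
  have h2 : ∑ k ∈ D.nodes (m + 1), ∫ x, ‖D.Hi f l m k x‖ ^ 2 ≤
      I3 ^ 2 * (2 * (1 + kerI ^ 2)) * (D.b * (kerI * l)) ^ 2 *
        ((19 * kerI ^ 2) ^ (m + 1) * ∑ i ∈ D.X, ∫ x, ‖f i x‖ ^ 2) := by
    refine (Finset.sum_le_sum fun k hk => Hi_energy hf hl hk).trans ?_
    rw [← Finset.mul_sum]
    exact mul_le_mul_of_nonneg_left (energy_le hf hl (m + 1)) (by positivity)
  calc _ ≤ (260 * (n + 2) * (D.b : ℝ) ^ 2) * (I3 ^ 2 * (2 * (1 + kerI ^ 2)) *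
        (D.b * (kerI * l)) ^ 2 * ((19 * kerI ^ 2) ^ (m + 1) * ∑ i ∈ D.X, ∫ x, ‖f i x‖ ^ 2)) :=
        (HH_overlap hS hf hl).trans (mul_le_mul h1 h2 (Finset.sum_nonneg fun k _ =>
          integral_nonneg fun x => sq_nonneg _) (by positivity))
    _ = _ := by rw [hiC]; ring

end Fam


lemma BL.translate {S : Set E2} {f : E2 → ℂ} (hf : BL S f) (x0 : E2) :
    BL S (fun x => f (x - x0)) := by
  obtain ⟨h2, g, hg, hS, rfl⟩ := hf
  refine ⟨h2.comp_measurePreserving (measurePreserving_sub_right volume x0),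
    fun ξ => (Real.fourierChar (inner ℝ ξ (-x0)) : ℂ) * g ξ, ?_, fun ξ hξ => by simp [hS ξ hξ], ?_⟩
  · refine hg.bdd_mul (c := 1) ?_ (ae_of_all _ fun ξ => (Circle.norm_coe _).le)
    exact (Continuous.aestronglyMeasurable (by fun_prop))
  · ext x
    rw [Real.fourierInv_eq, Real.fourierInv_eq]
    refine integral_congr_ae (ae_of_all _ fun ξ => ?_)
    simp only [Circle.smul_def, smul_eq_mul, sub_eq_add_neg, inner_add_right, AddChar.map_add_eq_mul,
      Circle.coe_mul]
    ring

namespace Fam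

variable {D : Fam} {f : ℕ → E2 → ℂ} {l : ℝ} {m k : ℕ}

lemma node_strip (hk : k ∈ D.nodes m) {ξ : E2}
    (h : ξ ∈ plank (D.tt m k) (D.cc m k) (D.frame m k).v (2 * (D.frame m k).a)
      (2 * (D.frame m k).b)) :
    |ξ 0 - D.tt m k| ≤ 2 * D.len m ∧
      |ξ 1 - D.s * ξ 0 - (D.cc m k - D.s * D.tt m k)| ≤ 12 * (D.S * D.len m) := by
  have hl := D.len_pos m
  have hmu := mu_le hk
  have hS := D.hS
  have hv := D.slope_mem _ (rep_mem_X hk)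
  obtain ⟨h0, h1⟩ := h
  simp only [frame] at h0 h1
  refine ⟨h0, ?_⟩
  have e : ξ 1 - D.s * ξ 0 - (D.cc m k - D.s * D.tt m k) =
      (ξ 1 - D.cc m k - D.v (D.rep m k) * (ξ 0 - D.tt m k)) +
        (D.v (D.rep m k) - D.s) * (ξ 0 - D.tt m k) := by ring
  rw [e]
  have h2 : |(D.v (D.rep m k) - D.s) * (ξ 0 - D.tt m k)| ≤ D.S * (2 * D.len m) := by
    rw [abs_mul]
    refine mul_le_mul ?_ h0 (abs_nonneg _) D.S_pos.le
    rw [abs_of_nonneg] <;> linarith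
  have h3 : D.len m * D.mu m k ≤ D.len m * (5 * D.S) := by gcongr; linarith
  refine (abs_add_le _ _).trans ?_
  nlinarith

lemma separation_le {i j i' j' : ℕ} (hi : i ∈ D.X) (hj : j ∈ D.X) (hi' : i' ∈ D.X) (hj' : j' ∈ D.X)
    {K ℓ : ℝ} (hK : 0 < K) (hℓ : 0 < ℓ) (hsep : D.v i + D.S / K ≤ D.v i')
    (h0 : |(D.L * j - D.L * i) + (D.L * j' - D.L * i')| ≤ 10 * ℓ)
    (h1 : |((D.c j - D.s * (D.L * j)) - (D.c i - D.s * (D.L * i))) +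
      ((D.c j' - D.s * (D.L * j')) - (D.c i' - D.s * (D.L * i')))| ≤ 50 * (D.S * ℓ)) :
    D.L * j' - D.L * i' ≤ 60 * K * ℓ := by
  have e1 := D.supp i hi j hj
  have e2 := D.supp i' hi' j' hj'
  have hv := D.slope_mem i hi
  have hS := D.S_pos
  set u := D.L * (j : ℝ) - D.L * i
  set u' := D.L * (j' : ℝ) - D.L * i'
  rcases le_total u' 0 with h | h
  · exact h.trans (by positivity)
  have h2 : (D.S / K) * u' ≤ (D.v i' - D.v i) * u' :=
    mul_le_mul_of_nonneg_right (by linarith) h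
  have h3 : -(D.S * (10 * ℓ)) ≤ (D.v i - D.s) * (u + u') := by
    have : |(D.v i - D.s) * (u + u')| ≤ D.S * (10 * ℓ) := by
      rw [abs_mul]
      refine mul_le_mul ?_ h0 (abs_nonneg _) hS.le
      rw [abs_of_nonneg] <;> linarith
    exact (abs_le.1 this).1
  have h4 := (abs_le.1 h1).2
  have h5 : (D.S / K) * u' ≤ 60 * (D.S * ℓ) := by
    simp only [u, u'] at *
    nlinarith
  have h6 : D.S * u' ≤ D.S * (60 * K * ℓ) := by
    rw [div_mul_eq_mul_div, div_le_iff₀ hK] at h5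
    linarith
  exact le_of_mul_le_mul_left h6 hS

section Bilinear

variable {A B : Finset ℕ} (hA : A ⊆ D.X) (hB : B ⊆ D.X)

lemma sub_Adm (hf : D.Adm f) : (D.sub A hA).Adm f := fun i hi => hf i (hA hi)

/-- The spectral set of a product of two node functions with a localisation to a box. -/
def pairSet (m : ℕ) (p : ℕ × ℕ) : Set E2 :=
  {ξ | |ξ 0 - ((D.sub A hA).tt m p.1 + (D.sub B hB).tt m p.2)| ≤ 5 * D.len m ∧
    |ξ 1 - D.s * ξ 0 - (((D.sub A hA).cc m p.1 - D.s * (D.sub A hA).tt m p.1) +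
      ((D.sub B hB).cc m p.2 - D.s * (D.sub B hB).tt m p.2))| ≤ 25 * (D.S * D.len m)}

lemma pair_bl (hf : D.Adm f) (hl : 0 < l) (x0 : E2) {p : ℕ × ℕ}
    (hp : p ∈ (D.sub A hA).nodes m ×ˢ (D.sub B hB).nodes m) :
    BL (pairSet hA hB m p) (fun x => (D.sub A hA).G f l m p.1 x * (D.sub B hB).G f l m p.2 x *
      ker (D.box m) 0 0 (x - x0)) := by
  obtain ⟨hk, hk'⟩ := Finset.mem_product.1 hp
  refine (((G_bl (sub_Adm hA hf) hl hk).mul (G_bl (sub_Adm hB hf) hl hk')).mul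
    ((ker_bl (D.box m) 0 0).translate x0)).mono ?_
  rintro ξ ⟨η, ⟨ζ, h1, h2⟩, h3⟩
  have e1 := node_strip hk h1
  have e2 := node_strip hk' h2
  obtain ⟨h3, h4⟩ := h3
  simp only [PiLp.sub_apply, box] at *
  have r1 : (D.sub A hA).len m = D.len m := rfl
  have r2 : (D.sub B hB).len m = D.len m := rfl
  have r3 : (D.sub A hA).S = D.S := rfl
  have r4 : (D.sub B hB).S = D.S := rfl
  have r5 : (D.sub A hA).s = D.s := rfl
  have r6 : (D.sub B hB).s = D.s := rfl
  rw [r1, r3, r5] at e1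
  rw [r2, r4, r6] at e2
  simp only [abs_le] at e1 e2 h3 h4
  obtain ⟨⟨a1, a2⟩, a3, a4⟩ := e1
  obtain ⟨⟨b1, b2⟩, b3, b4⟩ := e2
  obtain ⟨c1, c2⟩ := h3
  obtain ⟨d1, d2⟩ := h4
  refine ⟨abs_le.2 ⟨by linarith, by linarith⟩, abs_le.2 ⟨by linarith, by linarith⟩⟩

lemma pair_overlap {K : ℝ} (hK : 1 ≤ K) (hsep : ∀ i ∈ A, ∀ j ∈ B, D.v i + D.S / K ≤ D.v j)
    (ξ : E2) : ∃ t : Finset (ℕ × ℕ), (t.card : ℝ) ≤ 1600 * K ∧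
      ∀ p ∈ (D.sub A hA).nodes m ×ˢ (D.sub B hB).nodes m, ξ ∈ pairSet hA hB m p → p ∈ t := by
  classical
  set DA := D.sub A hA
  set DB := D.sub B hB
  have hl := D.len_pos m
  set t := (DA.nodes m ×ˢ DB.nodes m).filter fun p => ξ ∈ pairSet hA hB m p with ht
  refine ⟨t, ?_, fun p hp h => Finset.mem_filter.2 ⟨hp, h⟩⟩
  rcases t.eq_empty_or_nonempty with h | ⟨p0, hp0⟩
  · rw [h]; simp; linarith
  have far : ∀ p ∈ t, ∀ q ∈ t, DB.tt m q.2 - DB.tt m p.2 ≤ 60 * K * D.len m := by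
    intro p hp q hq
    obtain ⟨hp, p1, p2⟩ := Finset.mem_filter.1 hp
    obtain ⟨hq, q1, q2⟩ := Finset.mem_filter.1 hq
    obtain ⟨hpA, hpB⟩ := Finset.mem_product.1 hp
    obtain ⟨hqA, hqB⟩ := Finset.mem_product.1 hq
    refine separation_le (D := D) (i := DA.rep m p.1) (j := DA.rep m q.1) (i' := DB.rep m p.2)
      (j' := DB.rep m q.2) (hA (rep_mem_X hpA)) (hA (rep_mem_X hqA)) (hB (rep_mem_X hpB))
      (hB (rep_mem_X hqB)) (by linarith) hl (hsep _ (rep_mem_X hpA) _ (rep_mem_X hpB)) ?_ ?_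
    · rw [abs_le] at *
      have e1 : DA.tt m p.1 = D.L * DA.rep m p.1 := rfl
      have e2 : DA.tt m q.1 = D.L * DA.rep m q.1 := rfl
      have e3 : DB.tt m p.2 = D.L * DB.rep m p.2 := rfl
      have e4 : DB.tt m q.2 = D.L * DB.rep m q.2 := rfl
      constructor <;> linarith [p1.1, p1.2, q1.1, q1.2]
    · have e1 : DA.tt m p.1 = D.L * DA.rep m p.1 := rfl
      have e2 : DA.tt m q.1 = D.L * DA.rep m q.1 := rfl
      have e3 : DB.tt m p.2 = D.L * DB.rep m p.2 := rfl
      have e4 : DB.tt m q.2 = D.L * DB.rep m q.2 := rfl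
      have f1 : DA.cc m p.1 = D.c (DA.rep m p.1) := rfl
      have f2 : DA.cc m q.1 = D.c (DA.rep m q.1) := rfl
      have f3 : DB.cc m p.2 = D.c (DB.rep m p.2) := rfl
      have f4 : DB.cc m q.2 = D.c (DB.rep m q.2) := rfl
      rw [← e1, ← e2, ← e3, ← e4, ← f1, ← f2, ← f3, ← f4]
      simp only [DA, DB]
      rw [abs_le] at *
      constructor <;> linarith [p2.1, p2.2, q2.1, q2.2]
  have hsecond : ((t.image Prod.snd).card : ℝ) ≤ 123 * K := by
    refine (card_nat_window _ (l := D.len m) (y := DB.tt m p0.2) (R := 60 * K + 1) hl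
      (by linarith) fun k hk => ?_).trans (by linarith)
    obtain ⟨p, hp, rfl⟩ := Finset.mem_image.1 hk
    have h1 := far p hp p0 hp0
    have h2 := far p0 hp0 p hp
    have h3 := tt_near (Finset.mem_product.1 (Finset.mem_filter.1 hp).1).2
    have r : DB.len m = D.len m := rfl
    rw [r] at h3
    rw [abs_le]; constructor <;> linarith [h3.1, h3.2]
  have hfirst : t.card ≤ 13 * (t.image Prod.snd).card := by
    refine Finset.card_le_mul_card_image _ 13 fun k hk => ?_
    have hinj : Set.InjOn Prod.fst ((t.filter fun p => p.2 = k : Finset (ℕ × ℕ)) : Set (ℕ × ℕ)) := by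
      intro p hp q hq h
      exact Prod.ext h ((Finset.mem_filter.1 hp).2.trans (Finset.mem_filter.1 hq).2.symm)
    rw [← Finset.card_image_of_injOn hinj]
    have : (((t.filter fun p => p.2 = k).image Prod.fst).card : ℝ) ≤ 2 * 6 + 1 := by
      refine card_nat_window _ (l := D.len m) (y := ξ 0 - DB.tt m k) (R := 6) hl (by norm_num)
        fun k1 hk1 => ?_
      obtain ⟨p, hp, rfl⟩ := Finset.mem_image.1 hk1
      obtain ⟨hpt, rfl⟩ := Finset.mem_filter.1 hp
      obtain ⟨hpn, h1, -⟩ := Finset.mem_filter.1 hpt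
      have h3 := tt_near (Finset.mem_product.1 hpn).1
      have r : DA.len m = D.len m := rfl
      rw [r] at h3
      rw [abs_le] at *; constructor <;> linarith [h3.1, h3.2, h1.1, h1.2]
    have h13 : (((t.filter fun p => p.2 = k).image Prod.fst).card : ℝ) ≤ (13 : ℕ) := by
      push_cast; linarith
    exact_mod_cast h13
  have : (t.card : ℝ) ≤ 13 * ((t.image Prod.snd).card : ℝ) := by exact_mod_cast hfirst
  linarith

end Bilinear

/-- The constant in the pointwise bound of node functions by their square functions. -/
def ptC (m : ℕ) : ℝ := kerI * (64 * kerC (pw m))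

lemma ptC_nonneg (m : ℕ) : 0 ≤ ptC m := by
  have := kerI_nonneg; have := kerC_nonneg (pw m); unfold ptC; positivity

lemma norm_G_sq_le (hf : D.Adm f) (hl : 0 < l) (hk : k ∈ D.nodes m) (x : E2) :
    ‖D.G f l m k x‖ ^ 2 ≤ ptC m * D.W f l m k x :=
  (G_bl hf hl hk).norm_sq_le_sqav (three_le_pw m) x

lemma W_slow (hf : D.Adm f) (hl : 0 < l) (hk : k ∈ D.nodes m) :
    Slow (D.box m) 6 (pw m) (D.W f l m k) :=
  (G_bl hf hl hk).sqav_slow (by norm_num) (N_le_box hk) (three_le_pw m)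

lemma gs_slow (hf : D.Adm f) (hl : 0 < l) : Slow (D.box m) 6 (pw m) (D.gs f l m) :=
  Slow.sum fun _ hk => W_slow hf hl hk

/-- The pointwise bound of a localised node function. -/
lemma norm_G_loc_le (hf : D.Adm f) (hl : 0 < l) (hk : k ∈ D.nodes m) (x x0 : E2) :
    ‖D.G f l m k x‖ ^ 2 ≤ ptC m * ((6 * (1 + (D.box m).N (x - x0))) ^ pw m * D.W f l m k x0) := by
  refine (norm_G_sq_le hf hl hk x).trans (mul_le_mul_of_nonneg_left ?_ (ptC_nonneg m))
  have := (W_slow hf hl hk).2 x0 (x0 - x)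
  rwa [sub_sub_cancel, ← (D.box m).N_neg, neg_sub] at this

section Bilinear

variable {A B : Finset ℕ} (hA : A ⊆ D.X) (hB : B ⊆ D.X)

/-- The constant in the estimate of a single localised product. -/
def pairC (m : ℕ) : ℝ := (ptC m * 6 ^ pw m * kerC (pw m + 3)) ^ 2 * I3

lemma pair_integral_le (hf : D.Adm f) (hl : 0 < l) (x0 : E2) {p : ℕ × ℕ}
    (hp : p ∈ (D.sub A hA).nodes m ×ˢ (D.sub B hB).nodes m) :
    ∫ x, ‖(D.sub A hA).G f l m p.1 x * (D.sub B hB).G f l m p.2 x *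
      ker (D.box m) 0 0 (x - x0)‖ ^ 2 ≤
      pairC m * ((D.box m).a * (D.box m).b) *
        ((D.sub A hA).W f l m p.1 x0 * (D.sub B hB).W f l m p.2 x0) := by
  obtain ⟨hk, hk'⟩ := Finset.mem_product.1 hp
  set P := D.box m
  set WA := (D.sub A hA).W f l m p.1 x0
  set WB := (D.sub B hB).W f l m p.2 x0
  have hWA : 0 ≤ WA := W_nonneg x0
  have hWB : 0 ≤ WB := W_nonneg x0
  have hC := ptC_nonneg m
  have hkC := kerC_nonneg (pw m + 3)
  have hab : 0 < P.a * P.b := mul_pos P.ha P.hb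
  have key : ∀ x, ‖(D.sub A hA).G f l m p.1 x * (D.sub B hB).G f l m p.2 x *
      ker P 0 0 (x - x0)‖ ^ 2 ≤ (ptC m * 6 ^ pw m * kerC (pw m + 3)) ^ 2 * (P.a * P.b) *
        (WA * WB) * P.w 3 (x - x0) := by
    intro x
    have h1 : _ ≤ ptC m * ((6 * (1 + P.N (x - x0))) ^ pw m * WA) :=
      norm_G_loc_le (sub_Adm hA hf) hl hk x x0
    have h2 : _ ≤ ptC m * ((6 * (1 + P.N (x - x0))) ^ pw m * WB) :=
      norm_G_loc_le (sub_Adm hB hf) hl hk' x x0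
    have h3 := ker_decay P 0 0 (pw m + 3) (x - x0)
    have h4 := P.w_succ_mul (pw m) 3 (x - x0)
    have hN := P.one_add_N_pos (x - x0)
    have hw3 := P.w_pos 3 (x - x0)
    have h5 : P.w 3 (x - x0) ≤ P.a * P.b := by
      have h6 : 1 ≤ (1 + P.N (x - x0)) ^ 3 := one_le_pow₀ (by linarith [P.N_nonneg (x - x0)])
      rw [Frame.w]
      exact mul_le_of_le_one_right hab.le (inv_le_one_of_one_le₀ h6)
    rw [norm_mul, norm_mul, mul_pow, mul_pow]
    calc _ ≤ (ptC m * ((6 * (1 + P.N (x - x0))) ^ pw m * WA)) *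
          (ptC m * ((6 * (1 + P.N (x - x0))) ^ pw m * WB)) *
          (kerC (pw m + 3) * P.w (pw m + 3) (x - x0)) ^ 2 := by gcongr
      _ = (ptC m * 6 ^ pw m * kerC (pw m + 3)) ^ 2 * (WA * WB) *
          (P.w (pw m + 3) (x - x0) * (1 + P.N (x - x0)) ^ pw m) ^ 2 := by
          rw [mul_pow 6]; ring
      _ = (ptC m * 6 ^ pw m * kerC (pw m + 3)) ^ 2 * (WA * WB) *
          (P.w 3 (x - x0) * P.w 3 (x - x0)) := by rw [h4]; ring
      _ ≤ (ptC m * 6 ^ pw m * kerC (pw m + 3)) ^ 2 * (WA * WB) *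
          ((P.a * P.b) * P.w 3 (x - x0)) := by gcongr
      _ = _ := by ring
  refine (integral_mono (pair_bl hA hB hf hl x0 hp).sqInt
    (((P.integrable_w le_rfl).comp_sub_right x0).const_mul _) key).trans (le_of_eq ?_)
  rw [integral_const_mul, integral_sub_right_eq_self (P.w 3) x0, P.integral_w3, pairC]
  ring

/-- The constant in the local bilinear estimate. -/
def bilC (m : ℕ) : ℝ := 1600 * pairC m / kerL ^ 2

lemma pairC_nonneg (m : ℕ) : 0 ≤ pairC m := by
  have := I3_nonneg; unfold pairC; positivity

lemma bilC_nonneg (m : ℕ) : 0 ≤ bilC m := by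
  have := pairC_nonneg m; unfold bilC; positivity

/-- The sum of the functions of all nodes of height `m`. -/
def tot (D : Fam) (f : ℕ → E2 → ℂ) (l : ℝ) (m : ℕ) (x : E2) : ℂ :=
  ∑ k ∈ D.nodes m, D.G f l m k x

lemma tot_bl (hf : D.Adm f) (hl : 0 < l) : BL univ (D.tot f l m) :=
  BL.sum fun _ hk => (G_bl hf hl hk).mono (subset_univ _)

/-- The local bilinear estimate. -/
lemma local_bilinear {K : ℝ} (hK : 1 ≤ K) (hsep : ∀ i ∈ A, ∀ j ∈ B, D.v i + D.S / K ≤ D.v j)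
    (hf : D.Adm f) (hl : 0 < l) (x0 : E2) :
    ∫ x, {y | (D.box m).N y ≤ kerR}.indicator (fun _ => (1 : ℝ)) (x - x0) *
        ‖(D.sub A hA).tot f l m x * (D.sub B hB).tot f l m x‖ ^ 2 ≤
      bilC m * K * ((D.box m).a * (D.box m).b)⁻¹ *
        ((D.sub A hA).gs f l m x0 * (D.sub B hB).gs f l m x0) := by
  set P := D.box m
  have hab : 0 < P.a * P.b := mul_pos P.ha P.hb
  have hL := kerL_pos
  have e : ∀ x, ∑ p ∈ (D.sub A hA).nodes m ×ˢ (D.sub B hB).nodes m,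
      (D.sub A hA).G f l m p.1 x * (D.sub B hB).G f l m p.2 x * ker P 0 0 (x - x0) =
      (D.sub A hA).tot f l m x * (D.sub B hB).tot f l m x * ker P 0 0 (x - x0) := fun x => by
    rw [← Finset.sum_mul, Finset.sum_product, tot, tot, Finset.sum_mul_sum]
  have hbl : BL univ fun x => (D.sub A hA).tot f l m x * (D.sub B hB).tot f l m x *
      ker P 0 0 (x - x0) :=
    (((tot_bl (sub_Adm hA hf) hl).mul (tot_bl (sub_Adm hB hf) hl)).mul
      ((ker_bl P 0 0).translate x0)).mono (subset_univ _)
  have h1 : ∫ x, ‖(D.sub A hA).tot f l m x * (D.sub B hB).tot f l m x * ker P 0 0 (x - x0)‖ ^ 2 ≤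
      1600 * K * ∑ p ∈ (D.sub A hA).nodes m ×ˢ (D.sub B hB).nodes m,
        ∫ x, ‖(D.sub A hA).G f l m p.1 x * (D.sub B hB).G f l m p.2 x *
          ker P 0 0 (x - x0)‖ ^ 2 := by
    simp only [← e]
    exact BL.orth (fun p hp => pair_bl hA hB hf hl x0 hp) (pair_overlap hA hB hK hsep)
  have h2 : ∑ p ∈ (D.sub A hA).nodes m ×ˢ (D.sub B hB).nodes m,
      ∫ x, ‖(D.sub A hA).G f l m p.1 x * (D.sub B hB).G f l m p.2 x *
        ker P 0 0 (x - x0)‖ ^ 2 ≤ pairC m * (P.a * P.b) *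
      ((D.sub A hA).gs f l m x0 * (D.sub B hB).gs f l m x0) := by
    refine (Finset.sum_le_sum fun p hp => pair_integral_le hA hB hf hl x0 hp).trans (le_of_eq ?_)
    rw [← Finset.mul_sum, Finset.sum_product, gs, gs, Finset.sum_mul_sum]
  have h3 : (kerL * (P.a * P.b)) ^ 2 *
      ∫ x, {y | P.N y ≤ kerR}.indicator (fun _ => (1 : ℝ)) (x - x0) *
        ‖(D.sub A hA).tot f l m x * (D.sub B hB).tot f l m x‖ ^ 2 ≤
      ∫ x, ‖(D.sub A hA).tot f l m x * (D.sub B hB).tot f l m x * ker P 0 0 (x - x0)‖ ^ 2 := by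
    rw [← integral_const_mul]
    refine integral_mono_of_nonneg (ae_of_all _ fun x => ?_) hbl.sqInt (ae_of_all _ fun x => ?_)
    · exact mul_nonneg (sq_nonneg _) (mul_nonneg (indicator_nonneg (fun _ _ => zero_le_one) _)
        (sq_nonneg _))
    · by_cases hx : x - x0 ∈ {y | P.N y ≤ kerR}
      · simp only [indicator_of_mem hx, one_mul]
        rw [norm_mul _ (ker P 0 0 (x - x0)), mul_pow _ ‖ker P 0 0 (x - x0)‖, mul_comm]
        gcongr
        exact ker_lower P 0 0 hx
      · simp only [indicator_of_notMem hx, zero_mul, mul_zero]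
        positivity
  have h4 := h3.trans (h1.trans (mul_le_mul_of_nonneg_left h2 (by linarith)))
  rw [← le_div_iff₀' (by positivity)] at h4
  refine h4.trans (le_of_eq ?_)
  rw [bilC]
  field_simp

end Bilinear

end Fam


/-- A continuous function below the indicator of the unit box. -/
def tent (y : E2) : ℝ := max 0 (1 - n1 y / kerR)

lemma tent_continuous : Continuous tent := by
  have := n1_continuous
  unfold tent; fun_prop

lemma n1_nonneg (y : E2) : 0 ≤ n1 y := (norm_nonneg _).trans (norm_le_n1 y)

lemma tent_le (y : E2) : tent y ≤ {y | n1 y ≤ kerR}.indicator (fun _ => (1 : ℝ)) y := by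
  have hR := kerR_pos
  by_cases h : n1 y ≤ kerR
  · rw [indicator_of_mem (by exact h)]
    exact max_le zero_le_one (by linarith [div_nonneg (n1_nonneg y) hR.le])
  · rw [indicator_of_notMem (by exact h)]
    refine max_le le_rfl ?_
    have : 1 ≤ n1 y / kerR := by rw [le_div_iff₀ hR]; linarith
    linarith

lemma ind_le_w0 (y : E2) : {y | n1 y ≤ kerR}.indicator (fun _ => (1 : ℝ)) y ≤
    (1 + kerR) ^ 3 * ((1 + n1 y) ^ 3)⁻¹ := by
  have hR := kerR_pos
  have h1 := one_add_n1_pos y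
  by_cases h : n1 y ≤ kerR
  · rw [indicator_of_mem (by exact h), ← div_eq_mul_inv, le_div_iff₀ (by positivity), one_mul]
    gcongr
  · rw [indicator_of_notMem (by exact h)]; positivity

lemma tent_integrable : Integrable tent :=
  (integrable_w0.const_mul ((1 + kerR) ^ 3)).mono' tent_continuous.aestronglyMeasurable
    (ae_of_all _ fun y => by
      rw [Real.norm_of_nonneg (show 0 ≤ tent y from le_max_left _ _)]; exact (tent_le y).trans (ind_le_w0 y))

/-- The mass of `tent`. -/
def boxV : ℝ := ∫ y, tent y

lemma boxV_pos : 0 < boxV := by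
  refine (integral_pos_iff_support_of_nonneg (fun y => le_max_left _ _) tent_integrable).2 ?_
  refine tent_continuous.isOpen_support.measure_pos _ ⟨0, ?_⟩
  simp [tent, n1]

namespace Frame

variable (P : Frame)

/-- The indicator of the box of a frame. -/
def ind (y : E2) : ℝ := {y | P.N y ≤ kerR}.indicator (fun _ => (1 : ℝ)) y

lemma ind_nonneg (y : E2) : 0 ≤ P.ind y := indicator_nonneg (fun _ _ => zero_le_one) _

lemma ind_neg (y : E2) : P.ind (-y) = P.ind y := by
  unfold ind; simp only [indicator, mem_ofPred_eq, P.N_neg]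

lemma ind_integrable : Integrable P.ind := by
  have hab : (P.a * P.b)⁻¹ * (P.a * P.b) = 1 := inv_mul_cancel₀ (mul_pos P.ha P.hb).ne'
  refine ((P.integrable_w le_rfl).const_mul ((1 + kerR) ^ 3 * (P.a * P.b)⁻¹)).mono' ?_
    (ae_of_all _ fun y => ?_)
  · exact (measurable_const.indicator
      (measurableSet_le P.N_continuous.measurable measurable_const)).aestronglyMeasurable
  · rw [Real.norm_of_nonneg (P.ind_nonneg y)]
    have := ind_le_w0 (P.lin y)
    simp only [ind, indicator, mem_ofPred_eq, ← P.N_eq] at this ⊢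
    refine this.trans (le_of_eq ?_)
    rw [w, ← mul_assoc, mul_assoc _ _ (P.a * P.b), hab, mul_one]

lemma le_integral_ind : (P.a * P.b)⁻¹ * boxV ≤ ∫ y, P.ind y := by
  rw [boxV, ← smul_eq_mul, ← P.integral_lin tent_continuous]
  refine integral_mono (P.integrable_lin tent_continuous tent_integrable) P.ind_integrable
    fun y => ?_
  have := tent_le (P.lin y)
  simp only [ind, indicator, mem_ofPred_eq, ← P.N_eq] at this ⊢
  exact this

end Frame

namespace Fam

variable {D : Fam} {f : ℕ → E2 → ℂ} {l : ℝ} {m k : ℕ}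

/-- The oscillation of a square function on a box. -/
def shC (m : ℕ) : ℝ := (6 * (1 + kerR)) ^ pw m

lemma shC_pos (m : ℕ) : 0 < shC m := by have := kerR_pos; unfold shC; positivity

lemma Slow.near {P : Frame} {V : E2 → ℝ} (h : Slow P 6 (pw m) V) {x y : E2}
    (hx : P.N (x - y) ≤ kerR) : V x ≤ shC m * V y := by
  have := h.2 y (y - x)
  rw [sub_sub_cancel, ← P.N_neg, neg_sub] at this
  refine this.trans (mul_le_mul_of_nonneg_right ?_ (h.1 y))
  have := P.N_nonneg (x - y)
  unfold shC
  gcongr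

/-- The thresholds of the square functions. -/
def thr : ℕ → ℝ
  | 0 => 2 * I3
  | m + 1 => shC (m + 1) * (2 * (I3 * lowC m) * (shC m * thr m))

lemma thr_nonneg (m : ℕ) : 0 ≤ thr m := by
  have hI := I3_nonneg
  induction m with
  | zero => unfold thr; positivity
  | succ m ih =>
    have := (shC_pos m).le; have := (shC_pos (m + 1)).le; have := lowC_nonneg m
    unfold thr; positivity

/-- The constant in the pruning level. -/
def prC (n : ℕ) : ℝ := 1 + 128 * ∑ j ∈ Finset.range n, kerC (pw j) * thr j

lemma prC_pos (n : ℕ) : 0 < prC n := by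
  have : 0 ≤ ∑ j ∈ Finset.range n, kerC (pw j) * thr j :=
    Finset.sum_nonneg fun j _ => mul_nonneg (kerC_nonneg _) (thr_nonneg j)
  unfold prC; positivity

lemma tot_lower (hf : D.Adm f) {n : ℕ} (hm : m ≤ n) {α β : ℝ} (hα : 0 < α) (hβ : 0 < β) {x : E2}
    (hx : α ≤ ‖∑ i ∈ D.X, f i x‖)
    (hg : ∀ j < m, D.gs f (prC n * β / α) j x ≤ thr j * β) :
    α / 2 ≤ ‖D.tot f (prC n * β / α) m x‖ := by
  have hp := prC_pos n
  have hl : 0 < prC n * β / α := by positivity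
  have h1 := norm_sum_sub_le hf hl m x
  have h2 : ∑ j ∈ Finset.range m, 64 * kerC (pw j) / (prC n * β / α) *
      D.gs f (prC n * β / α) j x ≤ α / 2 := by
    calc _ ≤ ∑ j ∈ Finset.range m, 64 * kerC (pw j) / (prC n * β / α) * (thr j * β) := by
          refine Finset.sum_le_sum fun j hj => mul_le_mul_of_nonneg_left
            (hg j (Finset.mem_range.1 hj)) ?_
          have := kerC_nonneg (pw j); positivity
      _ = (α / prC n) * (64 * ∑ j ∈ Finset.range m, kerC (pw j) * thr j) := by
          simp only [Finset.mul_sum]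
          refine Finset.sum_congr rfl fun j _ => ?_
          field_simp
      _ ≤ (α / prC n) * (prC n / 2) := by
          refine mul_le_mul_of_nonneg_left ?_ (by positivity)
          have : ∑ j ∈ Finset.range m, kerC (pw j) * thr j ≤
              ∑ j ∈ Finset.range n, kerC (pw j) * thr j :=
            Finset.sum_le_sum_of_subset_of_nonneg (Finset.range_mono hm) fun j _ _ =>
              mul_nonneg (kerC_nonneg _) (thr_nonneg j)
          rw [prC]; linarith
      _ = α / 2 := by field_simp
  have h3 := norm_sub_norm_le (∑ i ∈ D.X, f i x) (D.tot f (prC n * β / α) m x)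
  rw [tot] at *
  linarith

section Bilinear

variable {A B : Finset ℕ} (hA : A ⊆ D.X) (hB : B ⊆ D.X)

/-- The sum of the square functions of two subfamilies. -/
def gg (f : ℕ → E2 → ℂ) (l : ℝ) (m : ℕ) (x : E2) : ℝ :=
  (D.sub A hA).gs f l m x + (D.sub B hB).gs f l m x

lemma gg_slow (hf : D.Adm f) (hl : 0 < l) : Slow (D.box m) 6 (pw m) (gg hA hB f l m) := by
  have h1 : Slow (D.box m) 6 (pw m) ((D.sub A hA).gs f l m) := gs_slow (sub_Adm hA hf) hl
  have h2 : Slow (D.box m) 6 (pw m) ((D.sub B hB).gs f l m) := gs_slow (sub_Adm hB hf) hl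
  refine ⟨fun x => add_nonneg (h1.1 x) (h2.1 x), fun x z => ?_⟩
  unfold gg
  rw [mul_add]
  exact add_le_add (h1.2 x z) (h2.2 x z)

lemma gs_continuous (hf : D.Adm f) (hl : 0 < l) : Continuous (D.gs f l m) :=
  continuous_finsetSum _ fun _ hk => (G_bl hf hl hk).sqav_continuous _ (three_le_pw m)

lemma gg_continuous (hf : D.Adm f) (hl : 0 < l) : Continuous (gg hA hB f l m) :=
  (gs_continuous (sub_Adm hA hf) hl).add (gs_continuous (sub_Adm hB hf) hl)

/-- Near a point where the square function first becomes large, its high part dominates. -/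
lemma gg_le_HH (hf : D.Adm f) (hl : 0 < l) {β : ℝ} {x x0 : E2}
    (h0 : gg hA hB f l m x ≤ thr m * β) (h1 : thr (m + 1) * β < gg hA hB f l (m + 1) x)
    (hx : (D.box (m + 1)).N (x - x0) ≤ kerR) :
    gg hA hB f l (m + 1) x0 ≤ 2 * (‖(D.sub A hA).HH f l m x0‖ + ‖(D.sub B hB).HH f l m x0‖) := by
  have hI := mul_nonneg I3_nonneg (lowC_nonneg m)
  have hs := shC_pos m
  have hs' := shC_pos (m + 1)
  have e1 := gs_le (sub_Adm hA hf) hl (m := m) x0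
  have e2 := gs_le (sub_Adm hB hf) hl (m := m) x0
  have e3 : gg hA hB f l m x0 ≤ shC m * gg hA hB f l m x := by
    refine Slow.near (gg_slow hA hB hf hl) ?_
    rw [← (D.box m).N_neg, neg_sub]
    exact (box_mono _).trans hx
  have e4 : gg hA hB f l (m + 1) x ≤ shC (m + 1) * gg hA hB f l (m + 1) x0 :=
    Slow.near (gg_slow hA hB hf hl) hx
  have e5 : 2 * (I3 * lowC m) * (shC m * (thr m * β)) ≤ gg hA hB f l (m + 1) x0 := by
    refine le_of_mul_le_mul_left ?_ hs'
    rw [thr] at h1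
    linarith
  have e6 : gg hA hB f l m x0 ≤ shC m * (thr m * β) :=
    e3.trans (mul_le_mul_of_nonneg_left h0 hs.le)
  have e7 := mul_le_mul_of_nonneg_left e6 hI
  unfold gg at *
  linarith

/-- The constant in the level set estimate at a fixed height. -/
def levC (m : ℕ) : ℝ := 2 * bilC (m + 1) * (hiC m * 2) / boxV

lemma levC_nonneg (m : ℕ) : 0 ≤ levC m := by
  have := bilC_nonneg (m + 1); have := hiC_nonneg m; have := boxV_pos; unfold levC; positivity

lemma energy_sub_le : ∑ i ∈ (D.sub A hA).X, ∫ x, ‖f i x‖ ^ 2 ≤ ∑ i ∈ D.X, ∫ x, ‖f i x‖ ^ 2 :=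
  Finset.sum_le_sum_of_subset_of_nonneg hA fun _ _ _ => integral_nonneg fun _ => sq_nonneg _

lemma HH_bl (hf : D.Adm f) (hl : 0 < l) : BL univ (D.HH f l m) :=
  BL.sum fun _ hk => (Hi_bl hf hl hk).mono (subset_univ _)

lemma level_le {K : ℝ} (hK : 1 ≤ K) (hsep : ∀ i ∈ A, ∀ j ∈ B, D.v i + D.S / K ≤ D.v j) {n : ℕ}
    (hS : D.S ≤ D.b ^ (n + 1) * D.ρ) (hf : D.Adm f) (hl : 0 < l) {β α : ℝ} (hα : 0 < α)
    {U : Set E2} (hUm : MeasurableSet U)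
    (hU : ∀ x ∈ U, α / 2 ≤ ‖(D.sub A hA).tot f l (m + 1) x‖ ∧
      α / 2 ≤ ‖(D.sub B hB).tot f l (m + 1) x‖ ∧ gg hA hB f l m x ≤ thr m * β ∧
      thr (m + 1) * β < gg hA hB f l (m + 1) x) :
    (α / 2) ^ 4 * volume.real U ≤
      levC m * K * (n + 2) * D.b ^ 4 * l ^ 2 * ∑ i ∈ D.X, ∫ x, ‖f i x‖ ^ 2 := by
  set P := D.box (m + 1)
  set TA := (D.sub A hA).tot f l (m + 1)
  set TB := (D.sub B hB).tot f l (m + 1)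
  set HA := (D.sub A hA).HH f l m
  set HB := (D.sub B hB).HH f l m
  set E := ∑ i ∈ D.X, ∫ x, ‖f i x‖ ^ 2
  have hab : 0 < P.a * P.b := mul_pos P.ha P.hb
  have hV := boxV_pos
  have hbil := bilC_nonneg (m + 1)
  have hTA : BL univ TA := tot_bl (sub_Adm hA hf) hl
  have hTB : BL univ TB := tot_bl (sub_Adm hB hf) hl
  have hHA : BL univ HA := HH_bl (sub_Adm hA hf) hl
  have hHB : BL univ HB := HH_bl (sub_Adm hB hf) hl
  have hT : BL univ fun x => TA x * TB x := (hTA.mul hTB).mono (subset_univ _)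
  set u : E2 → ℝ := U.indicator fun x => ‖TA x * TB x‖ ^ 2 with hu
  have hui : Integrable u := hT.sqInt.indicator hUm
  have hu0 : ∀ x, 0 ≤ u x := fun x => indicator_nonneg (fun _ _ => sq_nonneg _) x
  have hule : ∀ x, u x ≤ ‖TA x * TB x‖ ^ 2 := fun x =>
    indicator_le_self' (fun _ _ => sq_nonneg _) x
  have h1 : (α / 2) ^ 4 * volume.real U ≤ ∫ x, u x := by
    have hsub : U ⊆ {x | (α / 2) ^ 4 ≤ u x} := fun x hx => by
      obtain ⟨h1, h2, -⟩ := hU x hx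
      simp only [mem_ofPred_eq, hu, indicator_of_mem hx, norm_mul, mul_pow]
      calc (α / 2) ^ 4 = (α / 2) ^ 2 * (α / 2) ^ 2 := by ring
        _ ≤ _ := by gcongr
    refine le_trans ?_ (mul_meas_ge_le_integral_of_nonneg (ae_of_all _ hu0) hui ((α / 2) ^ 4))
    refine mul_le_mul_of_nonneg_left (measureReal_mono hsub ?_) (by positivity)
    exact (hui.measure_ge_lt_top (by positivity)).ne
  have h2 : ∀ x0, av P.ind u x0 ≤ bilC (m + 1) * K * (P.a * P.b)⁻¹ *
      (2 * (‖HA x0‖ ^ 2 + ‖HB x0‖ ^ 2)) := by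
    intro x0
    have hQ : 0 ≤ bilC (m + 1) * K * (P.a * P.b)⁻¹ := by positivity
    have e : av P.ind u x0 = ∫ x, P.ind (x - x0) * u x := by
      rw [av, ← integral_sub_left_eq_self (fun z => P.ind z * u (x0 - z)) _ x0]
      refine integral_congr_ae (ae_of_all _ fun x => ?_)
      simp only [sub_sub_cancel]
      rw [← P.ind_neg, neg_sub]
    rw [e]
    by_cases hex : ∃ x ∈ U, P.N (x - x0) ≤ kerR
    · obtain ⟨x, hx, hN⟩ := hex
      obtain ⟨-, -, h3, h4⟩ := hU x hx
      have h5 : gg hA hB f l (m + 1) x0 ≤ 2 * (‖HA x0‖ + ‖HB x0‖) :=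
        gg_le_HH hA hB hf hl h3 h4 hN
      have h6 : _ ≤ bilC (m + 1) * K * (P.a * P.b)⁻¹ * _ :=
        local_bilinear (m := m + 1) hA hB hK hsep hf hl x0
      have h7 : ∫ x, P.ind (x - x0) * u x ≤
          ∫ x, P.ind (x - x0) * ‖TA x * TB x‖ ^ 2 := by
        obtain ⟨C, hC⟩ := hT.sq_bdd
        refine integral_mono_of_nonneg (ae_of_all _ fun x => mul_nonneg (P.ind_nonneg _) (hu0 x))
          ((P.ind_integrable.comp_sub_right x0).mul_bdd (c := C)
            hT.sqInt.aestronglyMeasurable (ae_of_all _ fun x => hC x))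
          (ae_of_all _ fun x => mul_le_mul_of_nonneg_left (hule x) (P.ind_nonneg _))
      refine h7.trans (h6.trans (mul_le_mul_of_nonneg_left ?_ hQ))
      have g1 : 0 ≤ (D.sub A hA).gs f l (m + 1) x0 := gs_nonneg x0
      have g2 : 0 ≤ (D.sub B hB).gs f l (m + 1) x0 := gs_nonneg x0
      unfold gg at h5
      have h8 := mul_self_le_mul_self (add_nonneg g1 g2) h5
      nlinarith [sq_nonneg ((D.sub A hA).gs f l (m + 1) x0 - (D.sub B hB).gs f l (m + 1) x0),
        sq_nonneg (‖HA x0‖ - ‖HB x0‖)]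
    · have : ∀ x, P.ind (x - x0) * u x = 0 := fun x => by
        by_cases hx : x ∈ U
        · rw [Frame.ind, indicator_of_notMem (show x - x0 ∉ {y | P.N y ≤ kerR} from fun h => hex ⟨x, hx, h⟩), zero_mul]
        · rw [hu, indicator_of_notMem hx, mul_zero]
      simp only [this, integral_zero]
      positivity
  have h3 : (∫ y, P.ind y) * ∫ x, u x ≤ bilC (m + 1) * K * (P.a * P.b)⁻¹ *
      (2 * ((∫ x, ‖HA x‖ ^ 2) + ∫ x, ‖HB x‖ ^ 2)) := by
    rw [← integral_av P.ind_integrable hui]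
    refine (integral_mono (av_integrable P.ind_integrable hui)
      (((hHA.sqInt.add hHB.sqInt).const_mul 2).const_mul _) h2).trans (le_of_eq ?_)
    rw [integral_const_mul]
    congr 1
    rw [← integral_add hHA.sqInt hHB.sqInt, ← integral_const_mul]
    rfl
  have h4 : (P.a * P.b)⁻¹ * boxV * ∫ x, u x ≤ (∫ y, P.ind y) * ∫ x, u x :=
    mul_le_mul_of_nonneg_right P.le_integral_ind (integral_nonneg hu0)
  have h5 : ∫ x, ‖HA x‖ ^ 2 ≤ hiC m * (n + 2) * D.b ^ 4 * l ^ 2 * E := by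
    refine (HH_energy (D := D.sub A hA) hS (sub_Adm hA hf) hl).trans ?_
    have := hiC_nonneg m
    exact mul_le_mul_of_nonneg_left (energy_sub_le hA) (by positivity)
  have h6 : ∫ x, ‖HB x‖ ^ 2 ≤ hiC m * (n + 2) * D.b ^ 4 * l ^ 2 * E := by
    refine (HH_energy (D := D.sub B hB) hS (sub_Adm hB hf) hl).trans ?_
    have := hiC_nonneg m
    exact mul_le_mul_of_nonneg_left (energy_sub_le hB) (by positivity)
  have h7 : boxV * ∫ x, u x ≤ bilC (m + 1) * K *
      (2 * (hiC m * (n + 2) * D.b ^ 4 * l ^ 2 * E + hiC m * (n + 2) * D.b ^ 4 * l ^ 2 * E)) := by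
    have h8 := h4.trans h3
    have h9 : (P.a * P.b)⁻¹ * (boxV * ∫ x, u x) ≤ (P.a * P.b)⁻¹ * (bilC (m + 1) * K *
        (2 * ((∫ x, ‖HA x‖ ^ 2) + ∫ x, ‖HB x‖ ^ 2))) := by linarith
    refine (le_of_mul_le_mul_left h9 (inv_pos.2 hab)).trans ?_
    gcongr
  rw [← le_div_iff₀' hV] at h7
  refine h1.trans (h7.trans (le_of_eq ?_))
  rw [levC]; ring

end Bilinear

end Fam

namespace Fam

variable {D : Fam} {f : ℕ → E2 → ℂ} {l : ℝ} {m k : ℕ}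

lemma tot_top_le (hf : D.Adm f) (hl : 0 < l) {n : ℕ} (hX : ∀ i ∈ D.X, i < D.b ^ n) (x : E2) :
    ‖D.tot f l n x‖ ^ 2 ≤ ptC n * D.gs f l n x := by
  have hsub : D.nodes n ⊆ {0} := fun k hk => by
    obtain ⟨i, hi, rfl⟩ := Finset.mem_image.1 hk
    simp [Nat.div_eq_of_lt (hX i hi)]
  rcases Finset.subset_singleton_iff.1 hsub with h | h
  · simp [tot, gs, h]
  · have h0 : 0 ∈ D.nodes n := by simp [h]
    simp only [tot, gs, h, Finset.sum_singleton]
    exact norm_G_sq_le hf hl h0 x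

lemma sum_energy_le (hf : D.Adm f) {A : Finset ℕ} (hA : A ⊆ D.X) :
    ∫ x, ‖∑ i ∈ A, f i x‖ ^ 2 ≤ 7 * ∑ i ∈ D.X, ∫ x, ‖f i x‖ ^ 2 := by
  have h : ∫ x, ‖∑ i ∈ A, f i x‖ ^ 2 ≤ (2 * (2 + 1) + 1) * ∑ i ∈ A, ∫ x, ‖f i x‖ ^ 2 := by
    refine orth_nodes (D := D) (m := 0) (fun i hi => mem_nodes_zero.2 (hA hi)) (by norm_num)
      fun k hk => (hf k (hA hk)).mono ?_
    rw [tt, rep_zero (hA hk), len_zero]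
    exact plank_strip
  refine h.trans (le_of_eq_of_le (by norm_num) (mul_le_mul_of_nonneg_left
    (Finset.sum_le_sum_of_subset_of_nonneg hA fun _ _ _ => integral_nonneg fun _ => sq_nonneg _)
    (by norm_num)))

lemma sum_bl (hf : D.Adm f) {A : Finset ℕ} (hA : A ⊆ D.X) : BL univ fun x => ∑ i ∈ A, f i x :=
  BL.sum fun i hi => (hf i (hA hi)).mono (subset_univ _)

/-- Chebyshev's inequality in `L²`. -/
lemma BL.chebyshev {S : Set E2} {F : E2 → ℂ} (hF : BL S F) {α : ℝ} (hα : 0 < α) {U : Set E2}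
    (hU : ∀ x ∈ U, α ≤ ‖F x‖) : α ^ 2 * volume.real U ≤ ∫ x, ‖F x‖ ^ 2 := by
  refine le_trans ?_ (mul_meas_ge_le_integral_of_nonneg (ae_of_all _ fun x => sq_nonneg _)
    hF.sqInt (α ^ 2))
  refine mul_le_mul_of_nonneg_left (measureReal_mono (fun x hx => ?_) ?_) (by positivity)
  · exact pow_le_pow_left₀ hα.le (hU x hx) 2
  · exact (hF.sqInt.measure_ge_lt_top (by positivity)).ne

/-- The constant in the bilinear restricted estimate. -/
def biC (n : ℕ) : ℝ :=
  16 * (n + 2) * prC n ^ 2 * ∑ m ∈ Finset.range n, levC m + 112 * (ptC n * thr n) ^ 2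

lemma biC_nonneg (n : ℕ) : 0 ≤ biC n := by
  have : 0 ≤ ∑ m ∈ Finset.range n, levC m := Finset.sum_nonneg fun m _ => levC_nonneg m
  unfold biC; positivity

/-- The bilinear restricted estimate. -/
lemma bilinear_le {n : ℕ} (hX : ∀ i ∈ D.X, i < D.b ^ n) (hS : D.S ≤ D.b ^ (n + 1) * D.ρ)
    (hf : D.Adm f) {a : ℕ → ℝ} (ha : ∀ i ∈ D.X, ∀ x, ‖f i x‖ ≤ a i) {β : ℝ} (hβ : 0 < β)
    (hab : ∑ i ∈ D.X, a i ^ 2 ≤ β) {A B : Finset ℕ} (hA : A ⊆ D.X) (hB : B ⊆ D.X)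
    {K : ℝ} (hK : 1 ≤ K) (hsep : ∀ i ∈ A, ∀ j ∈ B, D.v i + D.S / K ≤ D.v j) {α : ℝ}
    (hα : 0 < α) :
    α ^ 6 * volume.real {x | α ≤ ‖∑ i ∈ A, f i x‖ ∧ α ≤ ‖∑ i ∈ B, f i x‖} ≤
      biC n * K * D.b ^ 4 * β ^ 2 * ∑ i ∈ D.X, ∫ x, ‖f i x‖ ^ 2 := by
  set E := ∑ i ∈ D.X, ∫ x, ‖f i x‖ ^ 2
  set U := {x | α ≤ ‖∑ i ∈ A, f i x‖ ∧ α ≤ ‖∑ i ∈ B, f i x‖}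
  have hE : 0 ≤ E := Finset.sum_nonneg fun _ _ => integral_nonneg fun _ => sq_nonneg _
  have hb : (1 : ℝ) ≤ D.b := by linarith [D.one_le_b]
  have hb4 : (1 : ℝ) ≤ D.b ^ 4 := one_le_pow₀ hb
  have hKb : (1 : ℝ) ≤ K * D.b ^ 4 := one_le_mul_of_one_le_of_one_le hK hb4
  have hlev : 0 ≤ ∑ m ∈ Finset.range n, levC m := Finset.sum_nonneg fun m _ => levC_nonneg m
  have hp := prC_pos n
  have hth : 0 ≤ ptC n * thr n := mul_nonneg (ptC_nonneg n) (thr_nonneg n)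
  by_cases hc : α ^ 2 ≤ 4 * (ptC n * thr n) * β
  · have h1 : α ^ 2 * volume.real U ≤ 7 * E :=
      (BL.chebyshev (sum_bl hf hA) hα fun x hx => hx.1).trans (sum_energy_le hf hA)
    have h2 : α ^ 4 ≤ 16 * (ptC n * thr n) ^ 2 * β ^ 2 := by
      have := pow_le_pow_left₀ (sq_nonneg α) hc 2
      nlinarith
    calc α ^ 6 * volume.real U = α ^ 4 * (α ^ 2 * volume.real U) := by ring
      _ ≤ (16 * (ptC n * thr n) ^ 2 * β ^ 2) * (7 * E) := by gcongr
      _ = 112 * (ptC n * thr n) ^ 2 * 1 * (β ^ 2 * E) := by ring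
      _ ≤ biC n * (K * D.b ^ 4) * (β ^ 2 * E) := by
          gcongr
          · exact biC_nonneg n
          · unfold biC
            have : 0 ≤ 16 * ((n : ℝ) + 2) * prC n ^ 2 * ∑ m ∈ Finset.range n, levC m := by
              positivity
            linarith
      _ = _ := by ring
  · push Not at hc
    set l := prC n * β / α with hl_def
    have hl : 0 < l := by positivity
    have hsA : ∑ i ∈ (D.sub A hA).X, a i ^ 2 ≤ β :=
      (Finset.sum_le_sum_of_subset_of_nonneg hA fun _ _ _ => sq_nonneg _).trans hab
    have hsB : ∑ i ∈ (D.sub B hB).X, a i ^ 2 ≤ β :=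
      (Finset.sum_le_sum_of_subset_of_nonneg hB fun _ _ _ => sq_nonneg _).trans hab
    have hg0 : ∀ x, gg hA hB f l 0 x ≤ thr 0 * β := fun x => by
      have h1 : (D.sub A hA).gs f l 0 x ≤ I3 * β := gs_zero_le (fun i hi => ha i (hA hi)) hsA x
      have h2 : (D.sub B hB).gs f l 0 x ≤ I3 * β := gs_zero_le (fun i hi => ha i (hB hi)) hsB x
      rw [gg, thr]; linarith
    have hgA : ∀ j x, (D.sub A hA).gs f l j x ≤ gg hA hB f l j x := fun j x => by
      have : 0 ≤ (D.sub B hB).gs f l j x := gs_nonneg x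
      rw [gg]; linarith
    have hgB : ∀ j x, (D.sub B hB).gs f l j x ≤ gg hA hB f l j x := fun j x => by
      have : 0 ≤ (D.sub A hA).gs f l j x := gs_nonneg x
      rw [gg]; linarith
    set V : ℕ → Set E2 := fun m => {x | α / 2 ≤ ‖(D.sub A hA).tot f l (m + 1) x‖ ∧
      α / 2 ≤ ‖(D.sub B hB).tot f l (m + 1) x‖ ∧ gg hA hB f l m x ≤ thr m * β ∧
      thr (m + 1) * β < gg hA hB f l (m + 1) x}
    have hcover : U ⊆ ⋃ m ∈ Finset.range n, U ∩ V m := fun x hx => by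
      have hex : ∃ j, thr j * β < gg hA hB f l j x ∧ j ≤ n := by
        by_contra hne
        push Not at hne
        have hall : ∀ j ≤ n, gg hA hB f l j x ≤ thr j * β := fun j hj => by
          by_contra h; exact absurd hj (not_le.2 (hne j (not_le.1 h)))
        have h1 : α / 2 ≤ ‖(D.sub A hA).tot f l n x‖ :=
          tot_lower (sub_Adm hA hf) le_rfl hα hβ hx.1
            fun j hj => (hgA j x).trans (hall j hj.le)
        have h2 : ‖(D.sub A hA).tot f l n x‖ ^ 2 ≤ ptC n * (D.sub A hA).gs f l n x :=
          tot_top_le (sub_Adm hA hf) hl (fun i hi => hX i (hA hi)) x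
        have h3 := mul_le_mul_of_nonneg_left ((hgA n x).trans (hall n le_rfl)) (ptC_nonneg n)
        have h4 := pow_le_pow_left₀ (by positivity) h1 2
        linarith [h2, h3, h4]
      classical
      obtain ⟨h1, h2⟩ := Nat.find_spec hex
      have hmin : ∀ j < Nat.find hex, gg hA hB f l j x ≤ thr j * β := fun j hj => by
        by_contra h
        exact Nat.find_min hex hj ⟨not_le.1 h, hj.le.trans h2⟩
      cases hj : Nat.find hex with
      | zero => rw [hj] at h1; exact absurd (hg0 x) (not_le.2 h1)
      | succ m =>
        rw [hj] at h1 h2 hmin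
        refine mem_biUnion (x := m) (by simpa using h2) ⟨hx, ?_, ?_, hmin m (Nat.lt_succ_self m), h1⟩
        · exact tot_lower (sub_Adm hA hf) h2 hα hβ hx.1 fun j hj => (hgA j x).trans (hmin j hj)
        · exact tot_lower (sub_Adm hB hf) h2 hα hβ hx.2 fun j hj => (hgB j x).trans (hmin j hj)
    have hUeq : U = ⋃ m ∈ Finset.range n, U ∩ V m :=
      hcover.antisymm (iUnion₂_subset fun _ _ => inter_subset_left)
    have hUm : MeasurableSet U :=
      (measurableSet_le measurable_const (sum_bl hf hA).cont.norm.measurable).inter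
        (measurableSet_le measurable_const (sum_bl hf hB).cont.norm.measurable)
    have hVm : ∀ m, MeasurableSet (V m) := fun m => by
      have cA : Continuous ((D.sub A hA).tot f l (m + 1)) := (tot_bl (sub_Adm hA hf) hl).cont
      have cB : Continuous ((D.sub B hB).tot f l (m + 1)) := (tot_bl (sub_Adm hB hf) hl).cont
      exact (measurableSet_le measurable_const cA.norm.measurable).inter
        ((measurableSet_le measurable_const cB.norm.measurable).inter
        ((measurableSet_le (gg_continuous hA hB hf hl).measurable measurable_const).inter
        (measurableSet_lt measurable_const (gg_continuous hA hB hf hl).measurable)))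
    have hpiece : ∀ m, α ^ 6 * volume.real (U ∩ V m) ≤
        levC m * (16 * (n + 2) * prC n ^ 2 * (K * D.b ^ 4 * β ^ 2 * E)) := fun m => by
      have := level_le hA hB hK hsep hS hf hl (β := β) hα (hUm.inter (hVm m)) fun x hx => hx.2
      have h2 := mul_le_mul_of_nonneg_left this (by positivity : 0 ≤ 16 * α ^ 2)
      calc _ = 16 * α ^ 2 * ((α / 2) ^ 4 * volume.real (U ∩ V m)) := by ring
        _ ≤ _ := h2
        _ = _ := by rw [hl_def]; field_simp; rfl
    have hsum : volume.real U ≤ ∑ m ∈ Finset.range n, volume.real (U ∩ V m) := by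
      conv_lhs => rw [hUeq]
      exact measureReal_biUnion_finset_le _ _
    calc α ^ 6 * volume.real U ≤ α ^ 6 * ∑ m ∈ Finset.range n, volume.real (U ∩ V m) := by gcongr
      _ = ∑ m ∈ Finset.range n, α ^ 6 * volume.real (U ∩ V m) := Finset.mul_sum _ _ _
      _ ≤ ∑ m ∈ Finset.range n, levC m * (16 * (n + 2) * prC n ^ 2 * (K * D.b ^ 4 * β ^ 2 * E)) :=
          Finset.sum_le_sum fun m _ => hpiece m
      _ = 16 * (n + 2) * prC n ^ 2 * (∑ m ∈ Finset.range n, levC m) *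
          (K * D.b ^ 4 * β ^ 2 * E) := by rw [← Finset.sum_mul]; ring
      _ ≤ biC n * (K * D.b ^ 4 * β ^ 2 * E) := by
          refine mul_le_mul_of_nonneg_right ?_ (by positivity)
          unfold biC; nlinarith [sq_nonneg (ptC n * thr n)]
      _ = _ := by ring

end Fam


/-- The broad-narrow dichotomy. -/
lemma broad_narrow {b : ℕ} (hb : 0 < b) (w : ℕ → ℂ) {α : ℝ} (hα : 0 < α)
    (h : α ≤ ‖∑ r ∈ Finset.range b, w r‖) :
    (∃ r < b, α / 4 ≤ ‖w r‖) ∨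
      ∃ r < b, ∃ r' < b, r + 2 ≤ r' ∧ α / (4 * b) ≤ ‖w r‖ ∧ α / (4 * b) ≤ ‖w r'‖ := by
  by_contra hne
  push Not at hne
  obtain ⟨hn1, hn2⟩ := hne
  have hb' : (0 : ℝ) < b := by exact_mod_cast hb
  have hne : (Finset.range b).Nonempty := ⟨0, Finset.mem_range.2 hb⟩
  obtain ⟨r0, hr0, hmax⟩ := Finset.exists_max_image (Finset.range b) (fun r => ‖w r‖) hne
  have h0 : α / (4 * b) ≤ ‖w r0‖ := by
    have h1 : α ≤ b * ‖w r0‖ := by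
      refine h.trans ((norm_sum_le _ _).trans ((Finset.sum_le_sum hmax).trans ?_))
      rw [Finset.sum_const, Finset.card_range, nsmul_eq_mul]
    rw [div_le_iff₀ (by positivity)]
    nlinarith [norm_nonneg (w r0)]
  have hr0' := Finset.mem_range.1 hr0
  set near := (Finset.range b).filter fun r => r0 ≤ r + 1 ∧ r ≤ r0 + 1 with hnear
  have hcard : near.card ≤ 3 := by
    have : near ⊆ Finset.Icc (r0 - 1) (r0 + 1) := fun r hr => by
      obtain ⟨-, h1, h2⟩ := Finset.mem_filter.1 hr
      exact Finset.mem_Icc.2 ⟨by omega, h2⟩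
    refine (Finset.card_le_card this).trans ?_
    rw [Nat.card_Icc]; omega
  have hlt : ∀ r ∈ Finset.range b,
      ‖w r‖ < (if r0 ≤ r + 1 ∧ r ≤ r0 + 1 then α / 4 else 0) + α / (4 * b) := fun r hr => by
    have hr' := Finset.mem_range.1 hr
    have hp : 0 < α / (4 * b) := by positivity
    by_cases hc : r0 ≤ r + 1 ∧ r ≤ r0 + 1
    · rw [if_pos hc]; linarith [hn1 r hr']
    · rw [if_neg hc, zero_add]
      by_contra hge
      push Not at hge
      rcases lt_or_ge r r0 with h1 | h1
      · exact absurd h0 (not_le.2 (hn2 r hr' r0 hr0' (by omega) hge))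
      · exact absurd hge (not_le.2 (hn2 r0 hr0' r hr' (by omega) h0))
  have hsum := Finset.sum_lt_sum_of_nonempty hne hlt
  rw [Finset.sum_add_distrib, ← Finset.sum_filter, Finset.sum_const, Finset.sum_const,
    Finset.card_range, nsmul_eq_mul, nsmul_eq_mul] at hsum
  have h3 : (near.card : ℝ) ≤ 3 := by exact_mod_cast hcard
  have h4 : (b : ℝ) * (α / (4 * b)) = α / 4 := by field_simp
  have h5 := h.trans (norm_sum_le _ _)
  rw [h4] at hsum
  nlinarith

namespace Fam

variable {D : Fam} {f : ℕ → E2 → ℂ}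

/-- A subfamily with slopes in a smaller window. -/
def block (D : Fam) (s S : ℝ) (hS : D.ρ ≤ S) (Y : Finset ℕ) (hY : Y ⊆ D.X)
    (h : ∀ i ∈ Y, s ≤ D.v i ∧ D.v i < s + S) : Fam :=
  { D.sub Y hY with
    s := s
    S := S
    hS := hS
    slope_mem := h }

/-- The constant in the linear restricted estimate. -/
def linC (n : ℕ) : ℕ → ℝ
  | 0 => 112
  | j + 1 => 4 ^ 6 * (linC n j + biC n)

lemma linC_nonneg (n j : ℕ) : 0 ≤ linC n j := by
  induction j with
  | zero => unfold linC; norm_num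
  | succ j ih => have := biC_nonneg n; unfold linC; positivity

lemma linear_zero (hf : D.Adm f) {a : ℕ → ℝ} (ha : ∀ i ∈ D.X, ∀ x, ‖f i x‖ ≤ a i) {β : ℝ}
    (hβ : 0 < β) (hab : ∑ i ∈ D.X, a i ^ 2 ≤ β) (hS : D.S = D.ρ) {α : ℝ} (hα : 0 < α) :
    α ^ 6 * volume.real {x | α ≤ ‖∑ i ∈ D.X, f i x‖} ≤
      112 * β ^ 2 * ∑ i ∈ D.X, ∫ x, ‖f i x‖ ^ 2 := by
  set E := ∑ i ∈ D.X, ∫ x, ‖f i x‖ ^ 2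
  set U := {x | α ≤ ‖∑ i ∈ D.X, f i x‖}
  have hE : 0 ≤ E := Finset.sum_nonneg fun _ _ => integral_nonneg fun _ => sq_nonneg _
  rcases U.eq_empty_or_nonempty with hU | ⟨x, hx⟩
  · rw [hU, measureReal_empty, mul_zero]; positivity
  have hcard : D.X.card ≤ 4 := by
    have := D.sparse D.s
    rwa [Finset.filter_true_of_mem fun i hi => hS ▸ D.slope_mem i hi] at this
  have h1 : α ^ 2 ≤ 4 * β := by
    have e1 : α ≤ ∑ i ∈ D.X, a i :=
      (show α ≤ ‖∑ i ∈ D.X, f i x‖ from hx).trans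
        (norm_sum_le_of_le _ fun i hi => ha i hi x)
    have e2 := sq_sum_le_card_mul_sum_sq (s := D.X) (f := a)
    have e3 : (D.X.card : ℝ) ≤ 4 := by exact_mod_cast hcard
    have e4 : 0 ≤ ∑ i ∈ D.X, a i ^ 2 := Finset.sum_nonneg fun _ _ => sq_nonneg _
    have e5 := pow_le_pow_left₀ hα.le e1 2
    nlinarith
  have h2 : α ^ 2 * volume.real U ≤ 7 * E :=
    (BL.chebyshev (sum_bl hf subset_rfl) hα fun x hx => hx).trans (sum_energy_le hf subset_rfl)
  have h3 := pow_le_pow_left₀ (sq_nonneg α) h1 2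
  calc α ^ 6 * volume.real U = (α ^ 2) ^ 2 * (α ^ 2 * volume.real U) := by ring
    _ ≤ (4 * β) ^ 2 * (7 * E) := by gcongr
    _ = _ := by ring

/-- The linear restricted estimate. -/
lemma linear_le {n : ℕ} {a : ℕ → ℝ} {β : ℝ} (hβ : 0 < β) (j : ℕ) (hj : j ≤ n + 1) {D : Fam}
    (hX : ∀ i ∈ D.X, i < D.b ^ n) (hS : D.S = D.b ^ j * D.ρ) (hf : D.Adm f)
    (ha : ∀ i ∈ D.X, ∀ x, ‖f i x‖ ≤ a i) (hab : ∑ i ∈ D.X, a i ^ 2 ≤ β) {α : ℝ} (hα : 0 < α) :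
    α ^ 6 * volume.real {x | α ≤ ‖∑ i ∈ D.X, f i x‖} ≤
      linC n j * D.b ^ 13 * β ^ 2 * ∑ i ∈ D.X, ∫ x, ‖f i x‖ ^ 2 := by
  induction j generalizing D α with
  | zero =>
    rw [pow_zero, one_mul] at hS
    refine (linear_zero hf ha hβ hab hS hα).trans ?_
    have hE : 0 ≤ ∑ i ∈ D.X, ∫ x, ‖f i x‖ ^ 2 :=
      Finset.sum_nonneg fun _ _ => integral_nonneg fun _ => sq_nonneg _
    have h1 : (1 : ℝ) ≤ D.b ^ 13 := one_le_pow₀ (by linarith [D.one_le_b])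
    have : (112 : ℝ) ≤ 112 * D.b ^ 13 := by linarith
    unfold linC
    gcongr
  | succ j ih =>
    set b := D.b with hb_def
    set e : ℕ → ℝ := fun i => ∫ x, ‖f i x‖ ^ 2
    have he : ∀ i, 0 ≤ e i := fun i => integral_nonneg fun _ => sq_nonneg _
    set E := ∑ i ∈ D.X, e i
    have hE : 0 ≤ E := Finset.sum_nonneg fun i _ => he i
    have hb0 : 0 < b := D.b_pos
    have hb16 : (16 : ℝ) ≤ b := D.one_le_b
    have hbp : (0 : ℝ) < b := by linarith
    set T : ℝ := b ^ j * D.ρ with hT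
    have hTρ : D.ρ ≤ T := le_mul_of_one_le_left D.hρ.le (one_le_pow₀ (by linarith))
    have hTp : 0 < T := D.hρ.trans_le hTρ
    have hST : D.S = b * T := by rw [hS, hT]; ring
    set r : ℕ → ℕ := fun i => ⌊(D.v i - D.s) / T⌋₊
    have hr : ∀ i ∈ D.X, D.s + r i * T ≤ D.v i ∧ D.v i < D.s + r i * T + T := fun i hi => by
      have h0 : 0 ≤ (D.v i - D.s) / T := div_nonneg (by linarith [(D.slope_mem i hi).1]) hTp.le
      have h1 : (r i : ℝ) ≤ _ := Nat.floor_le h0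
      have h2 : _ < (r i : ℝ) + 1 := Nat.lt_floor_add_one ((D.v i - D.s) / T)
      rw [le_div_iff₀ hTp] at h1
      rw [div_lt_iff₀ hTp] at h2
      constructor <;> linarith
    have hrb : ∀ i ∈ D.X, r i ∈ Finset.range b := fun i hi => by
      rw [Finset.mem_range]
      by_contra hge
      have : (b : ℝ) ≤ r i := by exact_mod_cast not_lt.1 hge
      have h1 := (hr i hi).1
      have h2 := (D.slope_mem i hi).2
      nlinarith
    set Y : ℕ → Finset ℕ := fun q => D.X.filter fun i => r i = q
    have hY : ∀ q, Y q ⊆ D.X := fun q => Finset.filter_subset _ _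
    have hYm : ∀ {q i}, i ∈ Y q → i ∈ D.X ∧ r i = q := fun h => Finset.mem_filter.1 h
    have hsum : ∀ x, ∑ q ∈ Finset.range b, ∑ i ∈ Y q, f i x = ∑ i ∈ D.X, f i x := fun x =>
      Finset.sum_fiberwise_of_maps_to hrb _
    have hEsum : ∑ q ∈ Finset.range b, ∑ i ∈ Y q, e i = E :=
      Finset.sum_fiberwise_of_maps_to hrb _
    set U := {x | α ≤ ‖∑ i ∈ D.X, f i x‖}
    set N : ℕ → Set E2 := fun q => {x | α / 4 ≤ ‖∑ i ∈ Y q, f i x‖}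
    set M : ℕ × ℕ → Set E2 := fun p =>
      {x | α / (4 * b) ≤ ‖∑ i ∈ Y p.1, f i x‖ ∧ α / (4 * b) ≤ ‖∑ i ∈ Y p.2, f i x‖}
    set Q := ((Finset.range b) ×ˢ (Finset.range b)).filter fun p => p.1 + 2 ≤ p.2
    have hcov : U ⊆ (⋃ q ∈ Finset.range b, N q) ∪ ⋃ p ∈ Q, M p := fun x hx => by
      have hx' : α ≤ ‖∑ i ∈ D.X, f i x‖ := hx
      rw [← hsum] at hx'
      rcases broad_narrow hb0 _ hα hx' with ⟨q, hq, h⟩ | ⟨q, hq, q', hq', h1, h2⟩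
      · exact Or.inl (mem_biUnion (x := q) (by simpa using hq) h)
      · refine Or.inr (mem_biUnion (x := (q, q')) ?_ h2)
        simp only [Q, Finset.coe_filter, Finset.mem_product, Finset.mem_range]
        exact ⟨⟨hq, hq'⟩, h1⟩
    have hN : ∀ q ∈ Finset.range b, α ^ 6 * volume.real (N q) ≤
        4 ^ 6 * (linC n j * b ^ 13 * β ^ 2 * ∑ i ∈ Y q, e i) := fun q _ => by
      have := ih (by omega) (D := D.block (D.s + q * T) T hTρ (Y q) (hY q) fun i hi => by
        obtain ⟨h1, h2⟩ := hYm hi; rw [← h2]; exact hr i h1) (α := α / 4)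
        (fun i hi => hX i (hY q hi)) rfl (fun i hi => hf i (hY q hi))
        (fun i hi => ha i (hY q hi))
        ((Finset.sum_le_sum_of_subset_of_nonneg (hY q) fun _ _ _ => sq_nonneg _).trans hab)
        (by positivity)
      have h2 : (α / 4) ^ 6 * volume.real (N q) ≤ linC n j * b ^ 13 * β ^ 2 * ∑ i ∈ Y q, e i :=
        this
      calc _ = 4 ^ 6 * ((α / 4) ^ 6 * volume.real (N q)) := by ring
        _ ≤ _ := by gcongr
    have hM : ∀ p ∈ Q, α ^ 6 * volume.real (M p) ≤
        4 ^ 6 * (biC n * b ^ 11 * β ^ 2 * E) := fun p hp => by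
      have hp' : p.1 + 2 ≤ p.2 := (Finset.mem_filter.1 hp).2
      have := bilinear_le hX (by
        rw [hS]
        exact mul_le_mul_of_nonneg_right (pow_le_pow_right₀ (by linarith) hj) D.hρ.le)
        hf ha hβ hab (hY p.1) (hY p.2) (K := b) (by linarith) (fun i hi i' hi' => by
          obtain ⟨h1, h2⟩ := hYm hi
          obtain ⟨h3, h4⟩ := hYm hi'
          have e1 := (hr i h1).2
          have e2 := (hr i' h3).1
          rw [h2] at e1
          rw [h4] at e2
          have e3 : D.S / b = T := by rw [hST]; field_simp
          have e4 : (p.1 : ℝ) + 2 ≤ p.2 := by exact_mod_cast hp'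
          rw [e3]
          nlinarith) (α := α / (4 * b)) (by positivity)
      have h2 : (α / (4 * b)) ^ 6 * volume.real (M p) ≤ biC n * b * b ^ 4 * β ^ 2 * E := this
      calc _ = 4 ^ 6 * b ^ 6 * ((α / (4 * b)) ^ 6 * volume.real (M p)) := by field_simp
        _ ≤ 4 ^ 6 * b ^ 6 * (biC n * b * b ^ 4 * β ^ 2 * E) := by gcongr
        _ = _ := by ring
    have hfin : volume ((⋃ q ∈ Finset.range b, N q) ∪ ⋃ p ∈ Q, M p) ≠ ⊤ := by
      have hfin1 : ∀ q {c : ℝ}, 0 < c → volume {x | c ≤ ‖∑ i ∈ Y q, f i x‖} ≠ ⊤ := fun q c hc => by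
        have hi := (sum_bl hf (hY q)).sqInt
        refine ne_top_of_le_ne_top (hi.measure_ge_lt_top (ε := c ^ 2) (by positivity)).ne
          (measure_mono fun x hx => pow_le_pow_left₀ hc.le hx 2)
      refine measure_union_ne_top ?_ ?_
      · exact (measure_biUnion_lt_top (Finset.range b).finite_toSet
          fun q _ => (hfin1 q (by positivity)).lt_top).ne
      · exact (measure_biUnion_lt_top Q.finite_toSet fun p _ =>
          ((measure_mono fun x hx => hx.1).trans_lt
            (hfin1 p.1 (c := α / (4 * b)) (by positivity)).lt_top)).ne
    have hvol : volume.real U ≤ ∑ q ∈ Finset.range b, volume.real (N q) +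
        ∑ p ∈ Q, volume.real (M p) :=
      (measureReal_mono hcov hfin).trans ((measureReal_union_le _ _).trans
        (add_le_add (measureReal_biUnion_finset_le _ _) (measureReal_biUnion_finset_le _ _)))
    have hQ : (Q.card : ℝ) ≤ b ^ 2 := by
      have : Q.card ≤ b * b := (Finset.card_filter_le _ _).trans (by simp)
      rw [sq]; exact_mod_cast this
    calc α ^ 6 * volume.real U ≤ α ^ 6 * (∑ q ∈ Finset.range b, volume.real (N q) +
          ∑ p ∈ Q, volume.real (M p)) := by gcongr
      _ = ∑ q ∈ Finset.range b, α ^ 6 * volume.real (N q) +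
          ∑ p ∈ Q, α ^ 6 * volume.real (M p) := by rw [mul_add, Finset.mul_sum, Finset.mul_sum]
      _ ≤ ∑ q ∈ Finset.range b, 4 ^ 6 * (linC n j * b ^ 13 * β ^ 2 * ∑ i ∈ Y q, e i) +
          ∑ p ∈ Q, 4 ^ 6 * (biC n * b ^ 11 * β ^ 2 * E) :=
          add_le_add (Finset.sum_le_sum hN) (Finset.sum_le_sum hM)
      _ = 4 ^ 6 * (linC n j * b ^ 13 * β ^ 2 * E) +
          Q.card * (4 ^ 6 * (biC n * b ^ 11 * β ^ 2 * E)) := by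
          rw [← Finset.mul_sum, ← Finset.mul_sum, hEsum, Finset.sum_const, nsmul_eq_mul]
      _ ≤ 4 ^ 6 * (linC n j * b ^ 13 * β ^ 2 * E) +
          b ^ 2 * (4 ^ 6 * (biC n * b ^ 11 * β ^ 2 * E)) := by
          have := biC_nonneg n
          gcongr
      _ = _ := by rw [linC]; ring

end Fam


section Big
variable {A : Frame} {t c l : ℝ} {G F : E2 → ℂ} {S : Set E2}

lemma BL.integrable_big_sq (hG : BL S G) (l : ℝ) : Integrable fun x => ‖big l G x‖ ^ 2 :=
  hG.sqInt.mono' ((hG.measurable_big l).norm.pow_const 2).aestronglyMeasurable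
    (ae_of_all _ fun x => by
      rw [Real.norm_of_nonneg (sq_nonneg _)]
      exact pow_le_pow_left₀ (norm_nonneg _) (norm_big_le l G x) 2)

lemma BL.integral_big_le (hG : BL S G) (l : ℝ) : ∫ x, ‖big l G x‖ ^ 2 ≤ ∫ x, ‖G x‖ ^ 2 :=
  integral_mono (hG.integrable_big_sq l) hG.sqInt fun x =>
    pow_le_pow_left₀ (norm_nonneg _) (norm_big_le l G x) 2

/-- A weak type bound of order six controls the `L²` mass on superlevel sets. -/
lemma BL.integral_big_le_of_weak (hF : BL S F) {Q : ℝ}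
    (hQ : ∀ s, 0 < s → s ^ 6 * volume.real {x | s ≤ ‖F x‖} ≤ Q) {α : ℝ} (hα : 0 < α) :
    ∫ x, ‖big α F x‖ ^ 2 ≤ 8 * Q / α ^ 4 := by
  obtain ⟨C, hC, hFC⟩ := hF.bdd
  obtain ⟨N, hN⟩ := pow_unbounded_of_one_lt (C / α) (one_lt_two (α := ℝ))
  rw [div_lt_iff₀ hα] at hN
  have hQ0 : 0 ≤ Q := le_trans (by positivity) (hQ 1 one_pos)
  set V : ℕ → Set E2 := fun k => {x | 2 ^ k * α ≤ ‖F x‖}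
  have hVm : ∀ k, MeasurableSet (V k) := fun k =>
    measurableSet_le measurable_const hF.cont.norm.measurable
  have hVf : ∀ k, volume (V k) ≠ ⊤ := fun k => by
    have hp : 0 < (2 : ℝ) ^ k * α := by positivity
    exact ne_top_of_le_ne_top (hF.sqInt.measure_ge_lt_top (ε := (2 ^ k * α) ^ 2)
      (by positivity)).ne (measure_mono fun x hx => pow_le_pow_left₀ hp.le hx 2)
  have hi : ∀ k, Integrable ((V k).indicator fun _ => 4 ^ (k + 1) * α ^ 2) := fun k =>
    (integrable_indicator_iff (hVm k)).2 (integrableOn_const (hVf k))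
  have hpt : ∀ x, ‖big α F x‖ ^ 2 ≤
      ∑ k ∈ Finset.range N, (V k).indicator (fun _ => 4 ^ (k + 1) * α ^ 2) x := fun x => by
    have h0 : ∀ k ∈ Finset.range N, 0 ≤ (V k).indicator (fun _ => 4 ^ (k + 1) * α ^ 2) x :=
      fun k _ => indicator_nonneg (fun _ _ => by positivity) _
    by_cases hx : α < ‖F x‖
    · obtain ⟨k, h1, h2⟩ := exists_nat_pow_near ((one_le_div hα).2 hx.le) (one_lt_two (α := ℝ))
      rw [le_div_iff₀ hα] at h1
      rw [div_lt_iff₀ hα] at h2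
      have hkN : k < N := by
        have : (2 : ℝ) ^ k * α < 2 ^ N * α := h1.trans_lt ((hFC x).trans_lt hN)
        exact (pow_lt_pow_iff_right₀ (one_lt_two (α := ℝ))).1 (lt_of_mul_lt_mul_right this hα.le)
      refine le_trans ?_ (Finset.single_le_sum h0 (Finset.mem_range.2 hkN))
      rw [indicator_of_mem (show x ∈ V k from h1)]
      calc _ ≤ ‖F x‖ ^ 2 := pow_le_pow_left₀ (norm_nonneg _) (norm_big_le α F x) 2
        _ ≤ (2 ^ (k + 1) * α) ^ 2 := pow_le_pow_left₀ (norm_nonneg _) h2.le 2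
        _ = _ := by rw [mul_pow, ← pow_mul, mul_comm (k + 1), pow_mul]; norm_num
    · rw [big, indicator_of_notMem (by exact hx), norm_zero, zero_pow two_ne_zero]
      exact Finset.sum_nonneg h0
  have hgeo : ∀ N : ℕ, ∑ k ∈ Finset.range N, ((16 : ℝ) ^ k)⁻¹ ≤ 2 - 2 * ((16 : ℝ) ^ N)⁻¹ := fun N => by
    induction N with
    | zero => norm_num
    | succ N ih =>
      rw [Finset.sum_range_succ, pow_succ, mul_inv]
      have : 0 < ((16 : ℝ) ^ N)⁻¹ := by positivity
      linarith
  calc _ ≤ ∫ x, ∑ k ∈ Finset.range N, (V k).indicator (fun _ => 4 ^ (k + 1) * α ^ 2) x :=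
        integral_mono (hF.integrable_big_sq α) (integrable_finsetSum _ fun k _ => hi k) hpt
    _ = ∑ k ∈ Finset.range N, 4 ^ (k + 1) * α ^ 2 * volume.real (V k) := by
        rw [integral_finsetSum _ fun k _ => hi k]
        refine Finset.sum_congr rfl fun k _ => ?_
        rw [integral_indicator_const _ (hVm k), smul_eq_mul, mul_comm]
    _ ≤ ∑ k ∈ Finset.range N, 4 * Q / α ^ 4 * ((16 : ℝ) ^ k)⁻¹ := by
        refine Finset.sum_le_sum fun k _ => ?_
        have h1 := hQ (2 ^ k * α) (by positivity)
        have h2 : (2 : ℝ) ^ k ≠ 0 := by positivity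
        have e4 : (4 : ℝ) ^ k = (2 ^ k) ^ 2 := by rw [← pow_mul, mul_comm, pow_mul]; norm_num
        have e16 : (16 : ℝ) ^ k = (2 ^ k) ^ 4 := by rw [← pow_mul, mul_comm, pow_mul]; norm_num
        calc _ = 4 * (((2 ^ k) ^ 4)⁻¹ / α ^ 4) * ((2 ^ k * α) ^ 6 * volume.real (V k)) := by
              rw [pow_succ, e4]; field_simp
          _ ≤ 4 * (((2 ^ k) ^ 4)⁻¹ / α ^ 4) * Q := by gcongr
          _ = _ := by rw [e16]; ring
    _ ≤ 4 * Q / α ^ 4 * 2 := by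
        rw [← Finset.mul_sum]
        refine mul_le_mul_of_nonneg_left ((hgeo N).trans ?_) (by positivity)
        linarith [show 0 < ((16 : ℝ) ^ N)⁻¹ by positivity]
    _ = _ := by ring

lemma BL.sub_prune_eq (x : E2) : G x - prune A t c l G x = cv (pker A t c) (big l G) x := by
  unfold prune; ring

lemma BL.integral_cv_big_le (hG : BL S G) {h : E2 → ℂ} (hm : Measurable h)
    (hh : ∀ x, ‖h x‖ ≤ ‖big l G x‖) :
    ∫ x, ‖cv (pker A t c) h x‖ ^ 2 ≤ kerI ^ 2 * ∫ x, ‖big l G x‖ ^ 2 := by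
  obtain ⟨C, hC, hb⟩ := hG.bdd
  have hi : Integrable fun x => ‖h x‖ ^ 2 :=
    (hG.integrable_big_sq l).mono' (hm.norm.pow_const 2).aestronglyMeasurable
      (ae_of_all _ fun x => by
        rw [Real.norm_of_nonneg (sq_nonneg _)]
        exact pow_le_pow_left₀ (norm_nonneg _) (hh x) 2)
  refine (cv_young (pker_integrable A t c) hm
    (fun y => (hh y).trans ((norm_big_le l G y).trans (hb y))) hi).trans ?_
  refine mul_le_mul (pow_le_pow_left₀ (integral_nonneg fun _ => norm_nonneg _)
    (integral_pker_le A t c) 2) ?_ (integral_nonneg fun _ => sq_nonneg _) (sq_nonneg _)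
  exact integral_mono hi (hG.integrable_big_sq l) fun x =>
    pow_le_pow_left₀ (norm_nonneg _) (hh x) 2

/-- The part of `G` where its size lies between two levels. -/
def slab (l l' : ℝ) (G : E2 → ℂ) (x : E2) : ℂ := small l' G x - small l G x

lemma slab_bounds {l l' : ℝ} (hl : 0 ≤ l') (hll : l ≤ l') (x : E2) :
    ‖slab l l' G x‖ ≤ ‖big l G x‖ ∧ ‖slab l l' G x‖ ≤ l' := by
  unfold slab
  have h := small_add_big l G x
  by_cases h1 : ‖G x‖ ≤ l
  · have e1 : small l G x = G x := indicator_of_mem (by exact h1) _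
    have e2 : small l' G x = G x := indicator_of_mem (by exact h1.trans hll) _
    rw [e1, e2, sub_self, norm_zero]
    exact ⟨norm_nonneg _, hl⟩
  · have e1 : small l G x = 0 := indicator_of_notMem (by exact h1) _
    rw [e1, zero_add] at h
    rw [e1, sub_zero, h]
    exact ⟨norm_small_le _ _ _, norm_small_le' hl _ _⟩

lemma BL.measurable_slab (hG : BL S G) (l l' : ℝ) : Measurable (slab l l' G) :=
  (hG.measurable_small l').sub (hG.measurable_small l)

lemma BL.prune_sub_eq (hG : BL (plank t c A.v (2 * A.a) (2 * A.b)) G) {l l' : ℝ} (hl : 0 ≤ l')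
    (hll : l ≤ l') (x : E2) :
    prune A t c l' G x - prune A t c l G x = cv (pker A t c) (slab l l' G) x := by
  obtain ⟨C, hC, hb⟩ := hG.bdd
  have h := cv_add_right (pker_integrable A t c) (hG.measurable_small l)
    (fun x => (norm_small_le l G x).trans (hb x)) (hG.measurable_slab l l')
    (fun x => (slab_bounds hl hll x).2) x
  have e : (fun y => small l G y + slab l l' G y) = small l' G := by
    ext y; unfold slab; ring
  rw [e] at h
  rw [hG.prune_eq, hG.prune_eq, h]; ring

end Big

namespace Fam

variable {D : Fam} {f : ℕ → E2 → ℂ}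

/-- The frame of a leaf. -/
def leafFrame (D : Fam) (i : ℕ) : Frame :=
  ⟨D.L / 4, D.L * D.ρ, D.v i, by have := D.hL; positivity, mul_pos D.hL D.hρ⟩

/-- The sharp spectral condition on the leaf functions. -/
def Leaf (D : Fam) (f : ℕ → E2 → ℂ) : Prop :=
  ∀ i ∈ D.X, BL (plank (D.L * i) (D.c i) (D.leafFrame i).v (2 * (D.leafFrame i).a)
    (2 * (D.leafFrame i).b)) (f i)

/-- Pruning of a leaf function. -/
def lprune (D : Fam) (f : ℕ → E2 → ℂ) (i : ℕ) (l : ℝ) : E2 → ℂ :=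
  prune (D.leafFrame i) (D.L * i) (D.c i) l (f i)

lemma Leaf.adm (hf : D.Leaf f) : D.Adm f := fun i hi => (hf i hi).mono fun ξ hξ => by
  have := D.hL; have := mul_pos D.hL D.hρ
  simp only [leafFrame] at hξ
  exact ⟨hξ.1.trans (by linarith), hξ.2.trans (by linarith)⟩

lemma Leaf.lprune_bl (hf : D.Leaf f) {i : ℕ} (hi : i ∈ D.X) {l : ℝ} (hl : 0 < l) :
    BL (plank (D.L * i) (D.c i) (D.v i) (2 * D.L) (8 * (D.L * D.ρ))) (D.lprune f i l) := by
  have := (hf i hi).prune_bl hl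
  simp only [leafFrame, show 8 * (D.L / 4) = 2 * D.L by ring] at this
  exact this

end Fam

namespace Fam

variable {D : Fam} {f : ℕ → E2 → ℂ}

/-- The normalisation of the levels in the decomposition of the leaf functions. -/
def kap : ℝ := 1 / (4 * (kerI + 1))

lemma kap_pos : 0 < kap := by have := kerI_nonneg; unfold kap; positivity

lemma kap_le_one : kap ≤ 1 := by
  have := kerI_nonneg
  unfold kap; rw [div_le_one (by positivity)]; linarith

lemma kerI_mul_kap_le : kerI * kap ≤ 1 / 4 := by
  have := kerI_nonneg
  unfold kap; rw [mul_one_div, div_le_div_iff₀ (by positivity) (by norm_num)]; linarith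

/-- The constant in the bound of the mass of superlevel sets. -/
def masC (n : ℕ) : ℝ :=
  (2 * (n + 1)) ^ 2 * (kerI ^ 2 * (7 + (2 * (n + 1)) ^ 4 * linC n (n + 1)))

lemma masC_nonneg (n : ℕ) : 0 ≤ masC n := by
  have := linC_nonneg n (n + 1); unfold masC; positivity

/-- The levels in the decomposition of a leaf function. -/
def lev (D : Fam) (a : ℕ → ℝ) (α R : ℝ) (j i : ℕ) : ℝ := kap / D.b ^ j * α / R * a i

section Pieces

variable {a : ℕ → ℝ} {α R : ℝ}

lemma lev_pos (hα : 0 < α) (hR : 0 < R) {i : ℕ} (ha : 0 < a i) (j : ℕ) :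
    0 < D.lev a α R j i := by
  have := kap_pos
  have hb : (0 : ℝ) < D.b := by linarith [D.one_le_b]
  unfold lev; positivity

lemma lev_anti (hα : 0 < α) (hR : 0 < R) {i : ℕ} (ha : 0 < a i) (j : ℕ) :
    D.lev a α R (j + 1) i ≤ D.lev a α R j i := by
  have := kap_pos
  have hb : (1 : ℝ) ≤ D.b := by linarith [D.one_le_b]
  unfold lev
  gcongr
  omega

/-- Successive prunings of a leaf function. -/
def stage (D : Fam) (f : ℕ → E2 → ℂ) (a : ℕ → ℝ) (α R : ℝ) : ℕ → ℕ → E2 → ℂ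
  | 0, i => f i
  | j + 1, i => D.lprune f i (D.lev a α R j i)

/-- The pieces of a leaf function. -/
def piece (D : Fam) (f : ℕ → E2 → ℂ) (a : ℕ → ℝ) (α R : ℝ) (j i : ℕ) (x : E2) : ℂ :=
  D.stage f a α R j i x - D.stage f a α R (j + 1) i x

lemma sum_piece (n i : ℕ) (x : E2) :
    ∑ j ∈ Finset.range n, D.piece f a α R j i x = f i x - D.stage f a α R n i x :=
  Finset.sum_range_sub' (fun j => D.stage f a α R j i x) n

lemma stage_bl (hf : D.Leaf f) (hα : 0 < α) (hR : 0 < R) {i : ℕ} (hi : i ∈ D.X) (ha : 0 < a i)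
    (j : ℕ) : BL (plank (D.L * i) (D.c i) (D.v i) (2 * D.L) (8 * (D.L * D.ρ)))
      (D.stage f a α R j i) := by
  cases j with
  | zero => exact hf.adm i hi
  | succ j => exact hf.lprune_bl hi (lev_pos hα hR ha j)

lemma piece_adm (hf : D.Leaf f) (hα : 0 < α) (hR : 0 < R) (ha : ∀ i ∈ D.X, 0 < a i) (j : ℕ) :
    D.Adm (D.piece f a α R j) := fun i hi =>
  (stage_bl hf hα hR hi (ha i hi) j).sub (stage_bl hf hα hR hi (ha i hi) (j + 1))

lemma integral_piece_le (hf : D.Leaf f) (hα : 0 < α) (hR : 0 < R) {i : ℕ} (hi : i ∈ D.X)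
    (ha : 0 < a i) (j : ℕ) :
    ∫ x, ‖D.piece f a α R j i x‖ ^ 2 ≤ kerI ^ 2 * ∫ x, ‖big (D.lev a α R j i) (f i) x‖ ^ 2 := by
  cases j with
  | zero =>
    simp only [piece, stage, lprune, BL.sub_prune_eq]
    exact (hf i hi).integral_cv_big_le ((hf i hi).measurable_big _) fun _ => le_rfl
  | succ j =>
    have h0 := (lev_pos (D := D) hα hR ha j).le
    have h1 := lev_anti (D := D) hα hR ha j
    simp only [piece, stage, lprune, (hf i hi).prune_sub_eq h0 h1]
    exact (hf i hi).integral_cv_big_le ((hf i hi).measurable_slab _ _)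
      fun x => (slab_bounds h0 h1 x).1

lemma norm_piece_succ_le (hf : D.Leaf f) (hα : 0 < α) (hR : 0 < R) {i : ℕ} (hi : i ∈ D.X)
    (ha : 0 < a i) (j : ℕ) (x : E2) :
    ‖D.piece f a α R (j + 1) i x‖ ≤ kerI * D.lev a α R j i := by
  have h0 := (lev_pos (D := D) hα hR ha j).le
  have h1 := lev_anti (D := D) hα hR ha j
  obtain ⟨C, hC, hb⟩ := (hf i hi).bdd
  simp only [piece, stage, lprune, (hf i hi).prune_sub_eq h0 h1]
  exact (norm_cv_le (pker_integrable _ _ _) (fun y => (slab_bounds h0 h1 y).2) x).trans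
    (mul_le_mul_of_nonneg_right (integral_pker_le _ _ _) h0)

lemma sum_le_sqrt {s : Finset ℕ} {n b : ℕ} (hb : 1 ≤ b) (hX : ∀ i ∈ s, i < b ^ n) (hR : 0 < R)
    (ha : ∑ i ∈ s, a i ^ 2 ≤ R ^ 2) : ∑ i ∈ s, a i ≤ b ^ n * R := by
  have h1 : s.card ≤ b ^ n := by
    have : s ⊆ Finset.range (b ^ n) := fun i hi => Finset.mem_range.2 (hX i hi)
    simpa using Finset.card_le_card this
  have h2 : (s.card : ℝ) ≤ b ^ n := by exact_mod_cast h1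
  have h3 : (1 : ℝ) ≤ b ^ n := one_le_pow₀ (by exact_mod_cast hb)
  refine abs_le_of_sq_le_sq' ?_ (by positivity) |>.2
  calc _ ≤ (s.card : ℝ) * ∑ i ∈ s, a i ^ 2 := sq_sum_le_card_mul_sum_sq
    _ ≤ b ^ n * R ^ 2 := by gcongr
    _ ≤ b ^ n * b ^ n * R ^ 2 := by
        have : (b : ℝ) ^ n ≤ b ^ n * b ^ n := le_mul_of_one_le_left (by positivity) h3
        gcongr
    _ = _ := by ring

lemma norm_bottom_le (hf : D.Leaf f) (hα : 0 < α) (hR : 0 < R) (ha : ∀ i ∈ D.X, 0 < a i)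
    (hT : ∑ i ∈ D.X, a i ^ 2 ≤ R ^ 2) {n : ℕ} (hX : ∀ i ∈ D.X, i < D.b ^ n) (x : E2) :
    ‖∑ i ∈ D.X, D.stage f a α R (n + 1) i x‖ ≤ α / 4 := by
  have hb : (0 : ℝ) < D.b := by linarith [D.one_le_b]
  have hk := kap_pos
  calc _ ≤ ∑ i ∈ D.X, kerI * (kap / D.b ^ n * α / R * a i) :=
        norm_sum_le_of_le _ fun i hi =>
          (hf i hi).norm_prune_le (lev_pos hα hR (ha i hi) n).le x
    _ = kerI * kap * (α / (D.b ^ n * R)) * ∑ i ∈ D.X, a i := by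
        rw [Finset.mul_sum]; exact Finset.sum_congr rfl fun i _ => by field_simp
    _ ≤ 1 / 4 * (α / (D.b ^ n * R)) * (D.b ^ n * R) := by
        have := kerI_mul_kap_le
        have := sum_le_sqrt D.b_pos hX hR hT
        have : 0 ≤ ∑ i ∈ D.X, a i := Finset.sum_nonneg fun i hi => (ha i hi).le
        gcongr
    _ = _ := by field_simp

lemma piece_mass_le (hf : D.Leaf f) (hα : 0 < α) (hR : 0 < R) (ha : ∀ i ∈ D.X, 0 < a i)
    (hT : ∑ i ∈ D.X, a i ^ 2 ≤ R ^ 2) {n : ℕ} (hX : ∀ i ∈ D.X, i < D.b ^ n)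
    (hS : D.S = D.b ^ (n + 1) * D.ρ) (j : ℕ) {M : ℝ} (hM : 0 < M) :
    ∫ x, ‖big (α / M) (fun x => ∑ i ∈ D.X, D.piece f a α R j i x) x‖ ^ 2 ≤
      kerI ^ 2 * (7 + M ^ 4 * linC n (n + 1)) * D.b ^ 17 *
        ((D.b ^ (4 * j) : ℝ)⁻¹ * ∑ i ∈ D.X, ∫ x, ‖big (D.lev a α R j i) (f i) x‖ ^ 2) := by
  have hb : (1 : ℝ) ≤ D.b := by linarith [D.one_le_b]
  have hb0 : (0 : ℝ) < D.b := by linarith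
  have hA := piece_adm hf hα hR ha j
  have hbl := sum_bl hA subset_rfl
  have hlin := linC_nonneg n (n + 1)
  set m := ∑ i ∈ D.X, ∫ x, ‖big (D.lev a α R j i) (f i) x‖ ^ 2
  have hm : 0 ≤ m := Finset.sum_nonneg fun _ _ => integral_nonneg fun _ => sq_nonneg _
  have hE : ∑ i ∈ D.X, ∫ x, ‖D.piece f a α R j i x‖ ^ 2 ≤ kerI ^ 2 * m := by
    rw [Finset.mul_sum]
    exact Finset.sum_le_sum fun i hi => integral_piece_le hf hα hR hi (ha i hi) j
  cases j with
  | zero =>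
    refine (hbl.integral_big_le _).trans ((sum_energy_le hA subset_rfl).trans ?_)
    have h17 : (1 : ℝ) ≤ D.b ^ 17 := one_le_pow₀ hb
    rw [mul_zero, pow_zero, inv_one, one_mul]
    calc 7 * ∑ i ∈ D.X, ∫ x, ‖D.piece f a α R 0 i x‖ ^ 2 ≤ 7 * (kerI ^ 2 * m) := by gcongr
      _ = kerI ^ 2 * (7 + 0) * 1 * m := by ring
      _ ≤ _ := by
        gcongr
        positivity
  | succ j =>
    set β : ℝ := (α / (4 * D.b ^ j)) ^ 2 with hβ
    have hβ0 : 0 < β := by positivity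
    have hab : ∑ i ∈ D.X, (kerI * D.lev a α R j i) ^ 2 ≤ β := by
      calc _ = (kerI * kap) ^ 2 * (α / (D.b ^ j * R)) ^ 2 * ∑ i ∈ D.X, a i ^ 2 := by
            rw [Finset.mul_sum]
            exact Finset.sum_congr rfl fun i _ => by unfold lev; field_simp
        _ ≤ (1 / 4) ^ 2 * (α / (D.b ^ j * R)) ^ 2 * R ^ 2 := by
            have := kerI_mul_kap_le
            have := mul_nonneg kerI_nonneg kap_pos.le
            gcongr
        _ = β := by rw [hβ]; field_simp
    have hQ : ∀ s, 0 < s → s ^ 6 *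
        volume.real {x | s ≤ ‖∑ i ∈ D.X, D.piece f a α R (j + 1) i x‖} ≤
        linC n (n + 1) * D.b ^ 13 * β ^ 2 * (kerI ^ 2 * m) := fun s hs => by
      refine (linear_le hβ0 (n + 1) le_rfl hX hS hA
        (fun i hi x => norm_piece_succ_le hf hα hR hi (ha i hi) j x) hab hs).trans ?_
      gcongr
    refine (hbl.integral_big_le_of_weak hQ (div_pos hα hM)).trans ?_
    have e : 8 * (linC n (n + 1) * D.b ^ 13 * β ^ 2 * (kerI ^ 2 * m)) / (α / M) ^ 4 =
        kerI ^ 2 * (0 + 1 / 32 * (M ^ 4 * linC n (n + 1))) * D.b ^ 17 *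
          ((D.b ^ (4 * (j + 1)) : ℝ)⁻¹ * m) := by
      rw [hβ]; field_simp; ring
    rw [e]
    have hp := mul_nonneg (pow_pos hM 4).le hlin
    exact mul_le_mul_of_nonneg_right (mul_le_mul_of_nonneg_right
      (mul_le_mul_of_nonneg_left (by linarith) (sq_nonneg _)) (by positivity)) (by positivity)

end Pieces

/-- The `L²` mass of a sum on a superlevel set is controlled by that of its terms. -/
lemma mass_le (hf : D.Leaf f) {a : ℕ → ℝ} {α R : ℝ} (hα : 0 < α) (hR : 0 < R)
    (ha : ∀ i ∈ D.X, 0 < a i) (hT : ∑ i ∈ D.X, a i ^ 2 ≤ R ^ 2) {n : ℕ}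
    (hX : ∀ i ∈ D.X, i < D.b ^ n) (hS : D.S = D.b ^ (n + 1) * D.ρ) :
    ∫ x, ‖big α (fun x => ∑ i ∈ D.X, f i x) x‖ ^ 2 ≤ masC n * D.b ^ 17 *
      ∑ j ∈ Finset.range (n + 1), (D.b ^ (4 * j) : ℝ)⁻¹ *
        ∑ i ∈ D.X, ∫ x, ‖big (D.lev a α R j i) (f i) x‖ ^ 2 := by
  set M : ℝ := 2 * (n + 1)
  have hM : 0 < M := by positivity
  set F : E2 → ℂ := fun x => ∑ i ∈ D.X, f i x
  set P : ℕ → E2 → ℂ := fun j x => ∑ i ∈ D.X, D.piece f a α R j i x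
  have hPbl : ∀ j, BL univ (P j) := fun j => sum_bl (piece_adm hf hα hR ha j) subset_rfl
  have hFbl : BL univ F := sum_bl hf.adm subset_rfl
  have hdec : ∀ x, F x = ∑ j ∈ Finset.range (n + 1), P j x +
      ∑ i ∈ D.X, D.stage f a α R (n + 1) i x := fun x => by
    simp only [P]
    rw [Finset.sum_comm]
    simp only [sum_piece, Finset.sum_sub_distrib, sub_add_cancel]
    rfl
  have hpt : ∀ x, ‖big α F x‖ ^ 2 ≤
      ∑ j ∈ Finset.range (n + 1), M ^ 2 * ‖big (α / M) (P j) x‖ ^ 2 := fun x => by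
    have h0 : ∀ j ∈ Finset.range (n + 1), 0 ≤ M ^ 2 * ‖big (α / M) (P j) x‖ ^ 2 :=
      fun j _ => by positivity
    by_cases hx : α < ‖F x‖
    · have hF0 : 0 < ‖F x‖ := hα.trans hx
      obtain ⟨j, hj, hge⟩ : ∃ j ∈ Finset.range (n + 1), ‖F x‖ / M ≤ ‖P j x‖ := by
        by_contra hne
        push Not at hne
        have h1 : ‖∑ j ∈ Finset.range (n + 1), P j x‖ ≤ ‖F x‖ / 2 := by
          refine (norm_sum_le_of_le _ fun j hj => (hne j hj).le).trans (le_of_eq ?_)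
          rw [Finset.sum_const, Finset.card_range, nsmul_eq_mul]
          push_cast; simp only [M]; field_simp
        have h2 := norm_bottom_le hf hα hR ha hT hX x
        have h3 := norm_add_le (∑ j ∈ Finset.range (n + 1), P j x)
          (∑ i ∈ D.X, D.stage f a α R (n + 1) i x)
        rw [← hdec] at h3
        linarith
      refine le_trans ?_ (Finset.single_le_sum h0 hj)
      have hmem : α / M < ‖P j x‖ := (div_lt_div_of_pos_right hx hM).trans_le hge
      rw [big, big, indicator_of_mem (by exact hx), indicator_of_mem (by exact hmem), ← mul_pow]
      refine pow_le_pow_left₀ (norm_nonneg _) ?_ 2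
      rwa [div_le_iff₀' hM] at hge
    · rw [big, indicator_of_notMem (by exact hx), norm_zero, zero_pow two_ne_zero]
      exact Finset.sum_nonneg h0
  have hi : ∀ j ∈ Finset.range (n + 1), Integrable fun x => M ^ 2 * ‖big (α / M) (P j) x‖ ^ 2 :=
    fun j _ => ((hPbl j).integrable_big_sq _).const_mul _
  calc _ ≤ ∫ x, ∑ j ∈ Finset.range (n + 1), M ^ 2 * ‖big (α / M) (P j) x‖ ^ 2 :=
        integral_mono (hFbl.integrable_big_sq α) (integrable_finsetSum _ hi) hpt
    _ = ∑ j ∈ Finset.range (n + 1), M ^ 2 * ∫ x, ‖big (α / M) (P j) x‖ ^ 2 := by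
        rw [integral_finsetSum _ hi]
        exact Finset.sum_congr rfl fun j _ => integral_const_mul _ _
    _ ≤ ∑ j ∈ Finset.range (n + 1), M ^ 2 * (kerI ^ 2 * (7 + M ^ 4 * linC n (n + 1)) *
          D.b ^ 17 * ((D.b ^ (4 * j) : ℝ)⁻¹ *
          ∑ i ∈ D.X, ∫ x, ‖big (D.lev a α R j i) (f i) x‖ ^ 2)) :=
        Finset.sum_le_sum fun j _ => mul_le_mul_of_nonneg_left
          (piece_mass_le hf hα hR ha hT hX hS j hM) (by positivity)
    _ = _ := by
        rw [Finset.mul_sum]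
        refine Finset.sum_congr rfl fun j _ => ?_
        unfold masC; ring

end Fam


lemma BL.mass_antitone {S : Set E2} {G : E2 → ℂ} (hG : BL S G) :
    Antitone fun l => ∫ x, ‖big l G x‖ ^ 2 := fun l m h =>
  integral_mono (hG.integrable_big_sq m) (hG.integrable_big_sq l) fun x => by
    dsimp only
    refine pow_le_pow_left₀ (norm_nonneg _) ?_ 2
    unfold big
    exact norm_indicator_le_of_subset (fun y (hy : m < ‖G y‖) => h.trans_lt hy) _ _

/-- Layer cake formula for the powers of a function, in terms of its `L²` mass on superlevel
sets. -/
lemma BL.layer {S : Set E2} {G : E2 → ℂ} (hG : BL S G) {l p : ℝ} (hl : 0 < l) (hp : 0 < p) :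
    ENNReal.ofReal (l ^ (-p)) * ∫⁻ x, ‖G x‖ₑ ^ (p + 2) = ENNReal.ofReal p *
      ∫⁻ t in Ioi (0 : ℝ), ENNReal.ofReal (∫ x, ‖big (l * t) G x‖ ^ 2) *
        ENNReal.ofReal (t ^ (p - 1)) := by
  have hGm := hG.cont.measurable
  have h := lintegral_rpow_eq_lintegral_meas_lt_mul
    (volume.withDensity fun x => ‖G x‖ₑ ^ 2) (f := fun x => ‖G x‖ / l)
    (Filter.Eventually.of_forall fun x => by positivity)
    (hGm.norm.div_const l).aemeasurable hp
  rw [lintegral_withDensity_eq_lintegral_mul _ (hGm.enorm.pow_const 2)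
    ((hGm.norm.div_const l).pow_const p).ennreal_ofReal] at h
  have e1 : ∀ x, ((fun x => ‖G x‖ₑ ^ 2) * fun x => ENNReal.ofReal ((‖G x‖ / l) ^ p)) x =
      ENNReal.ofReal (l ^ (-p)) * ‖G x‖ₑ ^ (p + 2) := fun x => by
    have h0 := norm_nonneg (G x)
    rw [Pi.mul_apply, ← ofReal_norm, ← ENNReal.ofReal_pow h0,
      ENNReal.ofReal_rpow_of_nonneg h0 (by positivity), ← ENNReal.ofReal_mul (by positivity),
      ← ENNReal.ofReal_mul (by positivity), Real.div_rpow h0 hl.le,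
      Real.rpow_add_of_nonneg h0 hp.le (by norm_num), Real.rpow_two, Real.rpow_neg hl.le]
    congr 1; ring
  have e2 : ∀ t, (volume.withDensity fun x => ‖G x‖ₑ ^ 2) {x | t < ‖G x‖ / l} =
      ENNReal.ofReal (∫ x, ‖big (l * t) G x‖ ^ 2) := fun t => by
    have hm : MeasurableSet {x | t < ‖G x‖ / l} :=
      measurableSet_lt measurable_const (hGm.norm.div_const l)
    rw [withDensity_apply _ hm, ofReal_integral_eq_lintegral_ofReal (hG.integrable_big_sq _)
      (Filter.Eventually.of_forall fun x => sq_nonneg _), ← lintegral_indicator hm]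
    refine lintegral_congr fun x => ?_
    unfold big
    have hx : t < ‖G x‖ / l ↔ l * t < ‖G x‖ := by rw [lt_div_iff₀ hl, mul_comm]
    by_cases hh : l * t < ‖G x‖
    · rw [indicator_of_mem (by exact hx.2 hh), indicator_of_mem (by exact hh),
        ENNReal.ofReal_pow (norm_nonneg _), ofReal_norm]
    · rw [indicator_of_notMem (by exact fun h => hh (hx.1 h)), indicator_of_notMem (by exact hh)]
      simp
  simp only [e1, e2] at h
  rw [lintegral_const_mul _ (hGm.enorm.pow_const _)] at h
  exact h

namespace Fam

variable {D : Fam} {f : ℕ → E2 → ℂ}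

lemma lintegral_pow_le (hf : D.Leaf f) {a : ℕ → ℝ} {p R : ℝ} (hp : 0 < p) (hp4 : p ≤ 4)
    (hR : 0 < R) (ha : ∀ i ∈ D.X, 0 < a i) (hT : ∑ i ∈ D.X, a i ^ 2 ≤ R ^ 2) {n : ℕ}
    (hX : ∀ i ∈ D.X, i < D.b ^ n) (hS : D.S = D.b ^ (n + 1) * D.ρ)
    (hfa : ∀ i ∈ D.X, ∫⁻ x, ‖f i x‖ₑ ^ (p + 2) = ENNReal.ofReal (a i ^ (p + 2))) :
    ∫⁻ x, ‖∑ i ∈ D.X, f i x‖ₑ ^ (p + 2) ≤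
      ENNReal.ofReal (masC n * D.b ^ 17 * (n + 1) * kap ^ (-4 : ℝ) * R ^ (p + 2)) := by
  have hb : (1 : ℝ) ≤ D.b := by linarith [D.one_le_b]
  have hb0 : (0 : ℝ) < D.b := by linarith
  have hk := kap_pos
  have hF : BL univ fun x => ∑ i ∈ D.X, f i x := sum_bl hf.adm subset_rfl
  have hM := masC_nonneg n
  set C := masC n * D.b ^ 17 with hC
  have hC0 : 0 ≤ C := by positivity
  have hlev : ∀ j, ∀ i ∈ D.X, 0 < D.lev a 1 R j i := fun j i hi => lev_pos one_pos hR (ha i hi) j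
  have hlay := hF.layer (l := 1) one_pos hp
  rw [Real.one_rpow, ENNReal.ofReal_one, one_mul] at hlay
  rw [hlay]
  simp only [one_mul]
  have hterm : ∀ j, ∀ i ∈ D.X, (D.b ^ (4 * j) : ℝ)⁻¹ * ((D.lev a 1 R j i) ^ (-p) *
      a i ^ (p + 2)) ≤ kap ^ (-4 : ℝ) * R ^ p * a i ^ 2 := fun j i hi => by
    have hai := ha i hi
    have e : D.lev a 1 R j i = kap * (D.b ^ j : ℝ)⁻¹ * R⁻¹ * a i := by
      unfold lev; field_simp
    have hbj : (0 : ℝ) < D.b ^ j := by positivity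
    rw [e, Real.mul_rpow (by positivity) hai.le, Real.mul_rpow (by positivity) (by positivity),
      Real.mul_rpow hk.le (by positivity), Real.rpow_add hai, Real.rpow_two,
      Real.inv_rpow hbj.le, Real.inv_rpow hR.le, Real.rpow_neg hbj.le, Real.rpow_neg hR.le,
      Real.rpow_neg hai.le, inv_inv, inv_inv]
    have h1 : (D.b ^ j : ℝ) ^ p ≤ D.b ^ (4 * j) := by
      calc (D.b ^ j : ℝ) ^ p ≤ (D.b ^ j : ℝ) ^ (4 : ℝ) :=
            Real.rpow_le_rpow_of_exponent_le (one_le_pow₀ hb) hp4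
        _ = _ := by
            rw [show (4 : ℝ) = (4 : ℕ) by norm_num, Real.rpow_natCast, ← pow_mul, mul_comm]
    have h2 : kap ^ (-p) ≤ kap ^ (-4 : ℝ) :=
      Real.rpow_le_rpow_of_exponent_ge hk kap_le_one (by linarith)
    have h3 : 0 < a i ^ p := Real.rpow_pos_of_pos hai p
    have h4 : (D.b ^ (4 * j) : ℝ)⁻¹ * (D.b ^ j : ℝ) ^ p ≤ 1 := by
      rw [inv_mul_le_iff₀ (by positivity)]; linarith
    calc _ = ((D.b ^ (4 * j) : ℝ)⁻¹ * (D.b ^ j : ℝ) ^ p) * (kap ^ (-p) * R ^ p * a i ^ 2) := by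
          field_simp
      _ ≤ 1 * (kap ^ (-4 : ℝ) * R ^ p * a i ^ 2) := by gcongr
      _ = _ := one_mul _
  have hmeas : ∀ j, ∀ i ∈ D.X, Measurable fun t =>
      ENNReal.ofReal (∫ x, ‖big (D.lev a 1 R j i * t) (f i) x‖ ^ 2) *
        ENNReal.ofReal (t ^ (p - 1)) := fun j i hi => by
    have h2 : Measurable fun t : ℝ => ENNReal.ofReal (t ^ (p - 1)) := by fun_prop
    refine Measurable.mul ?_ h2
    exact (((hf i hi).mass_antitone.measurable).comp (measurable_const_mul _)).ennreal_ofReal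
  calc _ ≤ ENNReal.ofReal p * ∫⁻ t in Ioi (0 : ℝ), ∑ j ∈ Finset.range (n + 1), ∑ i ∈ D.X,
        ENNReal.ofReal (C * (D.b ^ (4 * j) : ℝ)⁻¹) *
          (ENNReal.ofReal (∫ x, ‖big (D.lev a 1 R j i * t) (f i) x‖ ^ 2) *
            ENNReal.ofReal (t ^ (p - 1))) := by
        gcongr ENNReal.ofReal p * ?_
        refine setLIntegral_mono' measurableSet_Ioi fun t ht => ?_
        have h := mass_le hf (show 0 < t from ht) hR ha hT hX hS
        have hs : ∀ j i, D.lev a t R j i = D.lev a 1 R j i * t := fun j i => by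
          unfold lev; ring
        simp only [hs, Finset.mul_sum] at h
        refine (mul_le_mul_left (ENNReal.ofReal_le_ofReal h) _).trans (le_of_eq ?_)
        have hnn : ∀ j i, 0 ≤ ∫ x, ‖big (D.lev a 1 R j i * t) (f i) x‖ ^ 2 := fun j i =>
          integral_nonneg fun x => sq_nonneg _
        have hbn : ∀ j, (0 : ℝ) ≤ (D.b ^ (4 * j) : ℝ)⁻¹ := fun j => by positivity
        have hnn2 : ∀ j i, 0 ≤ C * ((D.b ^ (4 * j) : ℝ)⁻¹ *
            ∫ x, ‖big (D.lev a 1 R j i * t) (f i) x‖ ^ 2) := fun j i =>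
          mul_nonneg hC0 (mul_nonneg (hbn j) (hnn j i))
        rw [ENNReal.ofReal_sum_of_nonneg fun j _ => Finset.sum_nonneg fun i _ => hnn2 j i,
          Finset.sum_mul]
        refine Finset.sum_congr rfl fun j _ => ?_
        rw [ENNReal.ofReal_sum_of_nonneg fun i _ => hnn2 j i, Finset.sum_mul]
        refine Finset.sum_congr rfl fun i _ => ?_
        rw [← mul_assoc C, ENNReal.ofReal_mul (mul_nonneg hC0 (hbn j)), mul_assoc]
    _ = ∑ j ∈ Finset.range (n + 1), ∑ i ∈ D.X, ENNReal.ofReal (C * (D.b ^ (4 * j) : ℝ)⁻¹) *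
          (ENNReal.ofReal p * ∫⁻ t in Ioi (0 : ℝ),
            ENNReal.ofReal (∫ x, ‖big (D.lev a 1 R j i * t) (f i) x‖ ^ 2) *
              ENNReal.ofReal (t ^ (p - 1))) := by
        rw [lintegral_finsetSum _ fun j _ => Finset.measurable_sum _ fun i hi =>
          (hmeas j i hi).const_mul _, Finset.mul_sum]
        refine Finset.sum_congr rfl fun j _ => ?_
        rw [lintegral_finsetSum _ fun i hi => (hmeas j i hi).const_mul _, Finset.mul_sum]
        refine Finset.sum_congr rfl fun i hi => ?_
        rw [lintegral_const_mul _ (hmeas j i hi)]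
        ring
    _ ≤ ∑ j ∈ Finset.range (n + 1), ∑ i ∈ D.X,
          ENNReal.ofReal (C * (kap ^ (-4 : ℝ) * R ^ p * a i ^ 2)) := by
        refine Finset.sum_le_sum fun j _ => Finset.sum_le_sum fun i hi => ?_
        have hai := ha i hi
        rw [← (hf i hi).layer (hlev j i hi) hp, hfa i hi,
          ← ENNReal.ofReal_mul (Real.rpow_nonneg (hlev j i hi).le _),
          ← ENNReal.ofReal_mul (by positivity), mul_assoc C]
        exact ENNReal.ofReal_le_ofReal (mul_le_mul_of_nonneg_left (hterm j i hi) hC0)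
    _ = ENNReal.ofReal (C * (n + 1) * kap ^ (-4 : ℝ) * R ^ p * ∑ i ∈ D.X, a i ^ 2) := by
        have hRp := Real.rpow_nonneg hR.le p
        rw [Finset.sum_const, Finset.card_range, nsmul_eq_mul,
          ← ENNReal.ofReal_sum_of_nonneg fun i _ => by positivity, ← Finset.mul_sum,
          ← Finset.mul_sum, ← ENNReal.ofReal_natCast, ← ENNReal.ofReal_mul (by positivity)]
        congr 1; push_cast; ring
    _ ≤ _ := by
        apply ENNReal.ofReal_le_ofReal
        rw [Real.rpow_add hR, Real.rpow_two, ← mul_assoc]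
        have hRp := Real.rpow_nonneg hR.le p
        gcongr

end Fam

lemma BL.eLpNorm_lt_top {S : Set E2} {G : E2 → ℂ} (hG : BL S G) {q : ℝ≥0∞} (hq : 2 ≤ q)
    (hq' : q ≠ ⊤) : eLpNorm G q volume < ⊤ := by
  obtain ⟨C, hC, hGC⟩ := hG.bdd
  have hq0 : q ≠ 0 := (lt_of_lt_of_le (by norm_num) hq).ne'
  have hr2 : 2 ≤ q.toReal := by
    simpa using (ENNReal.toReal_le_toReal (by norm_num) hq').2 hq
  have h2 : ∫⁻ x, ‖G x‖ₑ ^ (2 : ℝ) < ⊤ := by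
    have := lintegral_rpow_enorm_lt_top_of_eLpNorm_lt_top (by norm_num) (by norm_num) hG.1.2
    simpa using this
  refine (eLpNorm_lt_top_iff_lintegral_rpow_enorm_lt_top hq0 hq').2 ?_
  calc ∫⁻ x, ‖G x‖ₑ ^ q.toReal
      ≤ ∫⁻ x, ENNReal.ofReal C ^ (q.toReal - 2) * ‖G x‖ₑ ^ (2 : ℝ) := by
        refine lintegral_mono fun x => ?_
        have e : ‖G x‖ₑ ^ q.toReal = ‖G x‖ₑ ^ (q.toReal - 2) * ‖G x‖ₑ ^ (2 : ℝ) := by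
          rw [← ENNReal.rpow_add_of_nonneg _ _ (by linarith) (by norm_num), sub_add_cancel]
        rw [e, ← ofReal_norm]
        gcongr
        exact hGC x
    _ = ENNReal.ofReal C ^ (q.toReal - 2) * ∫⁻ x, ‖G x‖ₑ ^ (2 : ℝ) :=
        lintegral_const_mul _ (hG.cont.measurable.enorm.pow_const _)
    _ < ⊤ := ENNReal.mul_lt_top
        (ENNReal.rpow_lt_top_of_nonneg (by linarith) ENNReal.ofReal_ne_top) h2

lemma BL.eq_zero_of_eLpNorm {S : Set E2} {G : E2 → ℂ} (hG : BL S G) {q : ℝ≥0∞} (hq : q ≠ 0)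
    (h : eLpNorm G q volume = 0) (x : E2) : G x = 0 := by
  have h0 := (eLpNorm_eq_zero_iff hG.1.1 hq).1 h
  exact congrFun ((hG.cont.ae_eq_iff_eq volume continuous_zero).1 h0) x

lemma eLpNorm_two_eq {S : Set E2} {G : E2 → ℂ} (hG : BL S G) :
    eLpNorm G 2 volume ^ 2 = ENNReal.ofReal (∫ x, ‖G x‖ ^ 2) := by
  rw [ofReal_integral_eq_lintegral_ofReal hG.sqInt (Filter.Eventually.of_forall fun x => sq_nonneg _),
    eLpNorm_eq_lintegral_rpow_enorm_toReal (by norm_num) (by norm_num)]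
  simp only [ENNReal.toReal_ofNat]
  rw [← ENNReal.rpow_natCast, ← ENNReal.rpow_mul]
  norm_num

namespace Fam

variable {D : Fam} {f : ℕ → E2 → ℂ}

/-- The constant in the square function estimate for one length. -/
def sqC (n : ℕ) : ℝ := 7 + masC n * (n + 1) * kap ^ (-4 : ℝ)

lemma sqC_ge (n : ℕ) : 7 ≤ sqC n := by
  have := masC_nonneg n; have := kap_pos
  have : 0 ≤ masC n * (n + 1) * kap ^ (-4 : ℝ) := by positivity
  unfold sqC; linarith

lemma le_sqrt_of_sq_le {A B : ℝ≥0∞} {K : ℝ} (hK : 1 ≤ K) (h : A ^ 2 ≤ ENNReal.ofReal K * B) :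
    A ≤ ENNReal.ofReal K * B ^ ((1 : ℝ) / 2) := by
  have h1 : A = (A ^ 2) ^ ((1 : ℝ) / 2) := by
    rw [← ENNReal.rpow_natCast, ← ENNReal.rpow_mul]; norm_num
  rw [h1]
  refine (ENNReal.rpow_le_rpow h (by norm_num)).trans ?_
  rw [ENNReal.mul_rpow_of_nonneg _ _ (by norm_num)]
  gcongr
  have : (1 : ℝ≥0∞) ≤ ENNReal.ofReal K := by rwa [ENNReal.one_le_ofReal]
  calc _ ≤ ENNReal.ofReal K ^ (1 : ℝ) := ENNReal.rpow_le_rpow_of_exponent_le this (by norm_num)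
    _ = _ := ENNReal.rpow_one _

/-- The decoupling inequality for one length, with nontrivial terms. -/
lemma eLpNorm_le_of_ne_zero (hf : D.Leaf f) {q : ℝ≥0∞} (hq : 2 < q) (hq6 : q ≤ 6) {n : ℕ}
    (hX : ∀ i ∈ D.X, i < D.b ^ n) (hS : D.S = D.b ^ (n + 1) * D.ρ)
    (h0 : ∀ i ∈ D.X, eLpNorm (f i) q volume ≠ 0) :
    eLpNorm (fun x => ∑ i ∈ D.X, f i x) q volume ≤
      ENNReal.ofReal (sqC n * D.b ^ 17) *
        (∑ i ∈ D.X, eLpNorm (f i) q volume ^ 2) ^ ((1 : ℝ) / 2) := by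
  have hqt : q ≠ ⊤ := ne_top_of_le_ne_top (by norm_num) hq6
  have hq0 : q ≠ 0 := (zero_le.trans_lt hq).ne'
  have hb : (1 : ℝ) ≤ D.b := by linarith [D.one_le_b]
  have hs := sqC_ge n
  have hfin : ∀ i ∈ D.X, eLpNorm (f i) q volume ≠ ⊤ := fun i hi =>
    ((hf i hi).eLpNorm_lt_top hq.le hqt).ne
  obtain hXe | hXe := D.X.eq_empty_or_nonempty
  · simp [hXe]
  set a : ℕ → ℝ := fun i => (eLpNorm (f i) q volume).toReal
  have hofa : ∀ i ∈ D.X, ENNReal.ofReal (a i) = eLpNorm (f i) q volume := fun i hi =>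
    ENNReal.ofReal_toReal (hfin i hi)
  have ha : ∀ i ∈ D.X, 0 < a i := fun i hi => ENNReal.toReal_pos (h0 i hi) (hfin i hi)
  set T := ∑ i ∈ D.X, a i ^ 2
  have hT : 0 < T := Finset.sum_pos (fun i hi => pow_pos (ha i hi) 2) hXe
  set r := q.toReal
  have hr2 : 2 < r := by
    have := (ENNReal.toReal_lt_toReal (by norm_num) hqt).2 hq
    simpa using this
  have hr6 : r ≤ 6 := by
    have := (ENNReal.toReal_le_toReal hqt (by norm_num)).2 hq6
    simpa using this
  have hr0 : 0 < r := by linarith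
  have hR : 0 < √T := Real.sqrt_pos.2 hT
  have key : ∀ G : E2 → ℂ, ∫⁻ x, ‖G x‖ₑ ^ (r - 2 + 2) = eLpNorm G q volume ^ r := fun G => by
    rw [eLpNorm_eq_lintegral_rpow_enorm_toReal hq0 hqt, ← ENNReal.rpow_mul, one_div,
      inv_mul_cancel₀ hr0.ne', ENNReal.rpow_one, sub_add_cancel]
  have h := lintegral_pow_le hf (p := r - 2) (by linarith) (by linarith) hR ha
    (Real.sq_sqrt hT.le).ge hX hS fun i hi => by
      rw [key, ← hofa i hi, sub_add_cancel, ENNReal.ofReal_rpow_of_pos (ha i hi)]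
  rw [key, sub_add_cancel] at h
  have hK : masC n * D.b ^ 17 * (n + 1) * kap ^ (-4 : ℝ) ≤ sqC n * D.b ^ 17 := by
    have : (0 : ℝ) ≤ D.b ^ 17 := by positivity
    unfold sqC; nlinarith
  have hK1 : 1 ≤ sqC n * D.b ^ 17 := by
    have h17 : (1 : ℝ) ≤ D.b ^ 17 := one_le_pow₀ hb
    nlinarith
  have hTs : (∑ i ∈ D.X, eLpNorm (f i) q volume ^ 2) ^ ((1 : ℝ) / 2) = ENNReal.ofReal (√T) := by
    rw [Real.sqrt_eq_rpow, ← ENNReal.ofReal_rpow_of_pos hT]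
    congr 1
    rw [ENNReal.ofReal_sum_of_nonneg fun i _ => sq_nonneg _]
    refine Finset.sum_congr rfl fun i hi => ?_
    rw [ENNReal.ofReal_pow (ha i hi).le, hofa i hi]
  rw [hTs]
  have h2 : eLpNorm (fun x => ∑ i ∈ D.X, f i x) q volume ^ r ≤
      (ENNReal.ofReal (sqC n * D.b ^ 17) * ENNReal.ofReal (√T)) ^ r := by
    refine h.trans ?_
    rw [← ENNReal.ofReal_mul (by positivity), ENNReal.ofReal_rpow_of_nonneg (by positivity) hr0.le]
    apply ENNReal.ofReal_le_ofReal
    rw [Real.mul_rpow (by positivity) hR.le]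
    have h3 : sqC n * D.b ^ 17 ≤ (sqC n * D.b ^ 17) ^ r :=
      Real.self_le_rpow_of_one_le hK1 (by linarith)
    have := Real.rpow_nonneg hR.le r
    exact mul_le_mul_of_nonneg_right (hK.trans h3) this
  exact (ENNReal.rpow_le_rpow_iff hr0).1 h2

/-- The decoupling inequality for one length. -/
lemma eLpNorm_sum_le (hf : D.Leaf f) {q : ℝ≥0∞} (hq : 2 ≤ q) (hq6 : q ≤ 6) {n : ℕ}
    (hX : ∀ i ∈ D.X, i < D.b ^ n) (hS : D.S = D.b ^ (n + 1) * D.ρ) :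
    eLpNorm (fun x => ∑ i ∈ D.X, f i x) q volume ≤
      ENNReal.ofReal (sqC n * D.b ^ 17) *
        (∑ i ∈ D.X, eLpNorm (f i) q volume ^ 2) ^ ((1 : ℝ) / 2) := by
  classical
  have hb : (1 : ℝ) ≤ D.b := by linarith [D.one_le_b]
  have h17 : (1 : ℝ) ≤ D.b ^ 17 := one_le_pow₀ hb
  have hs := sqC_ge n
  obtain rfl | hq2 := hq.eq_or_lt
  · have hK : 7 ≤ sqC n * D.b ^ 17 := by nlinarith
    refine le_sqrt_of_sq_le (by linarith) ?_
    rw [eLpNorm_two_eq (sum_bl hf.adm subset_rfl)]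
    calc _ ≤ ENNReal.ofReal (7 * ∑ i ∈ D.X, ∫ x, ‖f i x‖ ^ 2) :=
          ENNReal.ofReal_le_ofReal (sum_energy_le hf.adm subset_rfl)
      _ = ENNReal.ofReal 7 * ∑ i ∈ D.X, eLpNorm (f i) 2 volume ^ 2 := by
          rw [ENNReal.ofReal_mul (by norm_num), ENNReal.ofReal_sum_of_nonneg fun i _ =>
            integral_nonneg fun x => sq_nonneg _]
          congr 1
          exact Finset.sum_congr rfl fun i hi => (eLpNorm_two_eq (hf i hi)).symm
      _ ≤ _ := by gcongr
  · set Y := D.X.filter fun i => eLpNorm (f i) q volume ≠ 0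
    have hY : Y ⊆ D.X := Finset.filter_subset _ _
    have hq0 : q ≠ 0 := (zero_le.trans_lt hq2).ne'
    have hz : ∀ i ∈ D.X, i ∉ Y → eLpNorm (f i) q volume = 0 := fun i hi hiY => by
      by_contra hne
      exact hiY (Finset.mem_filter.2 ⟨hi, hne⟩)
    have h := eLpNorm_le_of_ne_zero (D := D.sub Y hY) (f := f) (fun i hi => hf i (hY hi)) hq2 hq6
      (n := n) (fun i hi => hX i (hY hi)) hS fun i hi => (Finset.mem_filter.1 hi).2
    have e1 : (fun x => ∑ i ∈ D.X, f i x) = fun x => ∑ i ∈ (D.sub Y hY).X, f i x := by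
      funext x
      exact (Finset.sum_subset hY fun i hi hiY =>
        (hf i hi).eq_zero_of_eLpNorm hq0 (hz i hi hiY) x).symm
    rw [e1]
    refine h.trans ?_
    gcongr
    · exact le_rfl
    · exact hY

end Fam

/-! ### Convex curves and dyadic intervals -/

/-- `s` is a subgradient of `γ` at `x`. -/
def IsSub (γ : ℝ → ℝ) (x s : ℝ) : Prop := ∀ y ∈ Icc (0 : ℝ) 1, γ x + s * (y - x) ≤ γ y

lemma IsSub.mono {γ : ℝ → ℝ} {x y s t : ℝ} (hx : IsSub γ x s) (hy : IsSub γ y t)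
    (hx1 : x ∈ Icc (0 : ℝ) 1) (hy1 : y ∈ Icc (0 : ℝ) 1) (h : x < y) : s ≤ t := by
  have h1 := hx y hy1
  have h2 := hy x hx1
  have h3 : (s - t) * (y - x) ≤ 0 := by linarith
  by_contra! hc
  nlinarith

/-- A convex curve with slopes in `[0,1]`; the one-sided slopes are subgradients. -/
structure Crv (γ γR γL : ℝ → ℝ) : Prop where
  right : ∀ x ∈ Ico (0 : ℝ) 1, IsSub γ x (γR x)
  left : ∀ x ∈ Ioc (0 : ℝ) 1, IsSub γ x (γL x)
  lo : 0 ≤ γR 0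
  hi : γL 1 ≤ 1

lemma crv_of_convexOn {γ γR γL : ℝ → ℝ} (hγ : ConvexOn ℝ (Icc (0 : ℝ) 1) γ)
    (hd : HasOneSidedDerivs γ γR γL 0 1) (lo : 0 ≤ γR 0) (hi : γL 1 ≤ 1) : Crv γ γR γL := by
  refine ⟨fun x hx y hy => ?_, fun x hx y hy => ?_, lo, hi⟩
  · have hx' : x ∈ Icc (0 : ℝ) 1 := ⟨hx.1, hx.2.le⟩
    have ht := hasDerivWithinAt_iff_tendsto_slope.1 (hd.1 x hx)
    rw [sdiff_singleton_eq_self (by simp)] at ht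
    have hne : (nhdsWithin x (Ioc x 1)).NeBot := by
      rw [nhdsWithin_Ioc_eq_nhdsGT hx.2]; infer_instance
    rcases lt_trichotomy y x with h | rfl | h
    · have h1 : slope γ y x ≤ γR x := by
        refine ge_of_tendsto ht ?_
        filter_upwards [self_mem_nhdsWithin] with z hz
        have := hγ.slope_mono_adjacent hy ⟨hx'.1.trans hz.1.le, hz.2⟩ h hz.1
        simpa only [slope_def_field] using this
      rw [slope_def_field, div_le_iff₀ (by linarith)] at h1
      linarith
    · simp
    · have h1 : γR x ≤ slope γ x y := by
        refine le_of_tendsto ht ?_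
        have : Ioo x y ∈ nhdsWithin x (Ioc x 1) := by
          rw [nhdsWithin_Ioc_eq_nhdsGT hx.2]; exact Ioo_mem_nhdsGT h
        filter_upwards [this] with z hz
        have := hγ.secant_mono hx' ⟨hx'.1.trans hz.1.le, hz.2.le.trans hy.2⟩ hy hz.1.ne' h.ne'
          hz.2.le
        simpa only [slope_def_field] using this
      rw [slope_def_field, le_div_iff₀ (by linarith)] at h1
      linarith
  · have hx' : x ∈ Icc (0 : ℝ) 1 := ⟨hx.1.le, hx.2⟩
    have ht := hasDerivWithinAt_iff_tendsto_slope.1 (hd.2 x hx)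
    rw [sdiff_singleton_eq_self (by simp)] at ht
    have hne : (nhdsWithin x (Ico 0 x)).NeBot := by
      rw [nhdsWithin_Ico_eq_nhdsLT hx.1]; infer_instance
    rcases lt_trichotomy x y with h | rfl | h
    · have h1 : γL x ≤ slope γ x y := by
        refine le_of_tendsto ht ?_
        filter_upwards [self_mem_nhdsWithin] with z hz
        have := hγ.slope_mono_adjacent ⟨hz.1, hz.2.le.trans hx.2⟩ hy hz.2 h
        rw [slope_comm]
        simpa only [slope_def_field] using this
      rw [slope_def_field, le_div_iff₀ (by linarith)] at h1
      linarith
    · simp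
    · have h1 : slope γ x y ≤ γL x := by
        refine ge_of_tendsto ht ?_
        have : Ioo y x ∈ nhdsWithin x (Ico 0 x) := by
          rw [nhdsWithin_Ico_eq_nhdsLT hx.1]; exact Ioo_mem_nhdsLT h
        filter_upwards [this] with z hz
        have := hγ.secant_mono hx' hy ⟨hy.1.trans hz.1.le, hz.2.le.trans hx.2⟩ h.ne hz.2.ne
          hz.1.le
        simpa only [slope_def_field] using this
      rw [slope_comm, slope_def_field, div_le_iff₀ (by linarith)] at h1
      linarith

/-- The `i`-th dyadic point of generation `k`. -/
def dy (k i : ℕ) : ℝ := i / 2 ^ k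

lemma dy_succ (k i : ℕ) : dy k (i + 1) = dy k i + 1 / 2 ^ k := by
  unfold dy; push_cast; ring

lemma dy_nonneg (k i : ℕ) : 0 ≤ dy k i := by unfold dy; positivity

lemma dy_le_one {k i : ℕ} (h : i ≤ 2 ^ k) : dy k i ≤ 1 := by
  unfold dy
  rw [div_le_one (by positivity)]
  exact_mod_cast h

lemma dy_lt_one {k i : ℕ} (h : i < 2 ^ k) : dy k i < 1 := by
  unfold dy
  rw [div_lt_one (by positivity)]
  exact_mod_cast h

lemma dy_succ_pos (k i : ℕ) : 0 < dy k (i + 1) := by unfold dy; positivity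

lemma dy_le_dy {k i j : ℕ} (h : i ≤ j) : dy k i ≤ dy k j := by unfold dy; gcongr

lemma dy_mul (k i m : ℕ) : dy (k + m) (2 ^ m * i) = dy k i := by
  unfold dy; push_cast; rw [pow_add]; field_simp

/-- The midpoint of a dyadic interval. -/
def md (k i : ℕ) : ℝ := dy k i + 1 / 2 ^ k / 2

lemma dy_lt_md (k i : ℕ) : dy k i < md k i := by
  have : (0 : ℝ) < 1 / 2 ^ k / 2 := by positivity
  unfold md; linarith

lemma md_lt_dy (k i : ℕ) : md k i < dy k (i + 1) := by
  have : (0 : ℝ) < 1 / 2 ^ k / 2 := by positivity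
  rw [dy_succ]; unfold md; linarith

namespace Crv

variable {γ γR γL : ℝ → ℝ} {R : ℝ}

lemma R_mono (h : Crv γ γR γL) {x y : ℝ} (hx : x ∈ Ico (0 : ℝ) 1) (hy : y ∈ Ico (0 : ℝ) 1)
    (hxy : x ≤ y) : γR x ≤ γR y := by
  obtain rfl | hl := hxy.eq_or_lt
  · rfl
  · exact (h.right x hx).mono (h.right y hy) (Ico_subset_Icc_self hx) (Ico_subset_Icc_self hy) hl

lemma L_mono (h : Crv γ γR γL) {x y : ℝ} (hx : x ∈ Ioc (0 : ℝ) 1) (hy : y ∈ Ioc (0 : ℝ) 1)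
    (hxy : x ≤ y) : γL x ≤ γL y := by
  obtain rfl | hl := hxy.eq_or_lt
  · rfl
  · exact (h.left x hx).mono (h.left y hy) (Ioc_subset_Icc_self hx) (Ioc_subset_Icc_self hy) hl

lemma R_nonneg (h : Crv γ γR γL) {x : ℝ} (hx : x ∈ Ico (0 : ℝ) 1) : 0 ≤ γR x :=
  h.lo.trans (h.R_mono ⟨le_rfl, one_pos⟩ hx hx.1)

lemma L_le_one (h : Crv γ γR γL) {x : ℝ} (hx : x ∈ Ioc (0 : ℝ) 1) : γL x ≤ 1 :=
  (h.L_mono hx ⟨one_pos, le_rfl⟩ hx.2).trans h.hi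

lemma R_le_L (h : Crv γ γR γL) {x y : ℝ} (hx : 0 ≤ x) (hxy : x < y) (hy : y ≤ 1) :
    γR x ≤ γL y :=
  (h.right x ⟨hx, hxy.trans_le hy⟩).mono (h.left y ⟨hx.trans_lt hxy, hy⟩)
    ⟨hx, hxy.le.trans hy⟩ ⟨hx.trans hxy.le, hy⟩ hxy

lemma L_le_R (h : Crv γ γR γL) {x y : ℝ} (hx : 0 < x) (hxy : x < y) (hy : y < 1) :
    γL x ≤ γR y :=
  (h.left x ⟨hx, hxy.le.trans hy.le⟩).mono (h.right y ⟨hx.le.trans hxy.le, hy⟩)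
    ⟨hx.le, hxy.le.trans hy.le⟩ ⟨hx.le.trans hxy.le, hy.le⟩ hxy

/-- At each point of an interval there is a subgradient between the extreme slopes. -/
lemma exists_sub (h : Crv γ γR γL) {a e x : ℝ} (ha : 0 ≤ a) (he : e ≤ 1) (hae : a < e)
    (hx : x ∈ Icc a e) : ∃ s, IsSub γ x s ∧ γR a ≤ s ∧ s ≤ γL e := by
  obtain hxe | hxe := hx.2.eq_or_lt
  · exact ⟨γL x, h.left x ⟨by linarith, by linarith⟩, hxe ▸ h.R_le_L ha hae he, hxe ▸ le_rfl⟩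
  · have hx1 : x ∈ Ico (0 : ℝ) 1 := ⟨ha.trans hx.1, by linarith⟩
    exact ⟨γR x, h.right x hx1, h.R_mono ⟨ha, by linarith⟩ hx1 hx.1, h.R_le_L hx1.1 hxe he⟩

/-- Distance to a tangent line. -/
lemma abs_tangent_le (h : Crv γ γR γL) {a e x m : ℝ} (ha : 0 ≤ a) (he : e ≤ 1) (hae : a < e)
    (hx : x ∈ Icc a e) (hm : m ∈ Ioo a e) :
    |γ x - γ m - γR m * (x - m)| ≤ (γL e - γR a) * |x - m| := by
  have hm1 : m ∈ Ico (0 : ℝ) 1 := ⟨ha.trans hm.1.le, by linarith [hm.2]⟩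
  have hxI : x ∈ Icc (0 : ℝ) 1 := ⟨ha.trans hx.1, hx.2.trans he⟩
  obtain ⟨s, hs, hs1, hs2⟩ := h.exists_sub ha he hae hx
  have h1 := h.right m hm1 x hxI
  have h2 := hs m (Ico_subset_Icc_self hm1)
  have h3 := h.R_mono ⟨ha, by linarith⟩ hm1 hm.1.le
  have h4 := h.R_le_L hm1.1 hm.2 he
  rw [abs_of_nonneg (by linarith)]
  calc γ x - γ m - γR m * (x - m) ≤ (s - γR m) * (x - m) := by linarith
    _ ≤ |(s - γR m) * (x - m)| := le_abs_self _
    _ = |s - γR m| * |x - m| := abs_mul _ _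
    _ ≤ _ := by
      gcongr
      exact abs_le.2 ⟨by linarith, by linarith⟩

end Crv

/-- The curve is flat over a dyadic interval. -/
def Flat (γR γL : ℝ → ℝ) (R : ℝ) (k i : ℕ) : Prop :=
  1 / 2 ^ k * (γL (dy k (i + 1)) - γR (dy k i)) ≤ 2 / R

open Classical in
/-- The indices of generation `k` of the maximal flat dyadic intervals. -/
def leaves (γR γL : ℝ → ℝ) (R : ℝ) (k : ℕ) : Finset ℕ :=
  (Finset.range (2 ^ k)).filter fun i =>
    Flat γR γL R k i ∧ ∀ l, k = l + 1 → ¬ Flat γR γL R l (i / 2)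

namespace Crv

variable {γ γR γL : ℝ → ℝ} {R : ℝ}

lemma mem_leaves {k i : ℕ} : i ∈ leaves γR γL R k ↔
    i < 2 ^ k ∧ Flat γR γL R k i ∧ ∀ l, k = l + 1 → ¬ Flat γR γL R l (i / 2) := by
  simp [leaves]

lemma dy_half_le (k i : ℕ) : dy k (i / 2) ≤ dy (k + 1) i := by
  rw [← dy_mul k (i / 2) 1, pow_one]; exact dy_le_dy (by omega)

lemma le_dy_half (k i : ℕ) : dy (k + 1) (i + 1) ≤ dy k (i / 2 + 1) := by
  rw [← dy_mul k (i / 2 + 1) 1, pow_one]; exact dy_le_dy (by omega)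

lemma dy_mem (k i : ℕ) (hi : i < 2 ^ k) : dy k i ∈ Ico (0 : ℝ) 1 := ⟨dy_nonneg k i, dy_lt_one hi⟩

lemma dy_succ_mem (k i : ℕ) (hi : i < 2 ^ k) : dy k (i + 1) ∈ Ioc (0 : ℝ) 1 :=
  ⟨dy_succ_pos k i, dy_le_one hi⟩

lemma var_nonneg (h : Crv γ γR γL) {k i : ℕ} (hi : i < 2 ^ k) :
    0 ≤ γL (dy k (i + 1)) - γR (dy k i) :=
  sub_nonneg.2 (h.R_le_L (dy_nonneg k i) ((dy_lt_md k i).trans (md_lt_dy k i)) (dy_le_one hi))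

lemma var_le_one (h : Crv γ γR γL) {k i : ℕ} (hi : i < 2 ^ k) :
    γL (dy k (i + 1)) - γR (dy k i) ≤ 1 := by
  linarith [h.R_nonneg (dy_mem k i hi), h.L_le_one (dy_succ_mem k i hi)]

lemma flat_child (h : Crv γ γR γL) {k i : ℕ} (hi : i < 2 ^ (k + 1))
    (hf : Flat γR γL R k (i / 2)) : Flat γR γL R (k + 1) i := by
  have hi2 : i / 2 < 2 ^ k := by rw [pow_succ] at hi; omega
  unfold Flat at *
  have h1 := h.R_mono (dy_mem _ _ hi2) (dy_mem _ _ hi) (dy_half_le k i)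
  have h2 := h.L_mono (dy_succ_mem _ _ hi) (dy_succ_mem _ _ hi2) (le_dy_half k i)
  have h3 := h.var_nonneg hi2
  refine le_trans ?_ hf
  gcongr
  · exact h.var_nonneg hi
  · exact one_le_two
  · omega

lemma flat_of_lt (h : Crv γ γR γL) (hR : 0 < R) {k i : ℕ} (hi : i < 2 ^ k) (hk : R ≤ 2 * 2 ^ k) :
    Flat γR γL R k i := by
  unfold Flat
  have := h.var_le_one hi
  rw [div_mul_eq_mul_div, one_mul, div_le_div_iff₀ (by positivity) hR]
  nlinarith

lemma pow_le_of_leaf (h : Crv γ γR γL) (hR : 1 ≤ R) {k i : ℕ} (hi : i ∈ leaves γR γL R k) :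
    (2 : ℝ) ^ k ≤ R := by
  obtain ⟨hi, -, hp⟩ := mem_leaves.1 hi
  cases k with
  | zero => simpa using hR
  | succ k =>
    by_contra! hc
    have hi2 : i / 2 < 2 ^ k := by rw [pow_succ] at hi; omega
    exact hp k rfl (h.flat_of_lt (by linarith) hi2 (by rw [pow_succ] at hc; linarith))

/-- Along a branch of the dyadic tree there is a leaf. -/
lemma exists_leaf (h : Crv γ γR γL) (hR : 0 < R) {K : ℕ} (hK : R ≤ 2 * 2 ^ K) {u : ℕ → ℕ}
    (hu : ∀ k, u k < 2 ^ k) (hu2 : ∀ k, u (k + 1) / 2 = u k) :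
    ∃ k ≤ K, u k ∈ leaves γR γL R k := by
  classical
  have hex : ∃ k, Flat γR γL R k (u k) := ⟨K, h.flat_of_lt hR (hu K) hK⟩
  refine ⟨Nat.find hex, Nat.find_min' hex (h.flat_of_lt hR (hu K) hK), mem_leaves.2
    ⟨hu _, Nat.find_spec hex, fun l hl => ?_⟩⟩
  rw [hl, hu2 l]
  exact Nat.find_min hex (by omega)

/-- Along a branch of the dyadic tree there is at most one leaf. -/
lemma leaf_unique (h : Crv γ γR γL) {u : ℕ → ℕ}
    (hu : ∀ k, u k < 2 ^ k) (hu2 : ∀ k, u (k + 1) / 2 = u k) {k l : ℕ}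
    (hk : u k ∈ leaves γR γL R k) (hl : u l ∈ leaves γR γL R l) : k = l := by
  have hmono : ∀ k l, k ≤ l → Flat γR γL R k (u k) → Flat γR γL R l (u l) := fun k l hkl hf => by
    induction l, hkl using Nat.le_induction with
    | base => exact hf
    | succ l _ ih => exact h.flat_child (hu _) (by rwa [hu2])
  have key : ∀ k l, k < l → u k ∈ leaves γR γL R k → u l ∈ leaves γR γL R l → False :=
    fun k l hkl hk hl => by
      obtain ⟨m, rfl⟩ : ∃ m, l = m + 1 := ⟨l - 1, by omega⟩
      have := (mem_leaves.1 hl).2.2 m rfl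
      rw [hu2] at this
      exact this (hmono k m (by omega) (mem_leaves.1 hk).2.1)
  rcases lt_trichotomy k l with hlt | rfl | hlt
  · exact (key _ _ hlt hk hl).elim
  · rfl
  · exact (key _ _ hlt hl hk).elim

end Crv

/-! ### Counting flat intervals by caps -/

lemma inner_E2 (w x : E2) : inner ℝ w x = w 0 * x 0 + w 1 * x 1 := by
  simp [PiLp.inner_apply, Fin.sum_univ_two]; ring

lemma norm_sq_E2 (w : E2) : ‖w‖ ^ 2 = w 0 ^ 2 + w 1 ^ 2 := by
  rw [EuclideanSpace.norm_sq_eq, Fin.sum_univ_two]; simp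

/-- The point of the curve over `t`. -/
def pt (γ : ℝ → ℝ) (t : ℝ) : E2 := !₂[t, γ t]

lemma pt_mem {γ : ℝ → ℝ} {t : ℝ} (ht : t ∈ Icc (0 : ℝ) 1) : pt γ t ∈ curveGraph γ := by
  simpa [curveGraph, pt] using ht

namespace Crv

variable {γ γR γL : ℝ → ℝ} {R : ℝ}

lemma exists_caps (h : Crv γ γR γL) (hR : 1 ≤ R) : ∃ n : ℕ, ∃ (w : Fin n → E2) (c : Fin n → ℝ),
    (∀ i, IsSupportingLine γ (w i) (c i)) ∧ curveGraph γ ⊆ ⋃ i, cap γ (w i) (c i) R⁻¹ := by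
  set M := ⌈R⌉₊ + 1 with hM
  have hMR : R < M := by rw [hM]; push_cast; linarith [Nat.le_ceil R]
  have hM0 : (0 : ℝ) < M := by linarith
  set t : Fin M → ℝ := fun j => j / M
  have ht : ∀ j, t j ∈ Ico (0 : ℝ) 1 := fun j =>
    ⟨by positivity, (div_lt_one hM0).2 (by exact_mod_cast j.2)⟩
  have hw : ∀ j x, inner ℝ (!₂[-γR (t j), 1] : E2) x = x 1 - γR (t j) * x 0 := fun j x => by
    rw [inner_E2]; simp; ring
  refine ⟨M, fun j => !₂[-γR (t j), 1], fun j => γ (t j) - γR (t j) * t j, fun j => ⟨?_, ?_, ?_⟩, ?_⟩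
  · intro h0
    have := congrArg (fun w : E2 => w 1) h0
    simp at this
  · exact ⟨pt γ (t j), subset_closure (pt_mem (Ico_subset_Icc_self (ht j))), by
      rw [hw]; simp [pt]⟩
  · right
    intro x hx
    rw [hw, hx.2]
    have := h.right _ (ht j) (x 0) hx.1
    linarith
  · intro x hx
    have hx1 := hx.1
    obtain ⟨j, hj1, hj2⟩ : ∃ j : Fin M, t j ≤ x 0 ∧ x 0 - t j ≤ 1 / M := by
      have hfl := Nat.floor_le (mul_nonneg hx1.1 hM0.le)
      have hfl2 := Nat.lt_floor_add_one (x 0 * M)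
      by_cases hlt : ⌊x 0 * M⌋₊ < M
      · refine ⟨⟨_, hlt⟩, ?_, ?_⟩
        · exact (div_le_iff₀ hM0).2 hfl
        · rw [sub_le_iff_le_add, ← add_div, le_div_iff₀ hM0]; linarith
      · refine ⟨⟨M - 1, by omega⟩, ?_, ?_⟩
        · refine (div_le_iff₀ hM0).2 (le_trans ?_ hfl)
          exact_mod_cast (by omega : M - 1 ≤ ⌊x 0 * M⌋₊)
        · rw [sub_le_iff_le_add, ← add_div, le_div_iff₀ hM0]
          have : ((M - 1 : ℕ) : ℝ) = M - 1 := by rw [Nat.cast_sub (by omega)]; simp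
          rw [this]; nlinarith [hx1.2]
    refine mem_iUnion.2 ⟨j, hx, ?_⟩
    rw [hw, hx.2]
    have hn : 1 ≤ ‖(!₂[-γR (t j), 1] : E2)‖ := by
      have := norm_sq_E2 (!₂[-γR (t j), 1] : E2)
      simp at this
      nlinarith [norm_nonneg (!₂[-γR (t j), 1] : E2), sq_nonneg (γR (t j))]
    have h1 := h.right _ (ht j) (x 0) hx1
    obtain ⟨s, hs, -, hs2⟩ := h.exists_sub le_rfl le_rfl one_pos hx1
    have h2 := hs _ (Ico_subset_Icc_self (ht j))
    have h3 := h.R_nonneg (ht j)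
    have h4 := h.hi
    have h5 : (s - γR (t j)) * (x 0 - t j) ≤ 1 * (x 0 - t j) :=
      mul_le_mul_of_nonneg_right (by linarith) (by linarith)
    have h6 : 1 / (M : ℝ) < R⁻¹ := by
      rw [one_div]; exact inv_strictAnti₀ (by linarith) hMR
    refine lt_of_le_of_lt (div_le_self (abs_nonneg _) hn) ?_
    rw [abs_of_nonneg (by linarith)]
    linarith

lemma capNumber_spec (h : Crv γ γR γL) (hR : 1 ≤ R) :
    ∃ (w : Fin (capNumber γ R⁻¹) → E2) (c : Fin (capNumber γ R⁻¹) → ℝ),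
    (∀ i, IsSupportingLine γ (w i) (c i)) ∧ curveGraph γ ⊆ ⋃ i, cap γ (w i) (c i) R⁻¹ :=
  Nat.sInf_mem (h.exists_caps hR)

lemma capNumber_pos (h : Crv γ γR γL) (hR : 1 ≤ R) : 1 ≤ capNumber γ R⁻¹ := by
  obtain ⟨w, c, -, hc⟩ := h.capNumber_spec hR
  obtain ⟨i, -⟩ := mem_iUnion.1 (hc (pt_mem (γ := γ) (t := 0) (by simp)))
  exact i.pos

/-- A normalised line that is close to two distant points of a curve has a controlled slope. -/
lemma cap_chord {w : E2} {c r t t' : ℝ} (hw : w ≠ 0) (ht : pt γ t ∈ cap γ w c r)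
    (ht' : pt γ t' ∈ cap γ w c r) :
    |w 0 * (t' - t) + w 1 * (γ t' - γ t)| < 2 * r * ‖w‖ := by
  have hn := norm_pos_iff.2 hw
  have h1 := (div_lt_iff₀ hn).1 ht.2
  have h2 := (div_lt_iff₀ hn).1 ht'.2
  simp only [inner_E2, pt, Matrix.cons_val_zero, Matrix.cons_val_one] at h1 h2
  rw [abs_lt] at *
  constructor <;> linarith

lemma md_mem {k i : ℕ} (hi : i < 2 ^ k) : md k i ∈ Ico (0 : ℝ) 1 :=
  ⟨(dy_nonneg k i).trans (dy_lt_md k i).le, (md_lt_dy k i).trans_le (dy_le_one hi)⟩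

lemma md_sub {k i j m : ℕ} (h : i + m ≤ j) : m * (1 / 2 ^ k : ℝ) ≤ md k j - md k i := by
  have : ((i + m : ℕ) : ℝ) ≤ j := by exact_mod_cast h
  push_cast at this
  unfold md dy
  rw [add_sub_add_right_eq_sub, ← sub_div, mul_one_div]
  gcongr
  linarith

lemma slopes_false {A B W s1 s2 l : ℝ} (hW : W ^ 2 = A ^ 2 + B ^ 2) (hn : 0 < W) (b1 : 0 ≤ s1)
    (b5 : s1 ≤ 1) (hl : 2 < l) (k1 : |A + B * s1| * (5 * l) < 2 * W)
    (k2 : |A + B * s2| * (5 * l) < 2 * W) (q4 : 2 < (s2 - s1) * l) : False := by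
  have hs : 0 ≤ s2 - s1 := by
    by_contra! hcon
    nlinarith
  have q1 : |A + B * s1| < W / 5 := by
    by_contra! hcon
    nlinarith
  have q2 : |A| ≤ |A + B * s1| + |B| := by
    have e1 : |B * s1| ≤ |B| := by
      rw [abs_mul, abs_of_nonneg b1]; exact mul_le_of_le_one_right (abs_nonneg _) b5
    have e2 : |A| = |(A + B * s1) - B * s1| := by ring_nf
    rw [e2]
    exact (abs_sub _ _).trans (by linarith)
  have q3 : |B| * (s2 - s1) * (5 * l) < 4 * W := by
    have e1 : |B| * (s2 - s1) = |B * s2 - B * s1| := by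
      rw [← mul_sub, abs_mul, abs_of_nonneg hs]
    have e2 : |B * s2 - B * s1| ≤ |A + B * s2| + |A + B * s1| := by
      have := abs_sub (A + B * s2) (A + B * s1)
      rwa [add_sub_add_left_eq_sub] at this
    rw [e1]
    have : |B * s2 - B * s1| * (5 * l) ≤ (|A + B * s2| + |A + B * s1|) * (5 * l) := by
      gcongr
    linarith
  have q5 : |B| * 10 ≤ 4 * W := by
    have := mul_le_mul_of_nonneg_left q4.le (abs_nonneg B)
    linarith
  have h1 : A ^ 2 ≤ (3 / 5 * W) ^ 2 := by
    rw [← sq_abs A]; exact pow_le_pow_left₀ (abs_nonneg _) (by linarith) 2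
  have h2 : B ^ 2 ≤ (2 / 5 * W) ^ 2 := by
    rw [← sq_abs B]; exact pow_le_pow_left₀ (abs_nonneg _) (by linarith) 2
  nlinarith [mul_pos hn hn]

lemma card_cap_le (h : Crv γ γR γL) (hR : 1 ≤ R) {k : ℕ} {w : E2} {c : ℝ} (hw : w ≠ 0)
    {Y : Finset ℕ} (hY : ∀ i ∈ Y, i < 2 ^ k ∧ ¬ Flat γR γL R k i ∧
      pt γ (md k i) ∈ cap γ w c R⁻¹) : Y.card ≤ 12 := by
  by_contra! hc
  have hR0 : 0 < R := by linarith
  set e := Y.orderEmbOfCardLe (k := 13) (by omega)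
  have he : ∀ a, e a < 2 ^ k ∧ ¬ Flat γR γL R k (e a) ∧ pt γ (md k (e a)) ∈ cap γ w c R⁻¹ :=
    fun a => hY _ (Y.orderEmbOfCardLe_mem _ a)
  have hlt : ∀ a b : Fin 13, a < b → e a < e b := fun a b hab => e.lt_iff_lt.2 hab
  have n0 := hlt 0 1 (by decide)
  have n1 := hlt 1 2 (by decide)
  have n2 := hlt 2 3 (by decide)
  have n3 := hlt 3 4 (by decide)
  have n4 := hlt 4 5 (by decide)
  have n5 := hlt 5 6 (by decide)
  have n6 := hlt 6 7 (by decide)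
  have n7 := hlt 7 8 (by decide)
  have n8 := hlt 8 9 (by decide)
  have n9 := hlt 9 10 (by decide)
  have n10 := hlt 10 11 (by decide)
  have n11 := hlt 11 12 (by decide)
  have hn := norm_pos_iff.2 hw
  set L : ℝ := 1 / 2 ^ k with hL
  have hL0 : 0 < L := by positivity
  have d1 : 5 * L ≤ md k (e 5) - md k (e 0) := by
    have := md_sub (k := k) (m := 5) (show e 0 + 5 ≤ e 5 by omega)
    rwa [Nat.cast_ofNat] at this
  have d2 : 5 * L ≤ md k (e 12) - md k (e 7) := by
    have := md_sub (k := k) (m := 5) (show e 7 + 5 ≤ e 12 by omega)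
    rwa [Nat.cast_ofNat] at this
  have hm : ∀ a, md k (e a) ∈ Ico (0 : ℝ) 1 := fun a => md_mem (he a).1
  have c1 := cap_chord hw (he 0).2.2 (he 5).2.2
  have c2 := cap_chord hw (he 7).2.2 (he 12).2.2
  set p := dy k (e 6) with hp
  set r := dy k (e 6 + 1) with hr
  have hpm := dy_mem _ _ (he 6).1
  have hrm := dy_succ_mem _ _ (he 6).1
  have o1 : md k (e 5) < p := (md_lt_dy k _).trans_le (dy_le_dy (by omega))
  have o2 : r < md k (e 7) := (dy_le_dy (by omega)).trans_lt (dy_lt_md k _)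
  have hfl := (he 6).2.1
  unfold Flat at hfl
  rw [not_le, ← hL, ← hp, ← hr, div_lt_iff₀ hR0] at hfl
  have hv1 := h.var_le_one (he 6).1
  rw [← hp, ← hr] at hv1
  set x1 := md k (e 5) - md k (e 0) with hx1
  set x2 := md k (e 12) - md k (e 7) with hx2
  have hx1p : 0 < x1 := by linarith
  have hx2p : 0 < x2 := by linarith
  obtain ⟨s1, hs1⟩ : ∃ s, s * x1 = γ (md k (e 5)) - γ (md k (e 0)) :=
    ⟨_, div_mul_cancel₀ _ hx1p.ne'⟩
  obtain ⟨s2, hs2⟩ : ∃ s, s * x2 = γ (md k (e 12)) - γ (md k (e 7)) :=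
    ⟨_, div_mul_cancel₀ _ hx2p.ne'⟩
  have b1 : 0 ≤ s1 := by
    have := h.right _ (hm 0) _ (Ico_subset_Icc_self (hm 5))
    have h0 := h.R_nonneg (hm 0)
    have : γR (md k (e 0)) * x1 ≤ s1 * x1 := by linarith
    exact h0.trans (le_of_mul_le_mul_right this hx1p)
  have b2 : s1 ≤ γR p := by
    have h1 := h.right _ (hm 5) _ (Ico_subset_Icc_self (hm 0))
    have h2 : s1 * x1 ≤ γR (md k (e 5)) * x1 := by linarith
    exact (le_of_mul_le_mul_right h2 hx1p).trans (h.R_mono (hm 5) hpm o1.le)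
  have b3 : γL r ≤ s2 := by
    have h1 := h.right _ (hm 7) _ (Ico_subset_Icc_self (hm 12))
    have h2 : γR (md k (e 7)) * x2 ≤ s2 * x2 := by linarith
    exact (h.L_le_R hrm.1 o2 (hm 7).2).trans (le_of_mul_le_mul_right h2 hx2p)
  have b4 : γL r ≤ 1 := h.L_le_one hrm
  have b5 : s1 ≤ 1 := b2.trans (h.R_le_L hpm.1 (by linarith [dy_lt_md k (e 6), md_lt_dy k (e 6)]) hrm.2) |>.trans b4
  have hRL : 2 < R * L := by nlinarith [mul_pos hR0 hL0]
  have key : ∀ {x s D : ℝ}, 0 < x → 5 * L ≤ x → s * x = D →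
      |w 0 * x + w 1 * D| < 2 * R⁻¹ * ‖w‖ → |w 0 + w 1 * s| * (5 * (R * L)) < 2 * ‖w‖ := by
    intro x s D hx hxL hsD hb
    rw [← hsD, show w 0 * x + w 1 * (s * x) = (w 0 + w 1 * s) * x by ring, abs_mul,
      abs_of_pos hx] at hb
    have : |w 0 + w 1 * s| * (5 * L) ≤ |w 0 + w 1 * s| * x := by gcongr
    have h2 : |w 0 + w 1 * s| * (5 * L) * R < 2 * R⁻¹ * ‖w‖ * R :=
      mul_lt_mul_of_pos_right (this.trans_lt hb) hR0
    rw [show 2 * R⁻¹ * ‖w‖ * R = 2 * ‖w‖ * (R⁻¹ * R) by ring, inv_mul_cancel₀ hR0.ne'] at h2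
    linarith
  have k1 := key hx1p d1 hs1 c1
  have k2 := key hx2p d2 hs2 c2
  refine slopes_false (norm_sq_E2 w) hn b1 b5 hRL k1 k2 ?_
  have : (γL r - γR p) * (R * L) ≤ (s2 - s1) * (R * L) := by gcongr
  linarith

open Classical in
lemma card_not_flat_le (h : Crv γ γR γL) (hR : 1 ≤ R) (k : ℕ) :
    ((Finset.range (2 ^ k)).filter fun i => ¬ Flat γR γL R k i).card ≤ 12 * capNumber γ R⁻¹ := by
  obtain ⟨w, c, hs, hc⟩ := h.capNumber_spec hR
  set Z := (Finset.range (2 ^ k)).filter fun i => ¬ Flat γR γL R k i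
  have hsub : Z ⊆ Finset.univ.biUnion fun j =>
      Z.filter fun i => pt γ (md k i) ∈ cap γ (w j) (c j) R⁻¹ := fun i hi => by
    have hi' := Finset.mem_range.1 (Finset.mem_filter.1 hi).1
    obtain ⟨j, hj⟩ := mem_iUnion.1 (hc (pt_mem (Ico_subset_Icc_self (md_mem hi'))))
    exact Finset.mem_biUnion.2 ⟨j, Finset.mem_univ _, Finset.mem_filter.2 ⟨hi, hj⟩⟩
  refine (Finset.card_le_card hsub).trans (Finset.card_biUnion_le.trans ?_)
  refine (Finset.sum_le_card_nsmul _ _ 12 fun j _ => ?_).trans (by simp [mul_comm])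
  refine h.card_cap_le hR (hs j).1 (c := c j) (k := k) fun i hi => ?_
  obtain ⟨h1, h2⟩ := Finset.mem_filter.1 hi
  obtain ⟨h3, h4⟩ := Finset.mem_filter.1 h1
  exact ⟨Finset.mem_range.1 h3, h4, h2⟩

lemma card_leaves_le (h : Crv γ γR γL) (hR : 1 ≤ R) (k : ℕ) :
    (leaves γR γL R k).card ≤ 24 * capNumber γ R⁻¹ := by
  classical
  cases k with
  | zero =>
    have h1 : (leaves γR γL R 0).card ≤ 1 := by
      refine (Finset.card_le_card (Finset.filter_subset _ _)).trans (by simp)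
    have := h.capNumber_pos hR
    omega
  | succ k =>
    set Z := (Finset.range (2 ^ k)).filter fun i => ¬ Flat γR γL R k i
    have hsub : leaves γR γL R (k + 1) ⊆
        Z.image (fun i => 2 * i) ∪ Z.image (fun i => 2 * i + 1) := fun i hi => by
      obtain ⟨h1, -, h2⟩ := mem_leaves.1 hi
      have hZ : i / 2 ∈ Z := Finset.mem_filter.2
        ⟨Finset.mem_range.2 (by rw [pow_succ] at h1; omega), h2 k rfl⟩
      rw [Finset.mem_union, Finset.mem_image, Finset.mem_image]
      rcases Nat.mod_two_eq_zero_or_one i with h0 | h0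
      · exact .inl ⟨_, hZ, by omega⟩
      · exact .inr ⟨_, hZ, by omega⟩
    have h1 := Finset.card_le_card hsub
    have h2 := Finset.card_union_le (Z.image (fun i => 2 * i)) (Z.image (fun i => 2 * i + 1))
    have h3 : (Z.image (fun i => 2 * i)).card ≤ Z.card := Finset.card_image_le
    have h4 : (Z.image (fun i => 2 * i + 1)).card ≤ Z.card := Finset.card_image_le
    have h5 : Z.card ≤ 12 * capNumber γ R⁻¹ := by convert h.card_not_flat_le hR k
    omega

end Crv

/-! ### Fourier projections to the leaves of one generation -/

lemma BL.modulate {S : Set E2} {f : E2 → ℂ} (hf : BL S f) (η : E2) :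
    BL {ξ | ξ + η ∈ S} (fun x => (Real.fourierChar (-inner ℝ η x) : ℂ) * f x) := by
  have hc : Continuous fun x : E2 => (Real.fourierChar (-inner ℝ η x) : ℂ) := by fun_prop
  refine ⟨hf.1.congr_norm (hc.mul hf.cont).aestronglyMeasurable
    (ae_of_all _ fun x => by rw [norm_mul, Circle.norm_coe, one_mul]), ?_⟩
  obtain ⟨-, g, hg, hS, rfl⟩ := hf
  refine ⟨fun ξ => g (ξ + η), hg.comp_add_right η, fun ξ hξ => hS _ hξ, ?_⟩
  ext x
  rw [Real.fourierInv_eq, Real.fourierInv_eq, ← integral_add_right_eq_self _ η,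
    ← integral_const_mul]
  refine integral_congr_ae (ae_of_all _ fun ξ => ?_)
  simp only [Circle.smul_def, smul_eq_mul, inner_add_left, AddChar.map_add_eq_mul,
    Circle.coe_mul, AddChar.map_neg_eq_inv, Circle.coe_inv]
  have := Circle.coe_ne_zero (Real.fourierChar (inner ℝ η x))
  field_simp

lemma measurableSet_strip {J : Set ℝ} (hJ : MeasurableSet J) : MeasurableSet {ξ : E2 | ξ 0 ∈ J} :=
  (show Measurable fun ξ : E2 => ξ 0 by fun_prop) hJ

lemma fourierProj_bl {γ : ℝ → ℝ} {r : ℝ} {J : Set ℝ} (hJ : MeasurableSet J) (f : SchwartzMap E2 ℂ)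
    (hf : Function.support (𝓕 ⇑f) ⊆ vnbhd γ r) :
    BL {ξ | ξ 0 ∈ J ∧ ξ ∈ vnbhd γ r} (fourierProj f J) := by
  have hs := measurableSet_strip hJ
  have hi : Integrable (𝓕 ⇑f) := by
    rw [← SchwartzMap.fourier_coe]; exact SchwartzMap.integrable _
  have h2 : MemLp (𝓕 ⇑f) 2 := by
    rw [← SchwartzMap.fourier_coe]; exact SchwartzMap.memLp (𝓕 f) 2
  refine BL.of_fourierInv (hi.indicator hs) (h2.indicator hs) fun ξ hξ => ?_
  by_cases h : ξ 0 ∈ J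
  · rw [indicator_of_mem (by exact h)]
    by_contra hne
    exact hξ ⟨h, hf hne⟩
  · exact indicator_of_notMem (by exact h) _

lemma md_sub_md (k i j : ℕ) : md k j - md k i = 1 / 2 ^ k * j - 1 / 2 ^ k * i := by
  unfold md dy; ring

/-- The dyadic interval with index `i` of generation `k`. -/
def dyI (k i : ℕ) : Set ℝ := Icc (dy k i) (dy k (i + 1))

namespace Crv

variable {γ γR γL : ℝ → ℝ} {R : ℝ}

lemma card_leaves_slope_le (h : Crv γ γR γL) (hR : 0 < R) (k : ℕ) (x : ℝ) :
    ((leaves γR γL R k).filter fun i =>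
      x ≤ γR (md k i) ∧ γR (md k i) < x + 2 ^ k / R).card ≤ 4 := by
  set F := (leaves γR γL R k).filter fun i =>
      x ≤ γR (md k i) ∧ γR (md k i) < x + 2 ^ k / R with hF
  cases k with
  | zero =>
    have hs : F ⊆ Finset.range (2 ^ 0) := fun i hi =>
      Finset.mem_range.2 (mem_leaves.1 (Finset.mem_filter.1 hi).1).1
    exact (Finset.card_le_card hs).trans (by simp)
  | succ k =>
    set P := F.image (· / 2) with hP
    have hcard : P.card ≤ 2 := by
      by_contra! hc
      set e := P.orderEmbOfCardLe (k := 3) (by omega)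
      have he : ∀ a, ∃ i ∈ F, i / 2 = e a := fun a =>
        Finset.mem_image.1 (P.orderEmbOfCardLe_mem _ a)
      have h01 : e 0 < e 1 := e.lt_iff_lt.2 (by decide)
      have h12 : e 1 < e 2 := e.lt_iff_lt.2 (by decide)
      obtain ⟨i, hi, hie⟩ := he 0
      obtain ⟨j, hj, hje⟩ := he 1
      obtain ⟨l, hl, hle⟩ := he 2
      obtain ⟨hi1, hi2, -⟩ := Finset.mem_filter.1 hi
      obtain ⟨hj1, -⟩ := Finset.mem_filter.1 hj
      obtain ⟨hl1, -, hl2⟩ := Finset.mem_filter.1 hl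
      have hi3 := (mem_leaves.1 hi1).1
      have hl3 := (mem_leaves.1 hl1).1
      obtain ⟨hj3, -, hj4⟩ := mem_leaves.1 hj1
      have hj5 : j / 2 < 2 ^ k := by rw [pow_succ] at hj3; omega
      have hfl := hj4 k rfl
      unfold Flat at hfl
      rw [not_le, div_mul_eq_mul_div, one_mul, div_lt_div_iff₀ hR (by positivity)] at hfl
      have a1 : γR (md (k + 1) i) ≤ γR (dy k (j / 2)) :=
        h.R_mono (md_mem hi3) (dy_mem _ _ hj5) ((md_lt_dy _ _).le.trans
          ((le_dy_half k i).trans (dy_le_dy (by omega))))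
      have a2 : γL (dy k (j / 2 + 1)) ≤ γR (md (k + 1) l) :=
        h.L_le_R (dy_succ_pos _ _) ((dy_le_dy (by omega)).trans_lt
          ((dy_half_le k l).trans_lt (dy_lt_md _ _))) (md_mem hl3).2
      have a3 : γL (dy k (j / 2 + 1)) - γR (dy k (j / 2)) < 2 ^ (k + 1) / R := by linarith
      rw [lt_div_iff₀ hR, pow_succ] at a3
      linarith
    have hsub : F ⊆ P.image (fun i => 2 * i) ∪ P.image (fun i => 2 * i + 1) := fun i hi => by
      have hiP : i / 2 ∈ P := Finset.mem_image_of_mem _ hi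
      rw [Finset.mem_union, Finset.mem_image, Finset.mem_image]
      rcases Nat.mod_two_eq_zero_or_one i with h0 | h0
      · exact .inl ⟨_, hiP, by omega⟩
      · exact .inr ⟨_, hiP, by omega⟩
    have h1 := Finset.card_le_card hsub
    have h2 := Finset.card_union_le (P.image (fun i => 2 * i)) (P.image (fun i => 2 * i + 1))
    have h3 : (P.image (fun i => 2 * i)).card ≤ P.card := Finset.card_image_le
    have h4 : (P.image (fun i => 2 * i + 1)).card ≤ P.card := Finset.card_image_le
    omega

/-- The family of leaves of one generation. -/
def fam (h : Crv γ γR γL) (hR : 1 ≤ R) {b n : ℕ} (hb : 16 ≤ b) (hbR : R ≤ b ^ n) (k : ℕ) : Fam :=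
  have hR0 : 0 < R := zero_lt_one.trans_le hR
  have hb1 : (16 : ℝ) ≤ b := by exact_mod_cast hb
  have hS : 16 * ((2 : ℝ) ^ k) ≤ b ^ (n + 1) * (2 ^ k / R) := by
    rw [pow_succ, mul_div_assoc', le_div_iff₀ hR0]
    have : R * 16 ≤ b ^ n * b := mul_le_mul hbR hb1 (by norm_num) (by positivity)
    nlinarith [pow_pos (two_pos (α := ℝ)) k]
  { L := 1 / 2 ^ k
    ρ := 2 ^ k / R
    s := 0
    S := b ^ (n + 1) * (2 ^ k / R)
    b := b
    c := fun i => γ (md k i)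
    v := fun i => γR (md k i)
    X := leaves γR γL R k
    hL := by positivity
    hρ := by positivity
    hS := le_mul_of_one_le_left (by positivity) (one_le_pow₀ (by linarith))
    hb := hb
    slope_mem := fun i hi => by
      have hm := md_mem (mem_leaves.1 hi).1
      refine ⟨h.R_nonneg hm, ?_⟩
      have h1 := h.R_le_L hm.1 hm.2 le_rfl
      have h2 := h.hi
      have h3 : (1 : ℝ) ≤ 2 ^ k := one_le_pow₀ (by norm_num)
      linarith
    supp := fun i hi j hj => by
      have := h.right _ (md_mem (mem_leaves.1 hi).1) _
        (Ico_subset_Icc_self (md_mem (mem_leaves.1 hj).1))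
      rw [← md_sub_md]
      linarith
    sparse := h.card_leaves_slope_le hR0 k }

/-- The decoupling inequality for the leaves of one generation. -/
lemma eLpNorm_leaves_le (h : Crv γ γR γL) (hR : 1 ≤ R) {b n : ℕ} (hb : 16 ≤ b) (hbR : R ≤ b ^ n)
    (k : ℕ) {q : ℝ≥0∞} (hq : 2 ≤ q) (hq6 : q ≤ 6) (f : SchwartzMap E2 ℂ)
    (hf : Function.support (𝓕 ⇑f) ⊆ vnbhd γ R⁻¹) :
    eLpNorm (fun x => ∑ i ∈ leaves γR γL R k, fourierProj f (dyI k i) x) q volume ≤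
      ENNReal.ofReal (Fam.sqC n * b ^ 17) *
        (∑ i ∈ leaves γR γL R k, eLpNorm (fourierProj f (dyI k i)) q volume ^ 2)
          ^ ((1 : ℝ) / 2) := by
  have hR0 : 0 < R := zero_lt_one.trans_le hR
  set L : ℝ := 1 / 2 ^ k with hL
  have hL0 : 0 < L := by positivity
  set η : E2 := !₂[L / 2, 0] with hη
  have η0 : η 0 = L / 2 := rfl
  have η1 : η 1 = 0 := rfl
  set F : ℕ → E2 → ℂ := fun i x =>
    (Real.fourierChar (-inner ℝ η x) : ℂ) * fourierProj f (dyI k i) x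
  have hleaf : (h.fam hR hb hbR k).Leaf F := fun i hi => by
    obtain ⟨hi1, hi2, -⟩ := mem_leaves.1 hi
    refine ((fourierProj_bl measurableSet_Icc f hf).modulate η).mono fun ξ hξ => ?_
    obtain ⟨⟨h1, h2⟩, -, h3⟩ := hξ
    simp only [PiLp.add_apply, η0, η1, add_zero] at h1 h2 h3
    have hm : md k i = L * i + L / 2 := by unfold md dy; rw [hL]; ring
    have hl : dy k i = L * i := by unfold dy; rw [hL]; ring
    have hr : dy k (i + 1) = L * i + L := by rw [dy_succ, hl]
    have habs : |ξ 0 - L * i| ≤ L / 2 := by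
      rw [abs_le]; constructor <;> linarith
    have ht := h.abs_tangent_le (dy_nonneg k i) (dy_le_one hi1) ((dy_lt_md k i).trans (md_lt_dy k i))
      ⟨h1, h2⟩ ⟨dy_lt_md k i, md_lt_dy k i⟩
    rw [show ξ 0 + L / 2 - md k i = ξ 0 - L * i by rw [hm]; ring] at ht
    unfold Flat at hi2
    rw [← hL] at hi2
    have hv := h.var_nonneg hi1
    have h5 : (γL (dy k (i + 1)) - γR (dy k i)) * |ξ 0 - L * i| ≤ 1 / R :=
      calc _ ≤ (γL (dy k (i + 1)) - γR (dy k i)) * (L / 2) := by gcongr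
        _ = L * (γL (dy k (i + 1)) - γR (dy k i)) / 2 := by ring
        _ ≤ 2 / R / 2 := by gcongr
        _ = 1 / R := by ring
    have e1 : 2 * (L / 4) = L / 2 := by ring
    have e2 : 2 * (L * (2 ^ k / R)) = R⁻¹ + 1 / R := by rw [hL]; field_simp; norm_num
    change |ξ 0 - L * i| ≤ 2 * (L / 4) ∧
      |ξ 1 - γ (md k i) - γR (md k i) * (ξ 0 - L * i)| ≤ 2 * (L * (2 ^ k / R))
    rw [e1, e2]
    refine ⟨habs, ?_⟩
    have := abs_add_le (ξ 1 - γ (ξ 0 + L / 2))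
      (γ (ξ 0 + L / 2) - γ (md k i) - γR (md k i) * (ξ 0 - L * i))
    rw [show ξ 1 - γ (ξ 0 + L / 2) + (γ (ξ 0 + L / 2) - γ (md k i) -
      γR (md k i) * (ξ 0 - L * i)) = ξ 1 - γ (md k i) - γR (md k i) * (ξ 0 - L * i) by ring] at this
    linarith
  have hX : ∀ i ∈ (h.fam hR hb hbR k).X, i < (h.fam hR hb hbR k).b ^ n := fun i hi => by
    have h1 := (mem_leaves.1 hi).1
    have h2 := (h.pow_le_of_leaf hR hi).trans hbR
    exact h1.trans_le (by exact_mod_cast h2)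
  have key := Fam.eLpNorm_sum_le hleaf hq hq6 hX rfl
  have hN : ∀ (G : E2 → ℂ),
      eLpNorm (fun x => (Real.fourierChar (-inner ℝ η x) : ℂ) * G x) q volume =
        eLpNorm G q volume := fun G =>
    eLpNorm_congr_norm_ae (ae_of_all _ fun x => by rw [norm_mul, Circle.norm_coe, one_mul])
  have e1 : (fun x => ∑ i ∈ (h.fam hR hb hbR k).X, F i x) = fun x =>
      (Real.fourierChar (-inner ℝ η x) : ℂ) *
        ∑ i ∈ leaves γR γL R k, fourierProj f (dyI k i) x := by
    funext x; rw [Finset.mul_sum]; rfl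
  rw [e1, hN] at key
  simp only [F, hN] at key
  exact key

end Crv

/-! ### The ideal partition -/

/-- The generation `k` dyadic index of a point. -/
def dig (x : ℝ) (k : ℕ) : ℕ := ⌊x * 2 ^ k⌋₊

lemma dig_succ (x : ℝ) (k : ℕ) : dig x (k + 1) / 2 = dig x k := by
  unfold dig
  rw [← Nat.floor_div_ofNat, pow_succ]
  congr 1
  rw [← mul_assoc, mul_div_assoc]
  norm_num

lemma dig_lt {x : ℝ} (h0 : 0 ≤ x) (h1 : x < 1) (k : ℕ) : dig x k < 2 ^ k := by
  rw [dig, Nat.floor_lt (by positivity)]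
  push_cast
  exact mul_lt_of_lt_one_left (by positivity) h1

lemma mem_dyI_iff {x : ℝ} (h0 : 0 ≤ x) {k i : ℕ} (hx : x ≠ dy k (i + 1)) :
    x ∈ dyI k i ↔ i = dig x k := by
  have h2 : (0 : ℝ) < 2 ^ k := by positivity
  have h3 : x ∈ dyI k i ↔ dy k i ≤ x ∧ x < dy k (i + 1) :=
    and_congr_right fun _ => ⟨fun h => h.lt_of_ne hx, le_of_lt⟩
  rw [h3, dig, eq_comm, Nat.floor_eq_iff (by positivity)]
  unfold dy
  rw [div_le_iff₀ h2, lt_div_iff₀ h2]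
  push_cast
  rfl

lemma mem_dyI_dig {x : ℝ} (h0 : 0 ≤ x) (k : ℕ) : x ∈ dyI k (dig x k) := by
  have h2 : (0 : ℝ) < 2 ^ k := by positivity
  unfold dyI dy dig
  rw [mem_Icc, div_le_iff₀ h2, le_div_iff₀ h2]
  push_cast
  exact ⟨Nat.floor_le (by positivity), (Nat.lt_floor_add_one _).le⟩

lemma volume_hyperplane (c : ℝ) : volume {ξ : E2 | ξ 0 = c} = 0 := by
  have h2 : volume {f : Fin 2 → ℝ | f 0 = c} = 0 := Measure.pi_hyperplane _ _ _
  have hm : MeasurableSet {f : Fin 2 → ℝ | f 0 = c} :=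
    measurableSet_eq_fun (measurable_pi_apply 0) measurable_const
  rw [← h2]
  exact (PiLp.volume_preserving_ofLp (Fin 2)).measure_preimage hm.nullMeasurableSet

lemma ae_ne_dy : ∀ᵐ ξ : E2, ∀ k i : ℕ, ξ 0 ≠ dy k i := by
  rw [ae_all_iff]; intro k
  rw [ae_all_iff]; intro i
  rw [ae_iff]
  simpa using volume_hyperplane (dy k i)

namespace Crv

variable {γ γR γL : ℝ → ℝ} {R : ℝ}

lemma sum_indicator_leaves (h : Crv γ γR γL) (hR : 0 < R) {K : ℕ} (hK : R ≤ 2 * 2 ^ K)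
    {g : E2 → ℂ} (hg : Function.support g ⊆ vnbhd γ R⁻¹) {ξ : E2} (hξ : ∀ k i : ℕ, ξ 0 ≠ dy k i) :
    ∑ k ∈ Finset.range (K + 1), ∑ i ∈ leaves γR γL R k,
      indicator {ξ : E2 | ξ 0 ∈ dyI k i} g ξ = g ξ := by
  classical
  by_cases h0 : g ξ = 0
  · rw [h0]
    exact Finset.sum_eq_zero fun k _ => Finset.sum_eq_zero fun i _ => by
      rw [indicator_apply, h0, ite_self]
  obtain ⟨hx0, hx1⟩ := (hg h0).1
  have hx1' : ξ 0 < 1 := hx1.lt_of_ne fun e => hξ 0 1 (by rw [e]; simp [dy])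
  have hu := dig_lt hx0 hx1'
  have hin : ∀ k, ∑ i ∈ leaves γR γL R k, indicator {ξ : E2 | ξ 0 ∈ dyI k i} g ξ =
      if dig (ξ 0) k ∈ leaves γR γL R k then g ξ else 0 := fun k => by
    rw [← Finset.sum_ite_eq' (leaves γR γL R k) (dig (ξ 0) k) fun _ => g ξ]
    refine Finset.sum_congr rfl fun i _ => ?_
    rw [indicator_apply]
    exact if_congr (mem_dyI_iff hx0 (hξ _ _)) rfl rfl
  obtain ⟨k, hk, hkl⟩ := h.exists_leaf hR hK hu (dig_succ _)
  simp only [hin]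
  rw [Finset.sum_eq_single_of_mem k (Finset.mem_range.2 (by omega)), if_pos hkl]
  exact fun l _ hlk => if_neg fun hl => hlk (h.leaf_unique hu (dig_succ _) hl hkl)

/-- A function is the sum of its Fourier projections to the leaves. -/
lemma eq_sum_fourierProj (h : Crv γ γR γL) (hR : 0 < R) {K : ℕ} (hK : R ≤ 2 * 2 ^ K)
    (f : SchwartzMap E2 ℂ) (hf : Function.support (𝓕 ⇑f) ⊆ vnbhd γ R⁻¹) :
    ⇑f = fun x => ∑ k ∈ Finset.range (K + 1), ∑ i ∈ leaves γR γL R k,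
      fourierProj f (dyI k i) x := by
  have hi : Integrable (𝓕 ⇑f) := by
    rw [← SchwartzMap.fourier_coe]; exact SchwartzMap.integrable _
  have hind : ∀ k i, Integrable (indicator {ξ : E2 | ξ 0 ∈ dyI k i} (𝓕 ⇑f)) := fun k i =>
    hi.indicator (measurableSet_strip measurableSet_Icc)
  have e1 : ∀ k : ℕ, 𝓕⁻ ((fun ξ => ∑ i ∈ leaves γR γL R k,
      indicator {ξ : E2 | ξ 0 ∈ dyI k i} (𝓕 ⇑f) ξ) : E2 → ℂ) =
        fun x => ∑ i ∈ leaves γR γL R k, fourierProj f (dyI k i) x := fun k =>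
    fourierInv_sum _ fun i _ => hind k i
  have e2 := fourierInv_sum (Finset.range (K + 1)) (g := fun k ξ =>
    ∑ i ∈ leaves γR γL R k, indicator {ξ : E2 | ξ 0 ∈ dyI k i} (𝓕 ⇑f) ξ)
    fun k _ => integrable_finsetSum _ fun i _ => hind k i
  simp only [e1] at e2
  rw [← e2]
  nth_rewrite 1 [← f.continuous.fourierInv_fourier_eq f.integrable hi]
  funext x
  refine Real.fourierInv_congr_ae ?_ x
  filter_upwards [ae_ne_dy] with ξ hξ
  exact (h.sum_indicator_leaves hR hK hf hξ).symm

/-- The leaves as pairs of endpoints. -/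
def part (γR γL : ℝ → ℝ) (R : ℝ) (K : ℕ) : Finset (ℝ × ℝ) :=
  (Finset.range (K + 1)).biUnion fun k =>
    (leaves γR γL R k).image fun i => (dy k i, dy k (i + 1))

lemma mem_part {K : ℕ} {p : ℝ × ℝ} : p ∈ part γR γL R K ↔
    ∃ k ≤ K, ∃ i ∈ leaves γR γL R k, (dy k i, dy k (i + 1)) = p := by
  simp [part]

lemma part_covers (h : Crv γ γR γL) (hR : 0 < R) {K : ℕ} (hK : R ≤ 2 * 2 ^ K) :
    Icc (0 : ℝ) 1 ⊆ ⋃ p ∈ part γR γL R K, Icc p.1 p.2 := fun x hx => by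
  rw [mem_iUnion₂]
  obtain hx1 | rfl := hx.2.lt_or_eq
  · obtain ⟨k, hk, hl⟩ := h.exists_leaf hR hK (dig_lt hx.1 hx1) (dig_succ _)
    exact ⟨_, mem_part.2 ⟨k, hk, _, hl, rfl⟩, mem_dyI_dig hx.1 k⟩
  · have hp : ∀ k : ℕ, 1 ≤ 2 ^ k := fun k => Nat.one_le_two_pow
    obtain ⟨k, hk, hl⟩ := h.exists_leaf hR hK (u := fun k => 2 ^ k - 1)
      (fun k => by have := hp k; omega) (fun k => by have := hp k; rw [pow_succ]; omega)
    refine ⟨_, mem_part.2 ⟨k, hk, _, hl, rfl⟩, dy_le_one (Nat.sub_le _ _), ?_⟩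
    simp [dy, Nat.sub_add_cancel (hp k)]

lemma card_part_le (h : Crv γ γR γL) (hR : 1 ≤ R) (K : ℕ) :
    (part γR γL R K).card ≤ (K + 1) * (24 * capNumber γ R⁻¹) := by
  refine Finset.card_biUnion_le.trans ((Finset.sum_le_card_nsmul _ _ _ fun k _ =>
    Finset.card_image_le.trans (h.card_leaves_le hR k)).trans ?_)
  simp

lemma sum_leaves_le_part {K k : ℕ} (hk : k ≤ K) (G : ℝ × ℝ → ℝ≥0∞) :
    ∑ i ∈ leaves γR γL R k, G (dy k i, dy k (i + 1)) ≤ ∑ p ∈ part γR γL R K, G p := by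
  have hinj : ∀ i ∈ leaves γR γL R k, ∀ j ∈ leaves γR γL R k,
      (dy k i, dy k (i + 1)) = (dy k j, dy k (j + 1)) → i = j := fun i _ j _ e => by
    have := (Prod.mk.inj e).1
    unfold dy at this
    rw [div_left_inj' (by positivity)] at this
    exact_mod_cast this
  rw [← Finset.sum_image (f := G) hinj]
  refine Finset.sum_le_sum_of_subset fun p hp => ?_
  obtain ⟨i, hi, rfl⟩ := Finset.mem_image.1 hp
  exact mem_part.2 ⟨k, hk, i, hi, rfl⟩

/-- The decoupling inequality for the leaves of all generations. -/
lemma eLpNorm_le_part (h : Crv γ γR γL) (hR : 1 ≤ R) {K : ℕ} (hK : R ≤ 2 * 2 ^ K) {b n : ℕ}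
    (hb : 16 ≤ b) (hbR : R ≤ b ^ n) {q : ℝ≥0∞} (hq : 2 ≤ q) (hq6 : q ≤ 6)
    (f : SchwartzMap E2 ℂ) (hf : Function.support (𝓕 ⇑f) ⊆ vnbhd γ R⁻¹) :
    eLpNorm f q volume ≤ (K + 1 : ℕ) * (ENNReal.ofReal (Fam.sqC n * b ^ 17) *
      (∑ p ∈ part γR γL R K, eLpNorm (fourierProj f (Icc p.1 p.2)) q volume ^ 2)
        ^ ((1 : ℝ) / 2)) := by
  have hR0 : 0 < R := zero_lt_one.trans_le hR
  have hm : ∀ k ∈ Finset.range (K + 1), AEStronglyMeasurable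
      (fun x => ∑ i ∈ leaves γR γL R k, fourierProj f (dyI k i) x) volume := fun k _ =>
    (continuous_finsetSum _ fun i _ =>
      (fourierProj_bl measurableSet_Icc f hf).cont).aestronglyMeasurable
  calc eLpNorm f q volume
      = eLpNorm (∑ k ∈ Finset.range (K + 1), fun x =>
          ∑ i ∈ leaves γR γL R k, fourierProj f (dyI k i) x) q volume := by
        congr 1
        rw [h.eq_sum_fourierProj hR0 hK f hf]
        funext x
        rw [Finset.sum_apply, ← h.eq_sum_fourierProj hR0 hK f hf]
    _ ≤ ∑ k ∈ Finset.range (K + 1), eLpNorm (fun x =>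
          ∑ i ∈ leaves γR γL R k, fourierProj f (dyI k i) x) q volume :=
        eLpNorm_sum_le hm (le_trans (by norm_num) hq)
    _ ≤ (Finset.range (K + 1)).card • (ENNReal.ofReal (Fam.sqC n * b ^ 17) *
          (∑ p ∈ part γR γL R K, eLpNorm (fourierProj f (Icc p.1 p.2)) q volume ^ 2)
            ^ ((1 : ℝ) / 2)) := Finset.sum_le_card_nsmul _ _ _ fun k hk => by
        refine (h.eLpNorm_leaves_le hR hb hbR k hq hq6 f hf).trans ?_
        gcongr
        exact sum_leaves_le_part (Nat.lt_succ_iff.1 (Finset.mem_range.1 hk)) fun p =>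
          eLpNorm (fourierProj f (Icc p.1 p.2)) q volume ^ 2
    _ = _ := by rw [Finset.card_range, nsmul_eq_mul]

end Crv

/-- The integer part of the binary logarithm is dominated by any power. -/
lemma log_add_one_le {R δ : ℝ} (hR : 1 ≤ R) (hδ : 0 < δ) {K : ℕ} (hK : 2 ^ K ≤ R) :
    ((K + 1 : ℕ) : ℝ) ≤ (2 / δ + 1) * R ^ δ := by
  have h1 : 1 ≤ R ^ δ := Real.one_le_rpow hR hδ.le
  have h2 := Real.log_le_rpow_div (zero_le_one.trans hR) hδ
  have h3 : K * Real.log 2 ≤ Real.log R := by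
    rw [← Real.log_pow]; exact Real.log_le_log (by positivity) hK
  have h4 : (1 : ℝ) / 2 ≤ Real.log 2 := by have := Real.log_two_gt_d9; linarith
  have h5 : K * (1 / 2 : ℝ) ≤ R ^ δ / δ := (by gcongr : K * (1 / 2 : ℝ) ≤ _).trans (h3.trans h2)
  push_cast
  have h6 : (2 / δ + 1) * R ^ δ = 2 * (R ^ δ / δ) + R ^ δ := by ring
  rw [h6]; linarith

lemma exists_base {R δ : ℝ} (hR : 1 ≤ R) {n : ℕ} (hn : 17 / n ≤ δ) (hn0 : 0 < n) :
    ∃ b : ℕ, 16 ≤ b ∧ R ≤ b ^ n ∧ (b : ℝ) ^ 17 ≤ 16 ^ 17 * R ^ δ := by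
  have hR0 : 0 ≤ R := zero_le_one.trans hR
  have hn' : (0 : ℝ) < n := by exact_mod_cast hn0
  set t : ℝ := R ^ (1 / n : ℝ) with ht
  have ht1 : 1 ≤ t := Real.one_le_rpow hR (by positivity)
  have hb1 : 16 * t ≤ ⌊16 * t⌋₊ + 1 := (Nat.lt_floor_add_one _).le
  have hb2 : (⌊16 * t⌋₊ : ℝ) ≤ 16 * t := Nat.floor_le (by positivity)
  refine ⟨⌊16 * t⌋₊, Nat.le_floor (by push_cast; linarith), ?_, ?_⟩
  · calc R = t ^ n := by
          rw [ht, ← Real.rpow_natCast, ← Real.rpow_mul hR0, one_div_mul_cancel hn'.ne',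
            Real.rpow_one]
      _ ≤ _ := by gcongr; linarith
  · calc (⌊16 * t⌋₊ : ℝ) ^ 17 ≤ (16 * t) ^ 17 := by gcongr
      _ = 16 ^ 17 * R ^ (17 / n : ℝ) := by
          rw [mul_pow, ht, ← Real.rpow_natCast (R ^ _), ← Real.rpow_mul hR0]
          congr 2; push_cast; ring
      _ ≤ _ := by gcongr

end HighLow

theorem statement_2 (ε : ℝ) (hε : 0 < ε) :
    ∃ cε Cε : ℝ, 1 ≤ cε ∧ 1 ≤ Cε ∧
      ∀ R : ℝ, 1 ≤ R → ∀ γ γR γL : ℝ → ℝ,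
        ConvexOn ℝ (Icc (0:ℝ) 1) γ →
        HasOneSidedDerivs γ γR γL 0 1 →
        0 ≤ γR 0 → γR 0 ≤ γL 1 → γL 1 ≤ 1 →
        ∃ 𝒥 : Finset (ℝ × ℝ),
          (∀ p ∈ 𝒥, 0 ≤ p.1 ∧ p.1 ≤ p.2 ∧ p.2 ≤ 1) ∧
          (Icc (0:ℝ) 1 ⊆ ⋃ p ∈ 𝒥, Icc p.1 p.2) ∧
          (∀ p ∈ 𝒥, (p.2 - p.1) * (γL p.2 - γR p.1) ≤ 2 / R) ∧
          ((𝒥.card : ℝ) ≤ cε * R ^ ε * (capNumber γ R⁻¹ : ℝ)) ∧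
          (∀ p ∈ 𝒥, R⁻¹ ≤ p.2 - p.1) ∧
          ∀ q : ℝ≥0∞, 2 ≤ q → q ≤ 6 →
            ∀ f : SchwartzMap E2 ℂ,
              Function.support (𝓕 ⇑f) ⊆ vnbhd γ R⁻¹ →
              eLpNorm (⇑f) q volume ≤
                ENNReal.ofReal (Cε * R ^ ε) *
                  (∑ p ∈ 𝒥, eLpNorm (fourierProj (⇑f) (Icc p.1 p.2)) q volume ^ 2)
                    ^ ((1 : ℝ) / 2) := by
  open HighLow in
  set n := ⌈34 / ε⌉₊ + 1 with hn
  have hn0 : (0 : ℝ) < n := by rw [hn]; positivity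
  have hnε : 17 / (n : ℝ) ≤ ε / 2 := by
    have h1 : 34 / ε ≤ n := (Nat.le_ceil _).trans (by rw [hn]; push_cast; linarith)
    rw [div_le_iff₀ hε] at h1
    rw [div_le_iff₀ hn0]
    linarith
  have hsq : 7 ≤ Fam.sqC n := Fam.sqC_ge n
  have hε2 : 0 < 2 / ε := by positivity
  have hε4 : 0 < 2 / (ε / 2) := by positivity
  refine ⟨(2 / ε + 1) * 24, (2 / (ε / 2) + 1) * (Fam.sqC n * 16 ^ 17), by linarith,
    one_le_mul_of_one_le_of_one_le (by linarith) (by linarith), ?_⟩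
  intro R hR γ γR γL hγ hd lo _ hi
  have h := crv_of_convexOn hγ hd lo hi
  have hR0 : 0 < R := zero_lt_one.trans_le hR
  obtain ⟨K, hK1, hK2⟩ := exists_nat_pow_near hR one_lt_two
  rw [pow_succ'] at hK2
  obtain ⟨b, hb, hbR, hb17⟩ := exists_base hR hnε (by omega)
  refine ⟨Crv.part γR γL R K, ?_, h.part_covers hR0 hK2.le, ?_, ?_, ?_, ?_⟩
  · intro p hp
    obtain ⟨k, -, i, hi, rfl⟩ := Crv.mem_part.1 hp
    exact ⟨dy_nonneg _ _, dy_le_dy (Nat.le_succ i), dy_le_one (Crv.mem_leaves.1 hi).1⟩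
  · intro p hp
    obtain ⟨k, -, i, hi, rfl⟩ := Crv.mem_part.1 hp
    have := (Crv.mem_leaves.1 hi).2.1
    unfold Flat at this
    simpa [dy_succ] using this
  · calc ((Crv.part γR γL R K).card : ℝ)
        ≤ ((K + 1 : ℕ) : ℝ) * (24 * capNumber γ R⁻¹) := by exact_mod_cast h.card_part_le hR K
      _ ≤ (2 / ε + 1) * R ^ ε * (24 * capNumber γ R⁻¹) := by
          gcongr; exact log_add_one_le hR hε hK1
      _ = _ := by ring
  · intro p hp
    obtain ⟨k, -, i, hi, rfl⟩ := Crv.mem_part.1 hp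
    rw [dy_succ, add_sub_cancel_left, one_div]
    exact inv_anti₀ (by positivity) (h.pow_le_of_leaf hR hi)
  · intro q hq hq6 f hf
    refine (h.eLpNorm_le_part hR hK2.le hb hbR hq hq6 f hf).trans ?_
    rw [← mul_assoc, ← ENNReal.ofReal_natCast, ← ENNReal.ofReal_mul (by positivity)]
    refine mul_le_mul_left (ENNReal.ofReal_le_ofReal ?_) _
    calc ((K + 1 : ℕ) : ℝ) * (Fam.sqC n * b ^ 17)
        ≤ ((2 / (ε / 2) + 1) * R ^ (ε / 2)) * (Fam.sqC n * (16 ^ 17 * R ^ (ε / 2))) := by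
          have := log_add_one_le hR (half_pos hε) hK1
          gcongr
      _ = (2 / (ε / 2) + 1) * (Fam.sqC n * 16 ^ 17) * (R ^ (ε / 2) * R ^ (ε / 2)) := by ring
      _ = _ := by rw [← Real.rpow_add hR0, add_halves]

end
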